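/- arXiv:2201.01648 — 10 statements merged into one kernel-verified Lean document; each statement's English description precedes it below -/
import Mathlib

section
/- Let ℱ be the set of complete flags in ℝ³, i.e. pairs (W₁, W₂) of linear subspaces of ℝ³ with W₁ ⊆ W₂, dim W₁ = 1, dim W₂ = 2. Suppose f : ℱ → ℱ is a bijection which is fibration-preserving, i.e. whenever two flags have the same 1-dimensional subspace, their images under f have the same 1-dimensional subspace, and whenever two flags have the same 2-dimensional subspace, their images under f have the same 2-dimensional subspace. Then there exists an invertible matrix g ∈ GL(3,ℝ) such that f(W₁, W₂) = (g·W₁, g·W₂) for every flag (W₁, W₂) ∈ ℱ, where g·W denotes the image of the subspace W under the linear map g. -/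
/-- The manifold of complete flags in `ℝ³`: pairs `(W₁, W₂)` of subspaces with
`W₁ ⊆ W₂`, `dim W₁ = 1`, `dim W₂ = 2`. -/
def Flag3 : Type :=
  {p : Submodule ℝ (Fin 3 → ℝ) × Submodule ℝ (Fin 3 → ℝ) //
    p.1 ≤ p.2 ∧ Module.finrank ℝ p.1 = 1 ∧ Module.finrank ℝ p.2 = 2}

/-- The determinant of the matrix with rows `u`, `v`, `w`. -/
def det3 (u v w : Fin 3 → ℝ) : ℝ := Matrix.det (Matrix.of ![u, v, w])

theorem det3_eq (u v w : Fin 3 → ℝ) : det3 u v w =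
    u 0 * (v 1 * w 2 - v 2 * w 1) - u 1 * (v 0 * w 2 - v 2 * w 0)
      + u 2 * (v 0 * w 1 - v 1 * w 0) := by
  simp [det3, Matrix.det_fin_three]
  ring

theorem det3_mulVec (M : Matrix (Fin 3) (Fin 3) ℝ) (u v w : Fin 3 → ℝ) :
    det3 (M.mulVec u) (M.mulVec v) (M.mulVec w) = M.det * det3 u v w := by
  simp only [det3_eq, Matrix.mulVec, dotProduct, Fin.sum_univ_three, Matrix.det_fin_three]
  ring

theorem det3_eq_zero_iff_exists_finrank_two (u v w : Fin 3 → ℝ) :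
    det3 u v w = 0 ↔
      ∃ W : Submodule ℝ (Fin 3 → ℝ), Module.finrank ℝ W = 2 ∧ u ∈ W ∧ v ∈ W ∧ w ∈ W := by
  rw [det3, ← Matrix.exists_mulVec_eq_zero_iff]
  constructor
  · rintro ⟨x, hx, hM⟩
    have hrow := fun i => congrFun hM i
    refine ⟨LinearMap.ker (dotProductBilin ℝ ℝ x), ?_, ?_, ?_, ?_⟩
    · have hne : dotProductBilin ℝ ℝ x ≠ 0 := by
        intro h
        apply hx
        have := LinearMap.congr_fun h x
        simpa using this
      have := Module.Dual.finrank_ker_add_one_of_ne_zero hne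
      simp at this
      omega
    · simpa [Matrix.mulVec, dotProduct_comm] using hrow 0
    · simpa [Matrix.mulVec, dotProduct_comm] using hrow 1
    · simpa [Matrix.mulVec, dotProduct_comm] using hrow 2
  · rintro ⟨W, hW, hu, hv, hw⟩
    have hlt : W < ⊤ := by
      rw [lt_top_iff_ne_top]
      rintro rfl
      simp at hW
    obtain ⟨l, hl, hWl⟩ := W.exists_le_ker_of_lt_top hlt
    have hdot : ∀ y, dotProduct y (fun i => l (Pi.single i 1)) = l y := by
      intro y
      conv_rhs => rw [LinearMap.pi_apply_eq_sum_univ l y]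
      simp only [dotProduct, smul_eq_mul]
      refine Finset.sum_congr rfl fun i _ => ?_
      congr 2
      ext j
      simp [Pi.single_apply, eq_comm]
    refine ⟨fun i => l (Pi.single i 1), ?_, ?_⟩
    · intro h
      apply hl
      refine LinearMap.ext fun y => ?_
      rw [← hdot y, h, dotProduct_zero, LinearMap.zero_apply]
    · ext i
      fin_cases i
      · exact (hdot u).trans (hWl hu)
      · exact (hdot v).trans (hWl hv)
      · exact (hdot w).trans (hWl hw)

/-- A collinearity-preserving map that fixes the standard projective frame fixes every
projective point. -/
theorem exists_smul_of_det3_iff_of_frame (ψ : (Fin 3 → ℝ) → (Fin 3 → ℝ))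
    (h : ∀ u v w, det3 u v w = 0 ↔ det3 (ψ u) (ψ v) (ψ w) = 0)
    {a b c : ℝ} (ha : a ≠ 0) (hb : b ≠ 0) (hc : c ≠ 0)
    (h₁ : ψ ![1, 0, 0] = ![a, 0, 0]) (h₂ : ψ ![0, 1, 0] = ![0, b, 0])
    (h₃ : ψ ![0, 0, 1] = ![0, 0, c]) (he : ψ ![1, 1, 1] = ![1, 1, 1])
    (v : Fin 3 → ℝ) (hv : v ≠ 0) : ∃ k : ℝ, k ≠ 0 ∧ ψ v = k • v := by
  have zero2 : ∀ v, v 2 = 0 ↔ ψ v 2 = 0 := by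
    intro v
    have := h ![1, 0, 0] ![0, 1, 0] v
    rw [h₁, h₂] at this
    simpa [det3_eq, ha, hb] using this
  have zero0 : ∀ v, v 0 = 0 ↔ ψ v 0 = 0 := by
    intro v
    have := h v ![0, 1, 0] ![0, 0, 1]
    rw [h₃, h₂] at this
    simpa [det3_eq, hc, hb] using this
  have zero1 : ∀ v, v 1 = 0 ↔ ψ v 1 = 0 := by
    intro v
    have := h v ![1, 0, 0] ![0, 0, 1]
    rw [h₃, h₁] at this
    simpa [det3_eq, hc, ha] using this
  have diag : ∀ v, v 0 = v 1 → ψ v 0 = ψ v 1 := by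
    intro v hv
    have := (h ![0, 0, 1] ![1, 1, 1] v).1 (by simp [det3_eq, hv])
    rw [h₃, he] at this
    simp [det3_eq, hc] at this
    linarith
  have vert : ∀ v w, v 0 * w 2 = v 2 * w 0 → ψ v 0 * ψ w 2 = ψ v 2 * ψ w 0 := by
    intro v w hvw
    have := (h ![0, 1, 0] v w).1 (by simp [det3_eq, hvw])
    rw [h₂] at this
    simp [det3_eq, hb] at this
    linarith
  have horiz : ∀ v w, v 1 * w 2 = v 2 * w 1 → ψ v 1 * ψ w 2 = ψ v 2 * ψ w 1 := by
    intro v w hvw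
    have := (h ![1, 0, 0] v w).1 (by simp [det3_eq, hvw])
    rw [h₁] at this
    simp [det3_eq, ha] at this
    linarith
  have ne2 : ∀ x y, ψ ![x, y, 1] 2 ≠ 0 := fun x y => by
    rw [Ne, ← zero2]; simp
  let α : ℝ → ℝ := fun x => ψ ![x, x, 1] 0 / ψ ![x, x, 1] 2
  have hα0 : ∀ x y, ψ ![x, y, 1] 0 = ψ ![x, y, 1] 2 * α x := by
    intro x y
    have := vert ![x, y, 1] ![x, x, 1] (by simp)
    have := ne2 x x
    simp only [α]
    field_simp
    assumption
  have hα1 : ∀ x y, ψ ![x, y, 1] 1 = ψ ![x, y, 1] 2 * α y := by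
    intro x y
    have := horiz ![x, y, 1] ![y, y, 1] (by simp)
    have := ne2 y y
    have := diag ![y, y, 1] (by simp)
    simp only [α]
    field_simp
    rw [this]
    assumption
  have α_zero : α 0 = 0 := by
    have := (zero0 ![0, 0, 1]).1 (by simp)
    simp [α, this]
  have α_one : α 1 = 1 := by simp [α, he]
  have α_mul : ∀ m x, α (m * x) = α m * α x := by
    intro m x
    have := (h ![0, 0, 1] ![1, m, 1] ![x, m * x, 1]).1 (by simp [det3_eq])
    rw [h₃] at this
    simp only [det3_eq, hα0, hα1] at this
    simp [hc, α_one] at this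
    apply mul_left_cancel₀ (mul_ne_zero (ne2 1 m) (ne2 x (m * x)))
    linear_combination this
  have α_add : ∀ x y, α (x + y) = α x + α y := by
    intro x y
    have := (h ![1, 1, 0] ![0, y, 1] ![x, x + y, 1]).1 (by simp [det3_eq])
    simp only [det3_eq, hα0, hα1, α_zero, ← diag ![1, 1, 0] (by simp),
      (zero2 ![1, 1, 0]).1 (by simp)] at this
    have h0 : ψ ![1, 1, 0] 0 ≠ 0 := by
      rw [Ne, ← zero0]; simp
    apply mul_left_cancel₀ (mul_ne_zero h0 (mul_ne_zero (ne2 0 y) (ne2 x (x + y))))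
    linear_combination -this
  let σ : ℝ →+* ℝ :=
    { toFun := α, map_one' := α_one, map_mul' := α_mul, map_zero' := α_zero, map_add' := α_add }
  have hα : ∀ x, α x = x := fun x => RingHom.congr_fun (Subsingleton.elim σ (RingHom.id ℝ)) x
  simp only [hα] at hα0 hα1
  by_cases hv2 : v 2 = 0
  · have hψ2 := (zero2 v).1 hv2
    have key := (h ![0, 0, 1] ![v 0, v 1, 1] v).1 (by simp [det3_eq]; ring)
    rw [h₃] at key
    simp only [det3_eq, hα0, hα1] at key
    simp [hc] at key
    have key : v 0 * ψ v 1 = v 1 * ψ v 0 := by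
      apply mul_left_cancel₀ (ne2 (v 0) (v 1))
      linear_combination key
    by_cases hv0 : v 0 = 0
    · have hv1 : v 1 ≠ 0 := by
        intro hv1
        apply hv
        ext i
        fin_cases i <;> simp [hv0, hv1, hv2]
      refine ⟨ψ v 1 / v 1, div_ne_zero (mt (zero1 v).2 hv1) hv1, ?_⟩
      ext i
      fin_cases i
      · simp [hv0, (zero0 v).1 hv0]
      · simp [hv1]
      · simp [hv2, hψ2]
    · refine ⟨ψ v 0 / v 0, div_ne_zero (mt (zero0 v).2 hv0) hv0, ?_⟩
      ext i
      fin_cases i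
      · simp [hv0]
      · simp
        field_simp
        linarith
      · simp [hv2, hψ2]
  · refine ⟨ψ v 2 / v 2, div_ne_zero (mt (zero2 v).2 hv2) hv2, ?_⟩
    have k0 := vert ![v 0 / v 2, v 1 / v 2, 1] v (by simp [hv2])
    have k1 := horiz ![v 0 / v 2, v 1 / v 2, 1] v (by simp [hv2])
    rw [hα0, mul_assoc] at k0
    rw [hα1, mul_assoc] at k1
    have k0 := mul_left_cancel₀ (ne2 _ _) k0
    have k1 := mul_left_cancel₀ (ne2 _ _) k1
    ext i
    fin_cases i
    · simp [← k0]; ring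
    · simp [← k1]; ring
    · simp [hv2]

/-- A collinearity-preserving map of vectors is projectively linear. -/
theorem exists_gl_of_det3_iff (φ : (Fin 3 → ℝ) → (Fin 3 → ℝ))
    (h : ∀ u v w, det3 u v w = 0 ↔ det3 (φ u) (φ v) (φ w) = 0) :
    ∃ g : GL (Fin 3) ℝ, ∀ v ≠ 0, ∃ k : ℝ, k ≠ 0 ∧
      φ v = k • (g : Matrix (Fin 3) (Fin 3) ℝ).mulVec v := by
  set p := φ ![1, 0, 0] with hp
  set q := φ ![0, 1, 0] with hq
  set r := φ ![0, 0, 1] with hr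
  set s := φ ![1, 1, 1] with hs
  have hd : det3 p q r ≠ 0 := by rw [hp, hq, hr, Ne, ← h]; simp [det3_eq]
  have ha : det3 s q r ≠ 0 := by rw [hs, hq, hr, Ne, ← h]; simp [det3_eq]
  have hb : det3 p s r ≠ 0 := by rw [hs, hp, hr, Ne, ← h]; simp [det3_eq]
  have hc : det3 p q s ≠ 0 := by rw [hs, hq, hp, Ne, ← h]; simp [det3_eq]
  -- By the rule of Cramer, `det3 p q r • s` is the sum of the three columns.
  let M : Matrix (Fin 3) (Fin 3) ℝ :=
    (Matrix.of ![det3 s q r • p, det3 p s r • q, det3 p q s • r]).transpose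
  have hM : M.det ≠ 0 := by
    have : M.det = det3 s q r * det3 p s r * det3 p q s * det3 p q r := by
      rw [Matrix.det_transpose]
      change det3 _ _ _ = _
      rw [det3_eq (_ • _), det3_eq p q r]
      simp only [Pi.smul_apply, smul_eq_mul]
      ring
    rw [this]
    positivity
  have hMu : IsUnit M.det := isUnit_iff_ne_zero.2 hM
  have inv_mulVec : ∀ x y, M.mulVec y = x → M⁻¹.mulVec x = y := by
    rintro x y rfl
    rw [Matrix.mulVec_mulVec, Matrix.nonsing_inv_mul _ hMu, Matrix.one_mulVec]
  have hinv : M⁻¹.det ≠ 0 := by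
    rw [Matrix.det_nonsing_inv]
    simpa using hM
  let ψ : (Fin 3 → ℝ) → (Fin 3 → ℝ) := fun v => det3 p q r • M⁻¹.mulVec (φ v)
  have hψ : ∀ u v w, det3 u v w = 0 ↔ det3 (ψ u) (ψ v) (ψ w) = 0 := by
    intro u v w
    have : det3 (ψ u) (ψ v) (ψ w) = det3 p q r ^ 3 * (M⁻¹.det * det3 (φ u) (φ v) (φ w)) := by
      rw [← det3_mulVec, det3_eq (ψ u), det3_eq (M⁻¹.mulVec _)]
      simp only [ψ, Pi.smul_apply, smul_eq_mul]
      ring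
    rw [this, h u v w, mul_eq_zero, mul_eq_zero]
    simp only [pow_eq_zero_iff three_ne_zero, hd, hinv, false_or]
  have main := exists_smul_of_det3_iff_of_frame ψ hψ
    (a := det3 p q r / det3 s q r) (b := det3 p q r / det3 p s r) (c := det3 p q r / det3 p q s)
    (div_ne_zero hd ha) (div_ne_zero hd hb) (div_ne_zero hd hc) ?_ ?_ ?_ ?_
  · refine ⟨Matrix.GeneralLinearGroup.mkOfDetNeZero M hM, fun v hv => ?_⟩
    obtain ⟨k, hk, hkv⟩ := main v hv
    refine ⟨k / det3 p q r, div_ne_zero hk hd, ?_⟩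
    have e : M.mulVec (ψ v) = det3 p q r • φ v := by
      simp only [ψ]
      rw [Matrix.mulVec_smul, Matrix.mulVec_mulVec, Matrix.mul_nonsing_inv _ hMu,
        Matrix.one_mulVec]
    rw [hkv, Matrix.mulVec_smul] at e
    change φ v = _ • M.mulVec v
    rw [div_eq_inv_mul, mul_smul, e, inv_smul_smul₀ hd]
  · have : M⁻¹.mulVec p = ![1 / det3 s q r, 0, 0] := by
      apply inv_mulVec
      ext i
      fin_cases i <;> simp [M, Matrix.mulVec, dotProduct, Fin.sum_univ_three] <;> field_simp
    simp [ψ, ← hp, this, div_eq_mul_inv]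
  · have : M⁻¹.mulVec q = ![0, 1 / det3 p s r, 0] := by
      apply inv_mulVec
      ext i
      fin_cases i <;> simp [M, Matrix.mulVec, dotProduct, Fin.sum_univ_three] <;> field_simp
    simp [ψ, ← hq, this, div_eq_mul_inv]
  · have : M⁻¹.mulVec r = ![0, 0, 1 / det3 p q s] := by
      apply inv_mulVec
      ext i
      fin_cases i <;> simp [M, Matrix.mulVec, dotProduct, Fin.sum_univ_three] <;> field_simp
    simp [ψ, ← hr, this, div_eq_mul_inv]
  · have : M⁻¹.mulVec (det3 p q r • s) = ![1, 1, 1] := by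
      apply inv_mulVec
      ext i
      fin_cases i <;> simp [M, Matrix.mulVec, dotProduct, Fin.sum_univ_three, det3_eq] <;> ring
    simp only [ψ, ← hs]
    rw [← Matrix.mulVec_smul, this]

theorem exists_span_eq_of_finrank_one {l : Submodule ℝ (Fin 3 → ℝ)}
    (hl : Module.finrank ℝ l = 1) : ∃ v ≠ 0, l = Submodule.span ℝ {v} := by
  obtain ⟨v, hv, h⟩ := finrank_eq_one_iff'.1 hl
  refine ⟨v, by simpa using hv, le_antisymm (fun w hw => ?_) (by simp)⟩
  obtain ⟨c, hc⟩ := h ⟨w, hw⟩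
  exact Submodule.mem_span_singleton.2 ⟨c, congrArg Subtype.val hc⟩

/-- The flag given by a nonzero vector in a plane. -/
def Flag3.mk {v : Fin 3 → ℝ} (hv : v ≠ 0) {W : Submodule ℝ (Fin 3 → ℝ)} (hvW : v ∈ W)
    (hW : Module.finrank ℝ W = 2) : Flag3 :=
  ⟨(Submodule.span ℝ {v}, W), (Submodule.span_singleton_le_iff_mem v W).2 hvW,
    finrank_span_singleton hv, hW⟩

theorem Flag3.fst_eq_of_map_fst_eq {f : Flag3 → Flag3} (hf : Function.Injective f)
    (h1 : ∀ x y : Flag3, x.1.1 = y.1.1 → (f x).1.1 = (f y).1.1)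
    (h2 : ∀ x y : Flag3, x.1.2 = y.1.2 → (f x).1.2 = (f y).1.2) {x y : Flag3}
    (hxy : (f x).1.1 = (f y).1.1) : x.1.1 = y.1.1 := by
  obtain ⟨u, hu, hxu⟩ := exists_span_eq_of_finrank_one x.2.2.1
  obtain ⟨v, hv, hyv⟩ := exists_span_eq_of_finrank_one y.2.2.1
  obtain ⟨W, hW, huW, hvW, -⟩ :=
    (det3_eq_zero_iff_exists_finrank_two u v 0).1 (by simp [det3_eq])
  have : mk hu huW hW = mk hv hvW hW := by
    refine hf (Subtype.ext (Prod.ext ?_ (h2 _ _ rfl)))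
    rw [h1 (mk hu huW hW) x hxu.symm, h1 (mk hv hvW hW) y hyv.symm, hxy]
  rw [hxu, hyv]
  exact congrArg (fun z : Flag3 => z.1.1) this

theorem Flag3.snd_eq_of_map_snd_eq {f : Flag3 → Flag3} (hf : Function.Injective f)
    (h1 : ∀ x y : Flag3, x.1.1 = y.1.1 → (f x).1.1 = (f y).1.1)
    (h2 : ∀ x y : Flag3, x.1.2 = y.1.2 → (f x).1.2 = (f y).1.2) {x y : Flag3}
    (hxy : (f x).1.2 = (f y).1.2) : x.1.2 = y.1.2 := by
  have hne : x.1.2 ⊓ y.1.2 ≠ ⊥ := by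
    intro hbot
    have e := Submodule.finrank_sup_add_finrank_inf_eq x.1.2 y.1.2
    have le := Submodule.finrank_le (x.1.2 ⊔ y.1.2)
    rw [hbot, x.2.2.2, y.2.2.2] at e
    simp at e le
    omega
  obtain ⟨v, hv, hv0⟩ := Submodule.exists_mem_ne_zero_of_ne_bot hne
  let x' : Flag3 := mk hv0 hv.1 x.2.2.2
  let y' : Flag3 := mk hv0 hv.2 y.2.2.2
  have : x' = y' := by
    refine hf (Subtype.ext (Prod.ext (h1 _ _ rfl) ?_))
    rw [h2 x' x rfl, h2 y' y rfl, hxy]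
  change x'.1.2 = y'.1.2
  rw [this]

/-- A fibration-preserving map of flags lifts to a map of vectors. -/
theorem Flag3.exists_lift {f : Flag3 → Flag3}
    (h1 : ∀ x y : Flag3, x.1.1 = y.1.1 → (f x).1.1 = (f y).1.1) :
    ∃ φ : (Fin 3 → ℝ) → (Fin 3 → ℝ), φ 0 = 0 ∧ ∀ v ≠ 0, φ v ≠ 0 ∧
      ∀ x : Flag3, x.1.1 = Submodule.span ℝ {v} → (f x).1.1 = Submodule.span ℝ {φ v} := by
  have (v : Fin 3 → ℝ) : ∃ w, (v = 0 → w = 0) ∧ (v ≠ 0 → w ≠ 0 ∧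
      ∀ x : Flag3, x.1.1 = Submodule.span ℝ {v} → (f x).1.1 = Submodule.span ℝ {w}) := by
    by_cases hv : v = 0
    · exact ⟨0, by simp [hv]⟩
    obtain ⟨W, hW, hvW, -⟩ :=
      (det3_eq_zero_iff_exists_finrank_two v 0 0).1 (by simp [det3_eq])
    obtain ⟨w, hw, e⟩ := exists_span_eq_of_finrank_one (f (mk hv hvW hW)).2.2.1
    exact ⟨w, by simp [hv], fun _ => ⟨hw, fun x hx => (h1 x (mk hv hvW hW) hx).trans e⟩⟩
  choose φ hφ0 hφ using this
  exact ⟨φ, hφ0 0 rfl, hφ⟩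

/-- Fundamental Theorem of Projective Geometry (flag formulation): every
fibration-preserving bijection of the flag manifold of `ℝ³` is induced by an
element of `GL(3,ℝ)`. -/
theorem fundamental_theorem_projective_geometry
    (f : Flag3 → Flag3) (hbij : Function.Bijective f)
    (h1 : ∀ x y : Flag3, x.1.1 = y.1.1 → (f x).1.1 = (f y).1.1)
    (h2 : ∀ x y : Flag3, x.1.2 = y.1.2 → (f x).1.2 = (f y).1.2) :
    ∃ g : GL (Fin 3) ℝ, ∀ x : Flag3,
      (f x).1.1 = Submodule.map (Matrix.mulVecLin (g : Matrix (Fin 3) (Fin 3) ℝ)) x.1.1 ∧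
      (f x).1.2 = Submodule.map (Matrix.mulVecLin (g : Matrix (Fin 3) (Fin 3) ℝ)) x.1.2 := by
  obtain ⟨φ, hφ0, hφ⟩ := Flag3.exists_lift h1
  have mem_of_mk {v : Fin 3 → ℝ} (hv : v ≠ 0) (x : Flag3) (hx : v ∈ x.1.2) :
      φ v ∈ (f x).1.2 := by
    rw [h2 x (Flag3.mk hv hx x.2.2.2) rfl]
    apply (f (Flag3.mk hv hx x.2.2.2)).2.1
    rw [(hφ v hv).2 (Flag3.mk hv hx x.2.2.2) rfl]
    exact Submodule.mem_span_singleton_self _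
  have exists_flag {v : Fin 3 → ℝ} (hv : v ≠ 0) {W : Submodule ℝ (Fin 3 → ℝ)}
      (hW : Module.finrank ℝ W = 2) (hvW : φ v ∈ W) : ∃ x : Flag3, (f x).1.2 = W ∧ v ∈ x.1.2 := by
    obtain ⟨x, hx⟩ := hbij.2 (Flag3.mk (hφ v hv).1 hvW hW)
    refine ⟨x, by rw [hx]; rfl, ?_⟩
    obtain ⟨W', hW', hvW', -⟩ :=
      (det3_eq_zero_iff_exists_finrank_two v 0 0).1 (by simp [det3_eq])
    have e : x.1.1 = Submodule.span ℝ {v} := by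
      refine Flag3.fst_eq_of_map_fst_eq hbij.1 h1 h2 (y := Flag3.mk hv hvW' hW') ?_
      rw [(hφ v hv).2 (Flag3.mk hv hvW' hW') rfl, hx]
      rfl
    apply x.2.1
    rw [e]
    exact Submodule.mem_span_singleton_self _
  have hdet : ∀ u v w, det3 u v w = 0 ↔ det3 (φ u) (φ v) (φ w) = 0 := by
    intro u v w
    by_cases hu : u = 0
    · simp [hu, hφ0, det3_eq]
    by_cases hv : v = 0
    · simp [hv, hφ0, det3_eq]
    by_cases hw : w = 0
    · simp [hw, hφ0, det3_eq]
    rw [det3_eq_zero_iff_exists_finrank_two, det3_eq_zero_iff_exists_finrank_two]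
    constructor
    · rintro ⟨W, hW, huW, hvW, hwW⟩
      let x := Flag3.mk hu huW hW
      exact ⟨(f x).1.2, (f x).2.2.2, mem_of_mk hu x huW, mem_of_mk hv x hvW, mem_of_mk hw x hwW⟩
    · rintro ⟨W, hW, huW, hvW, hwW⟩
      obtain ⟨x, hx, hux⟩ := exists_flag hu hW huW
      obtain ⟨y, hy, hvy⟩ := exists_flag hv hW hvW
      obtain ⟨z, hz, hwz⟩ := exists_flag hw hW hwW
      rw [Flag3.snd_eq_of_map_snd_eq hbij.1 h1 h2 (hy.trans hx.symm)] at hvy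
      rw [Flag3.snd_eq_of_map_snd_eq hbij.1 h1 h2 (hz.trans hx.symm)] at hwz
      exact ⟨x.1.2, x.2.2.2, hux, hvy, hwz⟩
  obtain ⟨g, hg⟩ := exists_gl_of_det3_iff φ hdet
  refine ⟨g, fun x => ⟨?_, ?_⟩⟩
  · obtain ⟨v, hv, e⟩ := exists_span_eq_of_finrank_one x.2.2.1
    obtain ⟨k, hk, hkv⟩ := hg v hv
    rw [(hφ v hv).2 x e, e, Submodule.map_span, Set.image_singleton, hkv,
      Submodule.span_singleton_smul_eq (isUnit_iff_ne_zero.2 hk)]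
    rfl
  · symm
    apply Submodule.eq_of_le_of_finrank_eq
    · rintro _ ⟨v, hvx, rfl⟩
      by_cases hv : v = 0
      · simp [hv]
      obtain ⟨k, hk, hkv⟩ := hg v hv
      have := mem_of_mk hv x hvx
      rwa [hkv, Submodule.smul_mem_iff _ hk] at this
    · exact (Submodule.equivMapOfInjective (Matrix.mulVecLin (g : Matrix (Fin 3) (Fin 3) ℝ))
        (Matrix.mulVec_injective_of_isUnit g.isUnit) _).finrank_eq.symm.trans
        (x.2.2.2.trans (f x).2.2.2.symm)
end

section
/- Let n ≥ 4 and let φ : 𝔫 → 𝔫 be a graded automorphism of the real Lie algebra 𝔫 of strictly upper triangular n×n real matrices. Then there exist ε ∈ {0,1} and an invertible diagonal matrix g = diag(λ₁,…,λₙ) with all λᵢ ≠ 0 such that φ = τ^ε ∘ Ad_g, where Ad_g(A) = g A g⁻¹, τ⁰ = id and τ¹ = τ. -/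
/-- The Lie algebra `𝔫` of strictly upper triangular `n×n` real matrices,
as a real submodule of the matrix space. -/
def strictlyUpper (n : ℕ) : Submodule ℝ (Matrix (Fin n) (Fin n) ℝ) where
  carrier := {A | ∀ i j : Fin n, j ≤ i → A i j = 0}
  add_mem' := fun ha hb i j h => by
    simp only [Matrix.add_apply, ha i j h, hb i j h, add_zero]
  zero_mem' := fun i j _ => rfl
  smul_mem' := fun c A hA i j h => by
    simp only [Matrix.smul_apply, hA i j h, smul_zero]

/-- The `i`-th layer `V_i` of the grading of `𝔫`: matrices supported on the
`i`-th superdiagonal. -/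
def superdiag (n i : ℕ) : Submodule ℝ (Matrix (Fin n) (Fin n) ℝ) where
  carrier := {A | ∀ a b : Fin n, (b : ℕ) ≠ (a : ℕ) + i → A a b = 0}
  add_mem' := fun ha hb a b h => by
    simp only [Matrix.add_apply, ha a b h, hb a b h, add_zero]
  zero_mem' := fun a b _ => rfl
  smul_mem' := fun c A hA a b h => by
    simp only [Matrix.smul_apply, hA a b h, smul_zero]

/-- The graded automorphism `τ` of `𝔫`, `(τ A)_{i,j} = -A_{n-j+1, n-i+1}`
(in 1-indexed notation; here implemented with `Fin.rev`). -/
def tauR (n : ℕ) (A : Matrix (Fin n) (Fin n) ℝ) : Matrix (Fin n) (Fin n) ℝ :=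
  Matrix.of fun i j => - A j.rev i.rev

theorem commutator_single_apply {n : ℕ} (X : Matrix (Fin n) (Fin n) ℝ) (a b i j : Fin n) :
    (X * Matrix.single a b 1 - Matrix.single a b 1 * X : Matrix (Fin n) (Fin n) ℝ) i j =
      (if b = j then X i a else 0) - (if a = i then X b j else 0) := by
  simp [Matrix.mul_apply, Matrix.single_apply, ite_and]

theorem single_mem_strictlyUpper {n : ℕ} {a b : Fin n} (h : a < b) :
    Matrix.single a b (1 : ℝ) ∈ strictlyUpper n := by
  intro i j hij
  exact Matrix.single_apply_of_ne _ _ _ _ _ (by rintro ⟨rfl, rfl⟩; exact absurd h hij.not_gt)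

theorem single_mem_superdiag {n k : ℕ} {a b : Fin n} (h : (b : ℕ) = a + k) :
    Matrix.single a b (1 : ℝ) ∈ superdiag n k := by
  intro i j hij
  exact Matrix.single_apply_of_ne _ _ _ _ _ (by rintro ⟨rfl, rfl⟩; exact hij h)

theorem superdiag_le_strictlyUpper (n k : ℕ) (hk : 1 ≤ k) : superdiag n k ≤ strictlyUpper n := by
  intro A hA i j hij
  exact hA i j (by have : (j : ℕ) ≤ i := hij; omega)

open Matrix in
theorem single_zero_commutator {n : ℕ} (k : ℕ) (hk : k + 2 < n) {Z : Matrix (Fin n) (Fin n) ℝ}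
    (hZ : Z ∈ superdiag n 1) :
    single (⟨0, by omega⟩ : Fin n) ⟨k + 1, by omega⟩ 1 * Z -
        Z * single (⟨0, by omega⟩ : Fin n) ⟨k + 1, by omega⟩ 1 =
      Z ⟨k + 1, by omega⟩ ⟨k + 2, hk⟩ • single (⟨0, by omega⟩ : Fin n) ⟨k + 2, hk⟩ 1 := by
  rw [← neg_sub]
  ext i j
  rw [Matrix.neg_apply, commutator_single_apply, Matrix.smul_apply, Matrix.single_apply]
  have h1 : Z i ⟨0, by omega⟩ = 0 := hZ _ _ (by simp)
  rw [h1, ite_self, zero_sub, neg_neg, ite_and]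
  split_ifs with h2 h3
  · subst h3; simp
  · rw [hZ _ _ (fun h4 => h3 (Fin.ext h4.symm)), smul_zero]
  · simp

/-- An injective bracket-preserving map which preserves the first layer. -/
structure IsGradedAut {n : ℕ} (φ : Matrix (Fin n) (Fin n) ℝ →ₗ[ℝ] Matrix (Fin n) (Fin n) ℝ) :
    Prop where
  map_superdiag : Submodule.map φ (superdiag n 1) = superdiag n 1
  map_commutator : ∀ A ∈ strictlyUpper n, ∀ B ∈ strictlyUpper n,
    φ (A * B - B * A) = φ A * φ B - φ B * φ A
  eq_zero : ∀ A ∈ strictlyUpper n, φ A = 0 → A = 0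

/-- The map `tauR` as a linear map. -/
def tauLinear (n : ℕ) : Matrix (Fin n) (Fin n) ℝ →ₗ[ℝ] Matrix (Fin n) (Fin n) ℝ where
  toFun := tauR n
  map_add' A B := by ext i j; simp [tauR]; ring
  map_smul' c A := by ext i j; simp [tauR]

@[simp] theorem tauLinear_apply {n : ℕ} (A : Matrix (Fin n) (Fin n) ℝ) (i j : Fin n) :
    tauLinear n A i j = -A j.rev i.rev := rfl

@[simp] theorem tauLinear_tauLinear {n : ℕ} (A : Matrix (Fin n) (Fin n) ℝ) :
    tauLinear n (tauLinear n A) = A := by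
  ext i j; simp

theorem tauLinear_single {n : ℕ} (a b : Fin n) :
    tauLinear n (Matrix.single a b 1) = -Matrix.single b.rev a.rev 1 := by
  ext i j
  simp only [tauLinear_apply, Matrix.neg_apply, Matrix.single_apply, ← Fin.rev_eq_iff]
  simp only [and_comm]

theorem tauLinear_commutator {n : ℕ} (A B : Matrix (Fin n) (Fin n) ℝ) :
    tauLinear n (A * B - B * A) =
      tauLinear n A * tauLinear n B - tauLinear n B * tauLinear n A := by
  ext i j
  simp only [tauLinear_apply, Matrix.sub_apply, Matrix.mul_apply, neg_mul_neg]
  rw [← Equiv.sum_comp Fin.revPerm (fun k => A j.rev k * B k i.rev),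
    ← Equiv.sum_comp Fin.revPerm (fun k => B j.rev k * A k i.rev)]
  simp [mul_comm]

theorem tauLinear_mem_superdiag {n k : ℕ} {A : Matrix (Fin n) (Fin n) ℝ}
    (hA : A ∈ superdiag n k) : tauLinear n A ∈ superdiag n k := by
  intro a b hab
  rw [tauLinear_apply, hA _ _ (by simp only [Fin.val_rev]; omega), neg_zero]

theorem tauLinear_mem_strictlyUpper {n : ℕ} {A : Matrix (Fin n) (Fin n) ℝ}
    (hA : A ∈ strictlyUpper n) : tauLinear n A ∈ strictlyUpper n := by
  intro a b hab
  rw [tauLinear_apply, hA _ _ (Fin.rev_le_rev.2 hab), neg_zero]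

theorem map_tauLinear_superdiag (n k : ℕ) :
    Submodule.map (tauLinear n) (superdiag n k) = superdiag n k := by
  apply le_antisymm
  · rintro _ ⟨A, hA, rfl⟩
    exact tauLinear_mem_superdiag hA
  · intro A hA
    exact ⟨_, tauLinear_mem_superdiag hA, tauLinear_tauLinear A⟩

namespace IsGradedAut

variable {n : ℕ} {φ : Matrix (Fin n) (Fin n) ℝ →ₗ[ℝ] Matrix (Fin n) (Fin n) ℝ}

theorem tau_comp (h : IsGradedAut φ) : IsGradedAut (tauLinear n ∘ₗ φ) where
  map_superdiag := by rw [Submodule.map_comp, h.map_superdiag, map_tauLinear_superdiag]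
  map_commutator A hA B hB := by
    simp only [LinearMap.comp_apply, h.map_commutator A hA B hB, tauLinear_commutator]
  eq_zero A hA h0 := h.eq_zero A hA (by
    rw [← tauLinear_tauLinear (φ A)]
    exact (congrArg (tauLinear n) h0).trans (map_zero _))

theorem comp_tau (h : IsGradedAut φ) : IsGradedAut (φ ∘ₗ tauLinear n) where
  map_superdiag := by rw [Submodule.map_comp, map_tauLinear_superdiag, h.map_superdiag]
  map_commutator A hA B hB := by
    simp only [LinearMap.comp_apply, tauLinear_commutator]
    exact h.map_commutator _ (tauLinear_mem_strictlyUpper hA) _ (tauLinear_mem_strictlyUpper hB)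
  eq_zero A hA h0 := by
    rw [← tauLinear_tauLinear A, h.eq_zero _ (tauLinear_mem_strictlyUpper hA) h0, map_zero]

theorem apply_mem (h : IsGradedAut φ) {A : Matrix (Fin n) (Fin n) ℝ} (hA : A ∈ superdiag n 1) :
    φ A ∈ superdiag n 1 := by
  rw [← h.map_superdiag]; exact Submodule.mem_map_of_mem hA

theorem map_single_ne_zero (h : IsGradedAut φ) {a b : Fin n} (hab : a < b) :
    φ (Matrix.single a b 1) ≠ 0 := fun h0 => by
  have := congrFun (congrFun (h.eq_zero _ (single_mem_strictlyUpper hab) h0) a) b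
  simp at this

end IsGradedAut

open Matrix in
/-- A degree-one element whose adjoint action on the first layer has rank at most one and squares
to zero is a multiple of one of the two extremal elementary matrices. -/
theorem eq_smul_single_of_commutator {n : ℕ} (hn : 4 ≤ n) {X W : Matrix (Fin n) (Fin n) ℝ}
    (hX : X ∈ superdiag n 1)
    (hW : ∀ Y ∈ superdiag n 1, ∃ t : ℝ, X * Y - Y * X = t • W) (hXW : X * W - W * X = 0) :
    (∃ t : ℝ, X = t • single ⟨0, by omega⟩ ⟨1, by omega⟩ 1) ∨
      ∃ t : ℝ, X = t • single ⟨n - 2, by omega⟩ ⟨n - 1, by omega⟩ 1 := by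
  have minor : ∀ Y ∈ superdiag n 1, ∀ Z ∈ superdiag n 1, ∀ i j k l,
      (X * Y - Y * X : Matrix (Fin n) (Fin n) ℝ) i j *
          (X * Z - Z * X : Matrix (Fin n) (Fin n) ℝ) k l =
        (X * Y - Y * X : Matrix (Fin n) (Fin n) ℝ) k l *
          (X * Z - Z * X : Matrix (Fin n) (Fin n) ℝ) i j := by
    intro Y hY Z hZ i j k l
    obtain ⟨t, ht⟩ := hW Y hY
    obtain ⟨s, hs⟩ := hW Z hZ
    simp only [ht, hs, Matrix.smul_apply, smul_eq_mul]
    ring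
  have inner_zero : ∀ (k : ℕ) (hk : k + 3 < n),
      X ⟨k + 1, by omega⟩ ⟨k + 2, by omega⟩ = 0 := by
    intro k hk
    have := minor _ (single_mem_superdiag (a := ⟨k, by omega⟩) (b := ⟨k + 1, by omega⟩) rfl)
      _ (single_mem_superdiag (a := ⟨k + 2, by omega⟩) (b := ⟨k + 3, by omega⟩) rfl)
      ⟨k, by omega⟩ ⟨k + 2, by omega⟩ ⟨k + 1, by omega⟩ ⟨k + 3, by omega⟩
    simp only [commutator_single_apply] at this
    simpa using this
  have outer_zero : X ⟨0, by omega⟩ ⟨1, by omega⟩ = 0 ∨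
      X ⟨n - 2, by omega⟩ ⟨n - 1, by omega⟩ = 0 := by
    rcases hn.lt_or_eq with hn' | rfl
    · have := minor _ (single_mem_superdiag (a := ⟨1, by omega⟩) (b := ⟨2, by omega⟩) rfl)
        _ (single_mem_superdiag (a := ⟨n - 3, by omega⟩) (b := ⟨n - 2, by omega⟩)
          (by simp only; omega))
        ⟨0, by omega⟩ ⟨2, by omega⟩ ⟨n - 3, by omega⟩ ⟨n - 1, by omega⟩
      simp only [commutator_single_apply, Fin.mk.injEq] at this
      simpa [show n - 2 ≠ n - 1 by omega, show 2 ≠ n - 1 by omega, show 1 ≠ n - 3 by omega]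
        using this
    · obtain ⟨t, ht⟩ := hW _ (single_mem_superdiag (n := 4) (a := 1) (b := 2) rfl)
      have hsq : X * (t • W) - (t • W) * X = 0 := by
        rw [Matrix.mul_smul, Matrix.smul_mul, ← smul_sub, hXW, smul_zero]
      rw [← ht] at hsq
      have h03 := congrFun (congrFun hsq 0) 3
      rw [Matrix.sub_apply, Matrix.mul_apply, Matrix.mul_apply] at h03
      have z : ∀ a b : Fin 4, (b : ℕ) ≠ a + 1 → X a b = 0 := hX
      simp only [commutator_single_apply, Fin.sum_univ_four] at h03
      simp [z 0 0, z 0 2, z 0 3, z 1 3, z 3 3] at h03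
      have : X 0 1 * X 2 3 = 0 := by linarith
      simpa using this
  have single_of : ∀ a b : Fin n, (∀ i j : Fin n, (j : ℕ) = i + 1 → i ≠ a → X i j = 0) →
      (b : ℕ) = a + 1 → X = X a b • single a b 1 := by
    intro a b hz hab
    ext i j
    simp only [Matrix.smul_apply, Matrix.single_apply, smul_eq_mul]
    split_ifs with hij
    · rw [← hij.1, ← hij.2, mul_one]
    · rw [mul_zero]
      by_cases h1 : (j : ℕ) = i + 1
      · exact hz i j h1 fun hia => hij ⟨hia.symm, Fin.ext (by rw [h1, hia, hab])⟩
      · exact hX i j h1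
  have zero_of : ∀ i j : Fin n, (j : ℕ) = i + 1 → (i : ℕ) ≠ 0 → (i : ℕ) ≠ n - 2 → X i j = 0 := by
    intro i j hij h0 h2
    have := inner_zero (i - 1) (by omega)
    convert this using 2 <;> ext <;> simp only <;> omega
  rcases outer_zero with h | h
  · refine Or.inr ⟨_, single_of _ _ (fun i j hij hi => ?_) (by simp only; omega)⟩
    by_cases h0 : (i : ℕ) = 0
    · convert h using 2 <;> ext <;> simp only <;> omega
    · exact zero_of i j hij h0 fun h2 => hi (Fin.ext h2)
  · refine Or.inl ⟨_, single_of _ _ (fun i j hij hi => ?_) rfl⟩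
    by_cases h0 : (i : ℕ) = n - 2
    · convert h using 2 <;> ext <;> simp only <;> omega
    · exact zero_of i j hij (fun h2 => hi (Fin.ext h2)) h0

namespace IsGradedAut

open Matrix

variable {n : ℕ} {φ : Matrix (Fin n) (Fin n) ℝ →ₗ[ℝ] Matrix (Fin n) (Fin n) ℝ}

theorem map_first (h : IsGradedAut φ) (hn : 4 ≤ n) :
    (∃ t : ℝ, φ (single ⟨0, by omega⟩ ⟨1, by omega⟩ 1) =
        t • single ⟨0, by omega⟩ ⟨1, by omega⟩ 1) ∨
      ∃ t : ℝ, φ (single ⟨0, by omega⟩ ⟨1, by omega⟩ 1) =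
        t • single ⟨n - 2, by omega⟩ ⟨n - 1, by omega⟩ 1 := by
  have h01 : single (⟨0, by omega⟩ : Fin n) (⟨1, by omega⟩ : Fin n) (1 : ℝ) ∈ superdiag n 1 :=
    single_mem_superdiag rfl
  have h01' := superdiag_le_strictlyUpper n 1 le_rfl h01
  refine eq_smul_single_of_commutator hn
    (W := φ (single ⟨0, by omega⟩ ⟨2, by omega⟩ 1)) (h.apply_mem h01) ?_ ?_
  · intro Y hY
    rw [← h.map_superdiag] at hY
    obtain ⟨Z, hZ, rfl⟩ := hY
    refine ⟨Z ⟨1, by omega⟩ ⟨2, by omega⟩, ?_⟩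
    rw [← h.map_commutator _ h01' _ (superdiag_le_strictlyUpper n 1 le_rfl hZ), ← map_smul]
    rw [single_zero_commutator 0 (by omega) hZ]
  · rw [← h.map_commutator _ h01' _ (single_mem_strictlyUpper (by simp [Fin.lt_def]))]
    simp [Matrix.single_mul_single_of_ne]

/-- If `φ` preserves the line of the first simple root vector, it preserves the vanishing of each
coordinate of the first layer except possibly the first one. -/
theorem apply_eq_zero (h : IsGradedAut φ) (hn : 4 ≤ n) {t : ℝ}
    (ht : φ (single ⟨0, by omega⟩ ⟨1, by omega⟩ 1) = t • single ⟨0, by omega⟩ ⟨1, by omega⟩ 1)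
    {Y : Matrix (Fin n) (Fin n) ℝ} (hY : Y ∈ superdiag n 1) {a b : Fin n}
    (hab : (b : ℕ) = a + 1) (ha : (a : ℕ) ≠ 0) (hYa : Y a b = 0) : φ Y a b = 0 := by
  have map_comm : ∀ (k : ℕ) (hk : k + 2 < n) (c : ℝ),
      φ (single ⟨0, by omega⟩ ⟨k + 1, by omega⟩ 1) =
        c • single ⟨0, by omega⟩ ⟨k + 1, by omega⟩ 1 → ∀ Y ∈ superdiag n 1,
      Y ⟨k + 1, by omega⟩ ⟨k + 2, by omega⟩ • φ (single (⟨0, by omega⟩ : Fin n) ⟨k + 2, hk⟩ 1) =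
        (c * φ Y ⟨k + 1, by omega⟩ ⟨k + 2, by omega⟩) •
          single (⟨0, by omega⟩ : Fin n) ⟨k + 2, hk⟩ 1 := by
    intro k hk c hc Z hZ
    rw [← map_smul, ← single_zero_commutator k hk hZ, h.map_commutator _ (single_mem_strictlyUpper
      (by simp [Fin.lt_def])) _ (superdiag_le_strictlyUpper n 1 le_rfl hZ), hc, Matrix.smul_mul,
      Matrix.mul_smul, ← smul_sub, single_zero_commutator k hk (h.apply_mem hZ), smul_smul]
  have eigen : ∀ (k : ℕ) (hk : k + 1 < n), ∃ c : ℝ,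
      φ (single ⟨0, by omega⟩ ⟨k + 1, by omega⟩ 1) =
        c • single ⟨0, by omega⟩ ⟨k + 1, by omega⟩ 1 := by
    intro k
    induction k with
    | zero => exact fun hk => ⟨t, ht⟩
    | succ k ih =>
      intro hk
      obtain ⟨c, hc⟩ := ih (by omega)
      have := map_comm k hk c hc (single ⟨k + 1, by omega⟩ ⟨k + 2, by omega⟩ 1)
        (single_mem_superdiag rfl)
      rw [Matrix.single_apply_same, one_smul] at this
      exact ⟨_, this⟩
  obtain ⟨k, hk⟩ := Nat.exists_eq_succ_of_ne_zero ha
  have hk' : k + 2 < n := by have := b.2; omega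
  have ha' : a = ⟨k + 1, Nat.lt_of_succ_lt hk'⟩ := Fin.ext hk
  have hb' : b = ⟨k + 2, hk'⟩ := Fin.ext (by simp only; omega)
  rw [ha', hb'] at hYa ⊢
  obtain ⟨c, hc⟩ := eigen k (by omega)
  have hc0 : c ≠ 0 := by
    rintro rfl
    exact h.map_single_ne_zero (by simp [Fin.lt_def]) (hc.trans (zero_smul _ _))
  have := congrFun (congrFun (map_comm k (by omega) c hc Y hY) ⟨0, by omega⟩) ⟨k + 2, by omega⟩
  rw [hYa, zero_smul, Matrix.smul_apply, Matrix.single_apply_same, smul_eq_mul, mul_one] at this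
  exact (mul_eq_zero.1 this.symm).resolve_left hc0

/-- If `φ` preserves the lines of both extremal simple root vectors, then it is conjugation by an
invertible diagonal matrix. -/
theorem exists_eq_conj (h : IsGradedAut φ) (hn : 4 ≤ n) {s t : ℝ}
    (hs : φ (single ⟨0, by omega⟩ ⟨1, by omega⟩ 1) = s • single ⟨0, by omega⟩ ⟨1, by omega⟩ 1)
    (ht : φ (single ⟨n - 2, by omega⟩ ⟨n - 1, by omega⟩ 1) =
      t • single ⟨n - 2, by omega⟩ ⟨n - 1, by omega⟩ 1) :
    ∃ lam : Fin n → ℝ, (∀ i, lam i ≠ 0) ∧ ∀ A ∈ strictlyUpper n,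
      φ A = diagonal lam * A * diagonal fun i => (lam i)⁻¹ := by
  have rev0 : Fin.rev (⟨0, by omega⟩ : Fin n) = ⟨n - 1, by omega⟩ := rfl
  have rev1 : Fin.rev (⟨1, by omega⟩ : Fin n) = ⟨n - 2, by omega⟩ := rfl
  have ht' : (tauLinear n ∘ₗ φ ∘ₗ tauLinear n) (single ⟨0, by omega⟩ ⟨1, by omega⟩ 1) =
      t • single ⟨0, by omega⟩ ⟨1, by omega⟩ 1 := by
    rw [LinearMap.comp_apply, LinearMap.comp_apply, tauLinear_single, rev0, rev1, map_neg, ht,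
      map_neg, map_smul, tauLinear_single, ← rev0, ← rev1, Fin.rev_rev, Fin.rev_rev, smul_neg,
      neg_neg]
  have apply_zero : ∀ Y ∈ superdiag n 1, ∀ a b : Fin n, (b : ℕ) = a + 1 → Y a b = 0 →
      φ Y a b = 0 := by
    intro Y hY a b hab hYa
    by_cases ha : (a : ℕ) = 0
    · have := h.comp_tau.tau_comp.apply_eq_zero hn ht' (tauLinear_mem_superdiag hY)
        (a := b.rev) (b := a.rev) (by simp only [Fin.val_rev]; omega)
        (by simp only [Fin.val_rev]; omega) (by simp [hYa])
      simpa using this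
    · exact h.apply_eq_zero hn hs hY hab ha hYa
  have simple : ∀ a b : Fin n, (b : ℕ) = a + 1 →
      φ (single a b 1) = φ (single a b 1) a b • single a b 1 := by
    intro a b hab
    have hm := single_mem_superdiag (k := 1) hab
    ext i j
    rw [Matrix.smul_apply, Matrix.single_apply]
    split_ifs with hij
    · rw [hij.1, hij.2, smul_eq_mul, mul_one]
    · rw [smul_zero]
      by_cases h1 : (j : ℕ) = i + 1
      · exact apply_zero _ hm i j h1 (Matrix.single_apply_of_ne _ _ _ _ _ hij)
      · exact h.apply_mem hm i j h1
  let μ : ℕ → ℝ := fun k =>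
    if hk : k + 1 < n then φ (single ⟨k, by omega⟩ ⟨k + 1, hk⟩ 1) ⟨k, by omega⟩ ⟨k + 1, hk⟩ else 1
  have hμ : ∀ k, μ k ≠ 0 := by
    intro k
    by_cases hk : k + 1 < n
    · simp only [μ, dif_pos hk]
      intro h0
      refine h.map_single_ne_zero (a := ⟨k, by omega⟩) (b := ⟨k + 1, hk⟩) (by simp [Fin.lt_def]) ?_
      rw [simple _ _ rfl, h0, zero_smul]
    · simp [μ, dif_neg hk]
  let ν : ℕ → ℝ := fun k => ∏ j ∈ Finset.range k, (μ j)⁻¹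
  have hν : ∀ k, ν k ≠ 0 := fun k => Finset.prod_ne_zero_iff.2 fun j _ => inv_ne_zero (hμ j)
  have ν_succ : ∀ k, ν (k + 1) = ν k * (μ k)⁻¹ := fun k => Finset.prod_range_succ _ _
  have map_single : ∀ (d i : ℕ) (hd : i + d + 1 < n),
      φ (single ⟨i, by omega⟩ ⟨i + d + 1, hd⟩ 1) =
        (ν i * (ν (i + d + 1))⁻¹) • single ⟨i, by omega⟩ ⟨i + d + 1, hd⟩ 1 := by
    intro d i
    have step : ∀ (k : ℕ) (hk : k + 1 < n), φ (single ⟨k, by omega⟩ ⟨k + 1, hk⟩ 1) =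
        (ν k * (ν (k + 1))⁻¹) • single ⟨k, by omega⟩ ⟨k + 1, hk⟩ 1 := by
      intro k hk
      rw [simple _ _ rfl, ν_succ]
      congr 1
      have := hν k
      rw [mul_inv, inv_inv, mul_inv_cancel_left₀ this]
      simp only [μ, dif_pos hk]
    induction d with
    | zero => exact step i
    | succ d ih =>
      intro hd
      have key : ∀ a b c : Fin n, a ≠ c →
          single a c (1 : ℝ) = single a b 1 * single b c 1 - single b c 1 * single a b 1 := by
        intro a b c hac
        rw [Matrix.single_mul_single_same, Matrix.single_mul_single_of_ne _ _ _ _ hac.symm,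
          sub_zero, mul_one]
      have hne : (⟨i, by omega⟩ : Fin n) ≠ ⟨i + (d + 1) + 1, hd⟩ := by
        simp only [ne_eq, Fin.mk.injEq]; omega
      rw [key _ ⟨i + d + 1, by omega⟩ _ hne,
        h.map_commutator _ (single_mem_strictlyUpper (by simp only [Fin.lt_def]; omega))
          _ (single_mem_strictlyUpper (by simp only [Fin.lt_def]; omega)),
        ih (by omega), show φ (single ⟨i + d + 1, by omega⟩ ⟨i + (d + 1) + 1, hd⟩ 1) = _ from
          step (i + d + 1) hd, Matrix.smul_mul, Matrix.smul_mul, Matrix.mul_smul,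
        Matrix.mul_smul, smul_smul, smul_smul, mul_comm (ν (i + d + 1) * _), ← smul_sub]
      congr 1
      have := hν (i + d + 1)
      field_simp
      rfl
  refine ⟨fun i => ν i, fun i => hν i, fun A hA => ?_⟩
  have hsum := Matrix.matrix_eq_sum_single A
  have map_entry : ∀ i j : Fin n, φ (single i j (A i j)) =
      single i j (ν i * A i j * (ν j)⁻¹) := by
    intro i j
    by_cases hij : j ≤ i
    · rw [hA i j hij]; simp
    · obtain ⟨d, hd⟩ := Nat.exists_eq_add_of_lt (not_le.1 hij)
      have hj := j.2
      have : φ (single i j 1) = (ν i * (ν j)⁻¹) • single i j 1 := by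
        convert map_single d i (by omega)
      have e : ∀ r : ℝ, single i j r = r • single i j 1 := by
        intro r; rw [Matrix.smul_single, smul_eq_mul, mul_one]
      rw [e, map_smul, this, smul_smul, e (_ * _)]
      congr 1
      ring
  rw [Matrix.matrix_eq_sum_single (diagonal _ * A * diagonal _)]
  conv_lhs => rw [hsum]
  simp only [map_sum, map_entry, Matrix.mul_diagonal, Matrix.diagonal_mul]

theorem map_last (h : IsGradedAut φ) (hn : 4 ≤ n) :
    (∃ t : ℝ, φ (single ⟨n - 2, by omega⟩ ⟨n - 1, by omega⟩ 1) =
        t • single ⟨0, by omega⟩ ⟨1, by omega⟩ 1) ∨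
      ∃ t : ℝ, φ (single ⟨n - 2, by omega⟩ ⟨n - 1, by omega⟩ 1) =
        t • single ⟨n - 2, by omega⟩ ⟨n - 1, by omega⟩ 1 := by
  have e : single (⟨n - 2, by omega⟩ : Fin n) ⟨n - 1, by omega⟩ (1 : ℝ) =
      -tauLinear n (single ⟨0, by omega⟩ ⟨1, by omega⟩ 1) := by
    rw [tauLinear_single, neg_neg]; rfl
  rcases h.comp_tau.map_first hn with ⟨t, ht⟩ | ⟨t, ht⟩
  · exact Or.inl ⟨-t, by rw [e, map_neg, neg_smul, ← ht]; rfl⟩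
  · refine Or.inr ⟨-t, ?_⟩
    rw [neg_smul, ← ht, e, map_neg]; rfl

theorem not_collinear (h : IsGradedAut φ) (hn : 4 ≤ n) {B : Matrix (Fin n) (Fin n) ℝ} {s t : ℝ}
    (hs : φ (single ⟨0, by omega⟩ ⟨1, by omega⟩ 1) = s • B)
    (ht : φ (single ⟨n - 2, by omega⟩ ⟨n - 1, by omega⟩ 1) = t • B) : False := by
  have h01 : single (⟨0, by omega⟩ : Fin n) ⟨1, by omega⟩ (1 : ℝ) ∈ strictlyUpper n :=
    single_mem_strictlyUpper (by simp [Fin.lt_def])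
  have hlt : (⟨n - 2, by omega⟩ : Fin n) < ⟨n - 1, by omega⟩ := by
    simp only [Fin.lt_def]; omega
  have hz := h.eq_zero _ (Submodule.sub_mem _ (Submodule.smul_mem _ t h01)
    (Submodule.smul_mem _ s (single_mem_strictlyUpper hlt))) (by
      rw [map_sub, map_smul, map_smul, hs, ht, smul_smul, smul_smul, mul_comm, sub_self])
  have h0 := congrFun (congrFun hz ⟨0, by omega⟩) ⟨1, by omega⟩
  rw [Matrix.sub_apply, Matrix.smul_apply, Matrix.smul_apply, Matrix.single_apply_same,
    Matrix.single_apply_of_ne _ _ _ _ _ (by simp only [Fin.mk.injEq]; omega)] at h0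
  have t0 : t = 0 := by simpa using h0
  exact h.map_single_ne_zero hlt (by rw [ht, t0, zero_smul])

end IsGradedAut

/-- Every graded automorphism of `𝔫` (for `n ≥ 4`) is of the form `τ^ε ∘ Ad_g`
with `g` an invertible diagonal matrix and `ε ∈ {0,1}`. -/
theorem graded_automorphism_classification
    (n : ℕ) (hn : 4 ≤ n)
    (φ : Matrix (Fin n) (Fin n) ℝ →ₗ[ℝ] Matrix (Fin n) (Fin n) ℝ)
    (hgraded : ∀ i : ℕ, 1 ≤ i → Submodule.map φ (superdiag n i) = superdiag n i)
    (hbracket : ∀ A ∈ strictlyUpper n, ∀ B ∈ strictlyUpper n,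
      φ (A * B - B * A) = φ A * φ B - φ B * φ A)
    (hinj : ∀ A ∈ strictlyUpper n, φ A = 0 → A = 0) :
    ∃ (ε : Bool) (lam : Fin n → ℝ), (∀ i, lam i ≠ 0) ∧
      ∀ A ∈ strictlyUpper n,
        φ A = (cond ε (tauR n) id)
          (Matrix.diagonal lam * A * Matrix.diagonal fun i => (lam i)⁻¹) := by
  have h : IsGradedAut φ := ⟨hgraded 1 le_rfl, hbracket, hinj⟩
  have swap : ∀ (t : ℝ) {A : Matrix (Fin n) (Fin n) ℝ} {a b : Fin n},
      φ A = t • Matrix.single a b 1 →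
        (tauLinear n ∘ₗ φ) A = (-t) • Matrix.single b.rev a.rev 1 := by
    intro t A a b hA
    rw [LinearMap.comp_apply, hA, map_smul, tauLinear_single, smul_neg, neg_smul]
  rcases h.map_first hn with ⟨s, hs⟩ | ⟨s, hs⟩ <;> rcases h.map_last hn with ⟨t, ht⟩ | ⟨t, ht⟩
  · exact (h.not_collinear hn hs ht).elim
  · obtain ⟨lam, h0, hlam⟩ := h.exists_eq_conj hn hs ht
    exact ⟨false, lam, h0, hlam⟩
  · have rev0 : Fin.rev (⟨n - 1, by omega⟩ : Fin n) = ⟨0, by omega⟩ := by ext; simp; omega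
    have rev1 : Fin.rev (⟨n - 2, by omega⟩ : Fin n) = ⟨1, by omega⟩ := by ext; simp; omega
    have hs' := swap s hs
    rw [rev0, rev1] at hs'
    obtain ⟨lam, h0, hlam⟩ := h.tau_comp.exists_eq_conj hn hs' (swap t ht)
    refine ⟨true, lam, h0, fun A hA => ?_⟩
    rw [← hlam A hA]
    exact (tauLinear_tauLinear (φ A)).symm
  · exact (h.not_collinear hn hs ht).elim
end

section
/- Let n ≥ 4. For 1 ≤ j ≤ n−1 let 𝔨_j ⊆ 𝔫 be the Lie subalgebra generated by the matrix units {X_{i,i+1} : 1 ≤ i ≤ n−1, i ≠ n−j} (equivalently, 𝔨_j = {A ∈ 𝔫 : A_{ab} = 0 whenever a ≤ n−j < b}). Then a graded automorphism φ of 𝔫 is of the form φ = Ad_g for some invertible diagonal matrix g = diag(λ₁,…,λₙ), where Ad_g(A) = g A g⁻¹, if and only if φ(𝔨_j) = 𝔨_j for all 1 ≤ j ≤ n−1. -/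
/-- The Lie subalgebra `𝔨_j ⊆ 𝔫`: strictly upper triangular matrices `A` with
`A_{ab} = 0` whenever `a ≤ n - j < b` (1-indexed), i.e. `a < n - j ≤ b` in
0-indexed notation. -/
def kSubalg (n j : ℕ) : Submodule ℝ (Matrix (Fin n) (Fin n) ℝ) where
  carrier := {A | (∀ a b : Fin n, b ≤ a → A a b = 0) ∧
    ∀ a b : Fin n, (a : ℕ) < n - j → n - j ≤ (b : ℕ) → A a b = 0}
  add_mem' := fun ha hb => by
    refine ⟨fun a b h => ?_, fun a b h1 h2 => ?_⟩
    · simp only [Matrix.add_apply, ha.1 a b h, hb.1 a b h, add_zero]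
    · simp only [Matrix.add_apply, ha.2 a b h1 h2, hb.2 a b h1 h2, add_zero]
  zero_mem' := ⟨fun a b _ => rfl, fun a b _ _ => rfl⟩
  smul_mem' := fun c A hA => by
    refine ⟨fun a b h => ?_, fun a b h1 h2 => ?_⟩
    · simp only [Matrix.smul_apply, hA.1 a b h, smul_zero]
    · simp only [Matrix.smul_apply, hA.2 a b h1 h2, smul_zero]

open Matrix in
/-- If `φ` rescales the simple root vectors `X_{k,k+1}` by `lam k / lam (k+1)` and respects brackets,
it rescales every root vector `X_{ab}` by `lam a / lam b`. -/
lemma map_single_of_map_simple_single {n : ℕ}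
    (φ : Matrix (Fin n) (Fin n) ℝ →ₗ[ℝ] Matrix (Fin n) (Fin n) ℝ)
    (hbracket : ∀ A ∈ strictlyUpper n, ∀ B ∈ strictlyUpper n,
      φ (A * B - B * A) = φ A * φ B - φ B * φ A)
    (lam : Fin n → ℝ) (hlam : ∀ i, lam i ≠ 0)
    (hsimple : ∀ a b : Fin n, (b : ℕ) = a + 1 →
      φ (single a b 1) = (lam a * (lam b)⁻¹) • single a b 1)
    (a b : Fin n) (hab : a < b) :
    φ (single a b 1) = (lam a * (lam b)⁻¹) • single a b 1 := by
  have hmem : ∀ i j : Fin n, i < j → (single i j 1 : Matrix (Fin n) (Fin n) ℝ) ∈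
      strictlyUpper n := by
    intro i j hij k l hlk
    rw [single_apply, if_neg]
    rintro ⟨rfl, rfl⟩
    exact absurd hij (not_lt.mpr hlk)
  obtain ⟨d, hd⟩ : ∃ d : ℕ, (b : ℕ) = a + 1 + d := ⟨b - (a + 1), by grind⟩
  induction d generalizing b with
  | zero => exact hsimple a b hd
  | succ d ih =>
    obtain ⟨c, hc⟩ : ∃ c : Fin n, (c : ℕ) = a + 1 + d := ⟨⟨a + 1 + d, by grind⟩, rfl⟩
    have hac : a < c := by grind
    have hcb : c < b := by grind
    have hsplit : (single a b 1 : Matrix (Fin n) (Fin n) ℝ) =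
        single a c 1 * single c b 1 - single c b 1 * single a c 1 := by
      simp [hab.ne']
    rw [hsplit, hbracket _ (hmem a c hac) _ (hmem c b hcb), ih c hac hc,
      hsimple c b (by grind)]
    simp only [smul_mul_smul_comm, single_mul_single_same, mul_one]
    rw [single_mul_single_of_ne _ _ _ _ hab.ne']
    have := hlam c
    simp only [smul_zero, sub_zero]
    congr 1
    field_simp

open Matrix in
/-- A graded linear map preserving every `𝔨_j` rescales the simple root vectors. -/
lemma map_simple_single_of_preserves_kSubalg {n : ℕ}
    (φ : Matrix (Fin n) (Fin n) ℝ →ₗ[ℝ] Matrix (Fin n) (Fin n) ℝ)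
    (hgraded : Submodule.map φ (superdiag n 1) = superdiag n 1)
    (hk : ∀ j : ℕ, 1 ≤ j → j ≤ n - 1 → Submodule.map φ (kSubalg n j) = kSubalg n j)
    (a b : Fin n) (hab : (b : ℕ) = a + 1) :
    φ (single a b 1) = φ (single a b 1) a b • single a b 1 := by
  have hdiag : φ (single a b 1) ∈ superdiag n 1 := by
    rw [← hgraded]
    refine Submodule.mem_map_of_mem fun i j hij => ?_
    rw [single_apply, if_neg]
    grind
  ext i j
  rw [Matrix.smul_apply, single_apply]
  split_ifs with h
  · simp [h.1, h.2]
  rw [smul_zero]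
  by_cases hij : (j : ℕ) = i + 1
  · have hne : i ≠ a := fun h' => h ⟨h'.symm, by ext; grind⟩
    have hmem : φ (single a b 1) ∈ kSubalg n (n - j) := by
      rw [← hk (n - j) (by grind) (by grind)]
      refine Submodule.mem_map_of_mem ⟨fun k l hlk => ?_, fun k l h1 h2 => ?_⟩
      all_goals
        rw [single_apply, if_neg]
        rintro ⟨rfl, rfl⟩
        have := Fin.val_ne_of_ne hne
        grind
    exact hmem.2 i j (by grind) (by grind)
  · exact hdiag i j hij

/-- A graded automorphism of `𝔫` (for `n ≥ 4`) is conjugation by an invertible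
diagonal matrix if and only if it preserves the subalgebras `𝔨_j` for all
`1 ≤ j ≤ n - 1`. -/
theorem graded_automorphism_diagonal_iff_preserves_kSubalg
    (n : ℕ) (hn : 4 ≤ n)
    (φ : Matrix (Fin n) (Fin n) ℝ →ₗ[ℝ] Matrix (Fin n) (Fin n) ℝ)
    (hgraded : ∀ i : ℕ, 1 ≤ i → Submodule.map φ (superdiag n i) = superdiag n i)
    (hbracket : ∀ A ∈ strictlyUpper n, ∀ B ∈ strictlyUpper n,
      φ (A * B - B * A) = φ A * φ B - φ B * φ A)
    (hinj : ∀ A ∈ strictlyUpper n, φ A = 0 → A = 0) :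
    (∃ lam : Fin n → ℝ, (∀ i, lam i ≠ 0) ∧
      ∀ A ∈ strictlyUpper n,
        φ A = Matrix.diagonal lam * A * Matrix.diagonal fun i => (lam i)⁻¹) ↔
    (∀ j : ℕ, 1 ≤ j → j ≤ n - 1 → Submodule.map φ (kSubalg n j) = kSubalg n j) := by
  constructor
  · rintro ⟨lam, hlam, hφ⟩ j - -
    have hle : kSubalg n j ≤ strictlyUpper n := fun A hA => hA.1
    have hentry : ∀ (μ : Fin n → ℝ), ∀ A ∈ kSubalg n j,
        Matrix.diagonal μ * A * (Matrix.diagonal fun i => (μ i)⁻¹) ∈ kSubalg n j := by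
      refine fun μ A hA => ⟨fun a b h => ?_, fun a b h1 h2 => ?_⟩
      · simp [Matrix.mul_diagonal, Matrix.diagonal_mul, hA.1 a b h]
      · simp [Matrix.mul_diagonal, Matrix.diagonal_mul, hA.2 a b h1 h2]
    apply le_antisymm
    · rintro _ ⟨A, hA, rfl⟩
      rw [hφ A (hle hA)]
      exact hentry lam A hA
    · intro A hA
      have hB := hentry (fun i => (lam i)⁻¹) A hA
      refine ⟨_, hB, ?_⟩
      rw [hφ _ (hle hB)]
      ext a b
      have ha := hlam a
      have hb := hlam b
      simp only [Matrix.mul_diagonal, Matrix.diagonal_mul]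
      field_simp
  · intro hk
    have hsimple := map_simple_single_of_preserves_kSubalg φ (hgraded 1 le_rfl) hk
    let c : ℕ → ℝ := fun k => if h : k + 1 < n then
      φ (Matrix.single ⟨k, by omega⟩ ⟨k + 1, h⟩ 1) ⟨k, by omega⟩ ⟨k + 1, h⟩ else 1
    have hc : ∀ k, c k ≠ 0 := by
      intro k
      by_cases h : k + 1 < n
      · simp only [c, dif_pos h]
        intro h0
        have hs := hsimple ⟨k, by omega⟩ ⟨k + 1, h⟩ rfl
        rw [h0, zero_smul] at hs
        have hz := hinj _ (fun i j hji => by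
          rw [Matrix.single_apply, if_neg]
          grind) hs
        simpa using congrFun₂ hz ⟨k, by omega⟩ ⟨k + 1, h⟩
      · simp [c, dif_neg h]
    let lam : Fin n → ℝ := fun i => ∏ k ∈ Finset.range i, (c k)⁻¹
    have hlam : ∀ i, lam i ≠ 0 := fun i => Finset.prod_ne_zero_iff.mpr fun k _ => inv_ne_zero (hc k)
    refine ⟨lam, hlam, fun A hA => ?_⟩
    have hsingle := map_single_of_map_simple_single φ hbracket lam hlam fun a b hab => by
      have hratio : lam a * (lam b)⁻¹ = φ (Matrix.single a b 1) a b := by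
        obtain ⟨b, hb⟩ := b
        obtain rfl : b = a + 1 := hab
        have ha := hlam a
        have hca := hc a
        have hlb : lam ⟨a + 1, hb⟩ = lam a * (c a)⁻¹ := Finset.prod_range_succ _ _
        have hcφ : c a = φ (Matrix.single a ⟨a + 1, hb⟩ 1) a ⟨a + 1, hb⟩ := dif_pos hb
        rw [hlb, ← hcφ]
        field_simp
      rw [hratio]
      exact hsimple a b hab
    have hterm : ∀ a b : Fin n, φ (Matrix.single a b (A a b)) =
        Matrix.single a b (lam a * A a b * (lam b)⁻¹) := by
      intro a b
      rcases lt_or_ge a b with hab | hba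
      · have := hsingle a b hab
        rw [← mul_one (A a b), ← smul_eq_mul, ← Matrix.smul_single, map_smul, this, smul_smul,
          Matrix.smul_single]
        congr 1
        simp only [smul_eq_mul]
        ring
      · simp [hA a b hba]
    conv_lhs => rw [Matrix.matrix_eq_sum_single A]
    conv_rhs => rw [Matrix.matrix_eq_sum_single
      (Matrix.diagonal lam * A * Matrix.diagonal fun i => (lam i)⁻¹)]
    simp only [map_sum, hterm, Matrix.mul_diagonal, Matrix.diagonal_mul]
end

section
/- Let n ≥ 2 and let N ⊂ GL(n,ℝ) be the group of upper triangular matrices with 1s on the diagonal. A complete flag (W₁,…,W_{n−1}) in ℝⁿ lies in the N-orbit of the standard decreasing flag (W_j^−), i.e. there exists g ∈ N with W_j = g·W_j^− for all j, if and only if W_j ∩ W_{n−j}^+ = {0} for every 1 ≤ j ≤ n−1. -/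
/-- `W_j^+ = span(e₁, …, e_j)`: the span of the first `j` standard basis vectors. -/
def stdIncFlag (n j : ℕ) : Submodule ℝ (Fin n → ℝ) :=
  Submodule.span ℝ {x | ∃ i : Fin n, (i : ℕ) < j ∧ x = Pi.single i 1}

/-- `W_j^- = span(eₙ, …, e_{n-j+1})`: the span of the last `j` standard basis vectors. -/
def stdDecFlag (n j : ℕ) : Submodule ℝ (Fin n → ℝ) :=
  Submodule.span ℝ {x | ∃ i : Fin n, n - j ≤ (i : ℕ) ∧ x = Pi.single i 1}

theorem apply_eq_zero_of_mem_span_single {n : ℕ} {p : Fin n → Prop} {x : Fin n → ℝ}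
    (hx : x ∈ Submodule.span ℝ {x | ∃ i : Fin n, p i ∧ x = Pi.single i 1})
    {k : Fin n} (hk : ¬ p k) : x k = 0 := by
  induction hx using Submodule.span_induction with
  | mem y hy =>
    obtain ⟨i, hi, rfl⟩ := hy
    have hki : k ≠ i := fun h => hk (h ▸ hi)
    simp [hki]
  | zero => rfl
  | add y z _ _ hy hz => simp [hy, hz]
  | smul a y _ hy => simp [hy]

theorem finrank_span_single {n : ℕ} (p : Fin n → Prop) [DecidablePred p] :
    Module.finrank ℝ
      (Submodule.span ℝ {x : Fin n → ℝ | ∃ i : Fin n, p i ∧ x = Pi.single i 1}) =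
      Fintype.card {i // p i} := by
  have hli : LinearIndependent ℝ (fun i : {i // p i} => (Pi.single i.1 1 : Fin n → ℝ)) :=
    (Pi.linearIndependent_single_one (Fin n) ℝ).comp _ Subtype.val_injective
  have hset : {x : Fin n → ℝ | ∃ i : Fin n, p i ∧ x = Pi.single i 1} =
      Set.range (fun i : {i // p i} => (Pi.single i.1 1 : Fin n → ℝ)) := by
    ext x
    simp [eq_comm]
  rw [hset, finrank_span_eq_card hli]

theorem finrank_stdIncFlag {n j : ℕ} (hj : j ≤ n) :
    Module.finrank ℝ (stdIncFlag n j) = j := by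
  rw [stdIncFlag, finrank_span_single, Fintype.card_subtype, Fin.card_filter_val_lt]
  exact min_eq_right hj

theorem finrank_stdDecFlag {n j : ℕ} (hj : j ≤ n) :
    Module.finrank ℝ (stdDecFlag n j) = j := by
  have h := Fintype.card_subtype_compl (fun i : Fin n => (i : ℕ) < n - j)
  simp only [not_lt] at h
  rw [stdDecFlag, finrank_span_single, h, Fintype.card_subtype, Fin.card_filter_val_lt,
    Fintype.card_fin]
  omega

/-- A vector supported on the coordinates from `m` on, whose image under a unipotent upper
triangular matrix is supported on the coordinates below `m`, vanishes. -/
theorem eq_zero_of_unipotent_mulVec {n : ℕ} {g : Matrix (Fin n) (Fin n) ℝ}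
    (hdiag : ∀ i, g i i = 1) (hlower : ∀ i j : Fin n, j < i → g i j = 0)
    {y : Fin n → ℝ} (m : ℕ) (hy : ∀ i : Fin n, (i : ℕ) < m → y i = 0)
    (hgy : ∀ i : Fin n, m ≤ (i : ℕ) → g.mulVec y i = 0) : y = 0 := by
  funext i
  induction i using WellFoundedGT.induction with
  | ind i ih =>
    rcases lt_or_ge (i : ℕ) m with him | him
    · exact hy i him
    · have h := hgy i him
      rw [Matrix.mulVec, dotProduct, Finset.sum_eq_single i] at h
      · simpa [hdiag] using h
      · intro k _ hki
        rcases lt_or_gt_of_ne hki with hk | hk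
        · simp [hlower i k hk]
        · simp [ih k hk]
      · simp

theorem inf_stdIncFlag_eq_bot_of_unipotent {n : ℕ} {g : Matrix (Fin n) (Fin n) ℝ}
    (hdiag : ∀ i, g i i = 1) (hlower : ∀ i j : Fin n, j < i → g i j = 0) (j : ℕ) :
    Submodule.map g.mulVecLin (stdDecFlag n j) ⊓ stdIncFlag n (n - j) = ⊥ := by
  rw [Submodule.eq_bot_iff]
  rintro x ⟨⟨y, hy, rfl⟩, hx⟩
  have hy0 : y = 0 := eq_zero_of_unipotent_mulVec hdiag hlower (n - j)
    (fun i hi => apply_eq_zero_of_mem_span_single hy (not_le.mpr hi))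
    (fun i hi => apply_eq_zero_of_mem_span_single hx (not_lt.mpr hi))
  simp [hy0]

theorem mulVecLin_injective_of_unipotent {n : ℕ} {g : Matrix (Fin n) (Fin n) ℝ}
    (hdiag : ∀ i, g i i = 1) (hlower : ∀ i j : Fin n, j < i → g i j = 0) :
    Function.Injective g.mulVecLin := by
  rw [injective_iff_map_eq_zero]
  intro y hy
  exact eq_zero_of_unipotent_mulVec hdiag hlower 0 (by simp) (fun i _ => congrFun hy i)

/-- A complement of `stdIncFlag n i` contains a vector whose last nonzero coordinate is a `1`
at position `i`. -/
theorem exists_mem_unipotent_column {n : ℕ} (i : Fin n) {V : Submodule ℝ (Fin n → ℝ)}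
    (hrank : Module.finrank ℝ V = n - i) (hV : V ⊓ stdIncFlag n i = ⊥) :
    ∃ w ∈ V, w i = 1 ∧ ∀ k, i < k → w k = 0 := by
  have htop : V ⊔ stdIncFlag n i = ⊤ := by
    refine Submodule.eq_top_of_disjoint _ _ ?_ (disjoint_iff.mpr hV)
    rw [hrank, finrank_stdIncFlag i.2.le, Module.finrank_fin_fun]
    omega
  have hmem : (Pi.single i 1 : Fin n → ℝ) ∈ V ⊔ stdIncFlag n i := htop ▸ Submodule.mem_top
  obtain ⟨w, hw, u, hu, hwu⟩ := Submodule.mem_sup.mp hmem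
  have huk : ∀ k : Fin n, i ≤ k → u k = 0 := fun k hk =>
    apply_eq_zero_of_mem_span_single hu (not_lt.mpr hk)
  refine ⟨w, hw, ?_, fun k hk => ?_⟩
  · simpa [huk i le_rfl] using congrFun hwu i
  · simpa [huk k hk.le, hk.ne'] using congrFun hwu k

/-- A complete flag `(W₁, …, W_{n-1})` in `ℝⁿ` lies in the orbit of the standard
decreasing flag under the unipotent upper triangular group `N` if and only if
`W_j ∩ W_{n-j}^+ = {0}` for all `1 ≤ j ≤ n-1`. -/
theorem orbit_of_decreasing_flag_iff_transverse
    (n : ℕ) (hn : 2 ≤ n) (W : ℕ → Submodule ℝ (Fin n → ℝ))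
    (hrank : ∀ j : ℕ, 1 ≤ j → j ≤ n - 1 → Module.finrank ℝ (W j) = j)
    (hchain : ∀ j : ℕ, 1 ≤ j → j + 1 ≤ n - 1 → W j ≤ W (j + 1)) :
    (∃ g : Matrix (Fin n) (Fin n) ℝ,
        (∀ i : Fin n, g i i = 1) ∧ (∀ i j : Fin n, j < i → g i j = 0) ∧
        ∀ j : ℕ, 1 ≤ j → j ≤ n - 1 →
          W j = Submodule.map g.mulVecLin (stdDecFlag n j)) ↔
    (∀ j : ℕ, 1 ≤ j → j ≤ n - 1 → W j ⊓ stdIncFlag n (n - j) = ⊥) := by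
  constructor
  · rintro ⟨g, hdiag, hlower, hW⟩ j hj hjn
    rw [hW j hj hjn]
    exact inf_stdIncFlag_eq_bot_of_unipotent hdiag hlower j
  · intro htrans
    have hmono : ∀ a b : ℕ, 1 ≤ a → a ≤ b → b ≤ n - 1 → W a ≤ W b := by
      intro a b ha hab
      induction b, hab using Nat.le_induction with
      | base => exact fun _ => le_rfl
      | succ b hab ih =>
        exact fun hb => (ih (by omega)).trans (hchain b (by omega) hb)
    have hcol : ∀ i : Fin n, ∃ w : Fin n → ℝ,
        (1 ≤ (i : ℕ) → w ∈ W (n - i)) ∧ w i = 1 ∧ ∀ k, i < k → w k = 0 := by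
      intro i
      rcases Nat.eq_zero_or_pos (i : ℕ) with hi | hi
      · exact ⟨Pi.single i 1, by omega, by simp, fun k hk => by simp [hk.ne']⟩
      · have hsub : n - (n - (i : ℕ)) = i := by omega
        have ht := htrans (n - i) (by omega) (by omega)
        rw [hsub] at ht
        obtain ⟨w, hw, h⟩ :=
          exists_mem_unipotent_column i (hrank (n - i) (by omega) (by omega)) ht
        exact ⟨w, fun _ => hw, h⟩
    choose c hcW hdiag hlower using hcol
    refine ⟨Matrix.of fun i j => c j i, hdiag, fun i j h => hlower j i h, fun j hj hjn => ?_⟩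
    symm
    apply Submodule.eq_of_le_of_finrank_eq
    · rw [stdDecFlag, Submodule.map_span_le]
      rintro _ ⟨i, hi, rfl⟩
      have hgi : (Matrix.of fun i j => c j i).mulVecLin (Pi.single i 1) = c i := by
        ext k
        simp
      rw [hgi]
      exact hmono (n - i) j (by omega) (by omega) hjn (hcW i (by omega))
    · have hinj := mulVecLin_injective_of_unipotent (g := Matrix.of fun i j => c j i)
        hdiag fun i j h => hlower j i h
      rw [← (Submodule.equivMapOfInjective _ hinj _).finrank_eq,
        finrank_stdDecFlag (by omega), hrank j hj hjn]
end

section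
/- Let n ≥ 2, fix 1 ≤ j ≤ n−1, and let K_j ⊂ N be the subgroup of upper triangular matrices g with 1s on the diagonal satisfying g_{ab} = 0 whenever a ≤ n−j < b. Then a complete flag (W₁,…,W_{n−1}) in ℝⁿ satisfies both (i) W_a ∩ W_{n−a}^+ = {0} for every 1 ≤ a ≤ n−1 and (ii) W_j = W_j^−, if and only if there exists k ∈ K_j with W_a = k·W_a^− for all 1 ≤ a ≤ n−1. -/
theorem mem_span_single_iff {n : ℕ} (p : Fin n → Prop) (x : Fin n → ℝ) :
    x ∈ Submodule.span ℝ {x : Fin n → ℝ | ∃ i : Fin n, p i ∧ x = Pi.single i 1} ↔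
      ∀ i, ¬ p i → x i = 0 := by
  constructor
  · intro hx i hi
    induction hx using Submodule.span_induction with
    | mem y hy =>
      obtain ⟨l, hl, rfl⟩ := hy
      exact Pi.single_eq_of_ne (by rintro rfl; exact hi hl) 1
    | zero => rfl
    | add y z _ _ hy hz => simp [hy, hz]
    | smul c y _ hy => simp [hy]
  · intro hx
    rw [pi_eq_sum_univ' x]
    refine Submodule.sum_mem _ fun i _ => ?_
    by_cases hi : p i
    · refine Submodule.smul_mem _ _ (Submodule.subset_span ⟨i, hi, ?_⟩)
      ext l
      simp [Pi.single_apply, eq_comm]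
    · simp [hx i hi]

theorem mem_stdIncFlag {n j : ℕ} {x : Fin n → ℝ} :
    x ∈ stdIncFlag n j ↔ ∀ i : Fin n, j ≤ (i : ℕ) → x i = 0 := by
  simp [stdIncFlag, mem_span_single_iff]

theorem mem_stdDecFlag {n j : ℕ} {x : Fin n → ℝ} :
    x ∈ stdDecFlag n j ↔ ∀ i : Fin n, (i : ℕ) < n - j → x i = 0 := by
  simp only [stdDecFlag, mem_span_single_iff, not_le]

theorem Matrix.eq_zero_of_unitriangular_mulVec {n m : ℕ} {k : Matrix (Fin n) (Fin n) ℝ}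
    (hdiag : ∀ i, k i i = 1) (hupper : ∀ a b : Fin n, b < a → k a b = 0) {y : Fin n → ℝ}
    (hy : ∀ i : Fin n, m ≤ (i : ℕ) → (k.mulVec y) i = 0) (i : Fin n) (hi : m ≤ (i : ℕ)) :
    y i = 0 := by
  induction i using WellFoundedGT.induction with
  | ind i ih =>
    have h := hy i hi
    rw [Matrix.mulVec, dotProduct, Finset.sum_eq_single i, hdiag, one_mul] at h
    · exact h
    · intro l _ hl
      rcases lt_or_gt_of_ne hl with hlt | hgt
      · rw [hupper i l hlt, zero_mul]
      · rw [ih l hgt (hi.trans (le_of_lt hgt)), mul_zero]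
    · simp

theorem Matrix.mulVecLin_injective_of_unitriangular {n : ℕ} {k : Matrix (Fin n) (Fin n) ℝ}
    (hdiag : ∀ i, k i i = 1) (hupper : ∀ a b : Fin n, b < a → k a b = 0) :
    Function.Injective k.mulVecLin := by
  rw [injective_iff_map_eq_zero]
  intro y hy
  ext i
  exact Matrix.eq_zero_of_unitriangular_mulVec (m := 0) hdiag hupper
    (fun l _ => congrFun hy l) i (Nat.zero_le _)

theorem exists_mem_eq_single_of_inf_stdIncFlag_eq_bot {n a : ℕ} (ha : a ≤ n)
    {V : Submodule ℝ (Fin n → ℝ)} (hV : Module.finrank ℝ V = a)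
    (hdisj : V ⊓ stdIncFlag n (n - a) = ⊥) (b : Fin n) :
    ∃ v ∈ V, ∀ i : Fin n, n - a ≤ (i : ℕ) → v i = (Pi.single b 1 : Fin n → ℝ) i := by
  have htop : V ⊔ stdIncFlag n (n - a) = ⊤ := by
    refine Submodule.eq_top_of_disjoint _ _ ?_ (disjoint_iff.2 hdisj)
    rw [hV, finrank_stdIncFlag (Nat.sub_le n a), Module.finrank_fin_fun]
    omega
  obtain ⟨v, hv, z, hz, hvz⟩ := Submodule.mem_sup.1
    (htop ▸ Submodule.mem_top : (Pi.single b 1 : Fin n → ℝ) ∈ V ⊔ stdIncFlag n (n - a))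
  refine ⟨v, hv, fun i hi => ?_⟩
  rw [← hvz, Pi.add_apply, mem_stdIncFlag.1 hz i hi, add_zero]

/-- A complete flag `(W₁, …, W_{n-1})` satisfies the transversality conditions
`W_a ∩ W_{n-a}^+ = {0}` for all `a` together with `W_j = W_j^-` if and only if it
lies in the `K_j`-orbit of the standard decreasing flag, where `K_j ⊂ N` consists
of the unipotent upper triangular matrices `k` with `k_{ab} = 0` whenever
`a ≤ n - j < b` (1-indexed). -/
theorem fiber_of_pi_j_in_N_orbit
    (n : ℕ) (hn : 2 ≤ n) (j : ℕ) (hj1 : 1 ≤ j) (hj2 : j ≤ n - 1)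
    (W : ℕ → Submodule ℝ (Fin n → ℝ))
    (hrank : ∀ a : ℕ, 1 ≤ a → a ≤ n - 1 → Module.finrank ℝ (W a) = a)
    (hchain : ∀ a : ℕ, 1 ≤ a → a + 1 ≤ n - 1 → W a ≤ W (a + 1)) :
    ((∀ a : ℕ, 1 ≤ a → a ≤ n - 1 → W a ⊓ stdIncFlag n (n - a) = ⊥) ∧
        W j = stdDecFlag n j) ↔
    (∃ k : Matrix (Fin n) (Fin n) ℝ,
        (∀ i : Fin n, k i i = 1) ∧ (∀ a b : Fin n, b < a → k a b = 0) ∧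
        (∀ a b : Fin n, (a : ℕ) < n - j → n - j ≤ (b : ℕ) → k a b = 0) ∧
        ∀ a : ℕ, 1 ≤ a → a ≤ n - 1 →
          W a = Submodule.map k.mulVecLin (stdDecFlag n a)) := by
  constructor
  · rintro ⟨hdisj, hWj⟩
    have hmono : ∀ a c : ℕ, 1 ≤ a → a ≤ c → c ≤ n - 1 → W a ≤ W c := by
      intro a c ha hac
      induction c, hac using Nat.le_induction with
      | base => exact fun _ => le_rfl
      | succ c hac ih => exact fun hc => (ih (by omega)).trans (hchain c (ha.trans hac) hc)
    have hcol : ∀ b : Fin n, ∃ v : Fin n → ℝ, (1 ≤ (b : ℕ) → v ∈ W (n - b)) ∧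
        ∀ i : Fin n, b ≤ i → v i = (Pi.single b 1 : Fin n → ℝ) i := by
      intro b
      by_cases hb : 1 ≤ (b : ℕ)
      · obtain ⟨v, hv, hvi⟩ := exists_mem_eq_single_of_inf_stdIncFlag_eq_bot (Nat.sub_le n b)
          (hrank (n - b) (by omega) (by omega)) (hdisj (n - b) (by omega) (by omega)) b
        exact ⟨v, fun _ => hv, fun i hi => hvi i (by rw [Fin.le_def] at hi; omega)⟩
      · exact ⟨Pi.single b 1, fun h => absurd h hb, fun _ _ => rfl⟩
    choose v hvW hv using hcol
    have hmem : ∀ (a : ℕ) (b : Fin n), 1 ≤ a → a ≤ n - 1 → n - a ≤ (b : ℕ) → v b ∈ W a :=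
      fun a b ha han hb => hmono (n - b) a (by omega) (by omega) han (hvW b (by omega))
    have hdiag : ∀ i : Fin n, (Matrix.of fun i b => v b i) i i = 1 := fun i => by
      simp [hv i i le_rfl]
    have hupper : ∀ a b : Fin n, b < a → (Matrix.of fun i b => v b i) a b = 0 :=
      fun a b hab => by simp [hv b a hab.le, hab.ne']
    refine ⟨Matrix.of fun i b => v b i, hdiag, hupper, ?_, ?_⟩
    · intro a b ha hb
      have h := hmem j b hj1 hj2 hb
      rw [hWj] at h
      exact mem_stdDecFlag.1 h a ha
    · intro a ha han
      symm
      apply Submodule.eq_of_le_of_finrank_eq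
      · rw [stdDecFlag, Submodule.map_span_le]
        rintro _ ⟨b, hb, rfl⟩
        rw [Matrix.mulVecLin_apply, Matrix.mulVec_single_one]
        exact hmem a b ha han hb
      · rw [← (Submodule.equivMapOfInjective _
          (Matrix.mulVecLin_injective_of_unitriangular hdiag hupper) _).finrank_eq,
          finrank_stdDecFlag (by omega), hrank a ha han]
  · rintro ⟨k, hdiag, hupper, hblock, hW⟩
    refine ⟨fun a ha han => ?_, ?_⟩
    · rw [eq_bot_iff, hW a ha han]
      rintro _ ⟨⟨y, hy, rfl⟩, hx⟩
      have hy0 : y = 0 := by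
        ext i
        rcases lt_or_ge (i : ℕ) (n - a) with hi | hi
        · exact mem_stdDecFlag.1 hy i hi
        · exact Matrix.eq_zero_of_unitriangular_mulVec hdiag hupper (mem_stdIncFlag.1 hx) i hi
      simp [hy0]
    · apply Submodule.eq_of_le_of_finrank_eq
      · rw [hW j hj1 hj2, stdDecFlag, Submodule.map_span_le]
        rintro _ ⟨b, hb, rfl⟩
        rw [Matrix.mulVecLin_apply, Matrix.mulVec_single_one]
        exact mem_stdDecFlag.2 fun i hi => hblock i b hi hb
      · rw [hrank j hj1 hj2, finrank_stdDecFlag (by omega)]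
end

section
/- Let U ⊆ ℝ² be a connected open subset and let φ = (φ₁, φ₂) : U → ℝ² be a continuous map such that for every v ∈ {e₁, e₂, e₁+e₂} and every affine line L parallel to v, the image φ(L ∩ U) is contained in an affine line parallel to v. Then there exist m, b₁, b₂ ∈ ℝ such that φ(x, y) = (m x + b₁, m y + b₂) for all (x, y) ∈ U. -/
/-- A bounded function on `[-c, c]` that is additive as long as its arguments stay in the interval
is linear there. -/
theorem eq_mul_of_bounded_of_map_sub {c : ℝ} (hc : 0 < c) {F : ℝ → ℝ}
    (hbdd : ∃ C, ∀ s, |s| ≤ c → |F s| ≤ C)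
    (hsub : ∀ s t, |s| ≤ c → |t| ≤ c → |s - t| ≤ c → F (s - t) = F s - F t) :
    ∀ s, |s| ≤ c → F s = F c / c * s := by
  set m := F c / c with hm
  have hmc : F c = m * c := by rw [hm]; field_simp
  obtain ⟨C, hC⟩ := hbdd
  have h0 : F 0 = 0 := by simpa [hc.le] using hsub 0 0
  have hneg : ∀ s, |s| ≤ c → F (-s) = - F s := by
    intro s hs
    have := hsub 0 s (by simpa using hc.le) hs (by simpa using hs)
    rw [zero_sub] at this
    rw [this, h0, zero_sub]
  have hdouble : ∀ s, |s| ≤ c / 2 → F (2 * s) = 2 * F s := by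
    intro s hs
    have h1 : |s| ≤ c := by linarith
    have h2 : |s - -s| ≤ c := by rw [abs_le] at *; constructor <;> linarith
    have := hsub s (-s) h1 (by simpa using h1) h2
    rw [hneg s h1] at this
    rw [show 2 * s = s - -s by ring, this]
    ring
  -- Subtracting `m * s` leaves a `c`-periodic function, so each value is also taken on
  -- `[-c/2, c/2]`, where it can be doubled.
  have hstep : ∀ s, |s| ≤ c → ∃ s', |s'| ≤ c ∧ F s' - m * s' = 2 * (F s - m * s) := by
    intro s hs
    have key : ∃ u, |u| ≤ c / 2 ∧ F u - m * u = F s - m * s := by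
      by_cases h : |s| ≤ c / 2
      · exact ⟨s, h, rfl⟩
      have hcc : |c| ≤ c := (abs_of_pos hc).le
      rcases le_total 0 s with h' | h'
      · rw [abs_of_nonneg h'] at h hs
        have h3 : |s - c| ≤ c / 2 := by rw [abs_le]; constructor <;> linarith
        refine ⟨s - c, h3, ?_⟩
        rw [hsub s c (by rwa [abs_of_nonneg h']) hcc (by linarith), hmc]
        ring
      · rw [abs_of_nonpos h'] at h hs
        have h3 : |s - -c| ≤ c / 2 := by rw [abs_le]; constructor <;> linarith
        refine ⟨s - -c, h3, ?_⟩
        rw [hsub s (-c) (by rwa [abs_of_nonpos h']) (by simpa using hcc) (by linarith),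
          hneg c hcc, hmc]
        ring
    obtain ⟨u, hu, hus⟩ := key
    refine ⟨2 * u, by rw [abs_mul, abs_two]; linarith, ?_⟩
    rw [hdouble u hu, ← hus]
    ring
  have hiter : ∀ n : ℕ, ∀ s, |s| ≤ c →
      ∃ s', |s'| ≤ c ∧ F s' - m * s' = 2 ^ n * (F s - m * s) := by
    intro n
    induction n with
    | zero => exact fun s hs => ⟨s, hs, by simp⟩
    | succ n ih =>
      intro s hs
      obtain ⟨u, hu, hus⟩ := ih s hs
      obtain ⟨w, hw, hwu⟩ := hstep u hu
      exact ⟨w, hw, by rw [hwu, hus]; ring⟩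
  intro s hs
  by_contra hne
  have hpos : 0 < |F s - m * s| := abs_pos.2 (sub_ne_zero.2 hne)
  obtain ⟨n, hn⟩ := pow_unbounded_of_one_lt ((C + |m| * c) / |F s - m * s|)
    (one_lt_two : (1 : ℝ) < 2)
  rw [div_lt_iff₀ hpos] at hn
  obtain ⟨u, hu, hus⟩ := hiter n s hs
  have h1 : |F u - m * u| = 2 ^ n * |F s - m * s| := by
    rw [hus, abs_mul, abs_of_pos (by positivity : (0 : ℝ) < 2 ^ n)]
  have h2 : |F u - m * u| ≤ |F u| + |m| * |u| := by
    rw [← abs_mul]; exact abs_sub _ _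
  have h3 : |m| * |u| ≤ |m| * c := by gcongr
  linarith [hC u hu]

/-- A continuous map on an open set that respects the three families of parallel lines
`y = const`, `x = const`, `x - y = const` is locally a homothety or a translation. -/
theorem eventually_eq_special_affine
    {U : Set (ℝ × ℝ)} (hUopen : IsOpen U) {φ : ℝ × ℝ → ℝ × ℝ} (hcont : ContinuousOn φ U)
    (h₁ : ∀ x ∈ U, ∀ y ∈ U, x.2 = y.2 → (φ x).2 = (φ y).2)
    (h₂ : ∀ x ∈ U, ∀ y ∈ U, x.1 = y.1 → (φ x).1 = (φ y).1)
    (h₃ : ∀ x ∈ U, ∀ y ∈ U, x.1 - x.2 = y.1 - y.2 →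
      (φ x).1 - (φ x).2 = (φ y).1 - (φ y).2)
    {p : ℝ × ℝ} (hp : p ∈ U) :
    ∃ m b₁ b₂ : ℝ, φ =ᶠ[nhds p] fun x => (m * x.1 + b₁, m * x.2 + b₂) := by
  obtain ⟨c, hc, hcU⟩ := Metric.nhds_basis_closedBall.mem_iff.1 (hUopen.mem_nhds hp)
  obtain ⟨a, b⟩ := p
  have hmem : ∀ s t, |s| ≤ c → |t| ≤ c → (a + s, b + t) ∈ U := by
    intro s t hs ht
    apply hcU
    simp [Prod.dist_eq, hs, ht]
  have z : |(0 : ℝ)| ≤ c := by simpa using hc.le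
  let F : ℝ → ℝ := fun s => (φ (a + s, b + 0)).1 - (φ (a + 0, b + 0)).1
  have hG : ∀ t, |t| ≤ c → (φ (a + 0, b + t)).2 - (φ (a + 0, b + 0)).2 = F t := by
    intro t ht
    have e1 := h₃ _ (hmem t t ht ht) _ (hmem 0 0 z z) (by simp)
    have e2 := h₁ _ (hmem t t ht ht) _ (hmem 0 t z ht) rfl
    have e3 := h₂ _ (hmem t t ht ht) _ (hmem t 0 ht z) rfl
    simp only [F]
    linarith
  have hsub : ∀ s t, |s| ≤ c → |t| ≤ c → |s - t| ≤ c → F (s - t) = F s - F t := by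
    intro s t hs ht hst
    have e1 := h₃ _ (hmem s t hs ht) _ (hmem (s - t) 0 hst z) (by ring)
    have e2 := h₁ _ (hmem s t hs ht) _ (hmem 0 t z ht) rfl
    have e3 := h₂ _ (hmem s t hs ht) _ (hmem s 0 hs z) rfl
    have e4 := h₁ _ (hmem (s - t) 0 hst z) _ (hmem 0 0 z z) rfl
    have e5 := hG t ht
    simp only [F] at e5 ⊢
    linarith
  have hbdd : ∃ C, ∀ s, |s| ≤ c → |F s| ≤ C := by
    have hF : ContinuousOn F (Set.Icc (-c) c) := by
      refine (continuous_fst.comp_continuousOn (hcont.comp (by fun_prop) ?_)).sub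
        continuousOn_const
      exact fun s hs => hmem s 0 (abs_le.2 hs) z
    obtain ⟨C, hC⟩ := isCompact_Icc.exists_bound_of_continuousOn hF
    exact ⟨C, fun s hs => hC s (abs_le.1 hs)⟩
  have hlin := eq_mul_of_bounded_of_map_sub hc hbdd hsub
  set m := F c / c
  refine ⟨m, (φ (a + 0, b + 0)).1 - m * a, (φ (a + 0, b + 0)).2 - m * b, ?_⟩
  filter_upwards [Metric.closedBall_mem_nhds (a, b) hc]
  rintro ⟨x, y⟩ hxy
  simp only [Metric.mem_closedBall, Prod.dist_eq, Real.dist_eq, max_le_iff] at hxy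
  obtain ⟨hx, hy⟩ := hxy
  have hxyU := hmem _ _ hx hy
  have e1 := h₂ _ hxyU _ (hmem _ 0 hx z) rfl
  have e2 := h₁ _ hxyU _ (hmem 0 _ z hy) rfl
  have e3 := hlin _ hx
  have e4 := hlin _ hy
  rw [← hG _ hy] at e4
  simp only [F] at e3
  rw [add_sub_cancel, add_sub_cancel] at e1 e2
  rw [add_sub_cancel] at e3 e4
  ext
  · simp only; linarith
  · simp only; linarith

/-- A continuous map on a connected open subset of `ℝ²` that maps lines parallel
to `e₁`, `e₂`, `e₁ + e₂` into lines parallel to the same vector is of the form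
`(x, y) ↦ (m x + b₁, m y + b₂)`. -/
theorem line_preserving_map_is_special_affine
    (U : Set (ℝ × ℝ)) (hUopen : IsOpen U) (hUconn : IsConnected U)
    (φ : ℝ × ℝ → ℝ × ℝ) (hcont : ContinuousOn φ U)
    (hlines : ∀ v : ℝ × ℝ, v ∈ ({(1, 0), (0, 1), (1, 1)} : Set (ℝ × ℝ)) →
      ∀ p : ℝ × ℝ, ∃ q : ℝ × ℝ, ∀ x ∈ U, (∃ t : ℝ, x = p + t • v) →
        ∃ s : ℝ, φ x = q + s • v) :
    ∃ m b₁ b₂ : ℝ, ∀ x ∈ U, φ x = (m * x.1 + b₁, m * x.2 + b₂) := by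
  have hpair : ∀ v ∈ ({(1, 0), (0, 1), (1, 1)} : Set (ℝ × ℝ)), ∀ x ∈ U, ∀ y ∈ U,
      (∃ t : ℝ, y = x + t • v) → ∃ s : ℝ, φ y = φ x + s • v := by
    intro v hv x hx y hy hxy
    obtain ⟨q, hq⟩ := hlines v hv x
    obtain ⟨s, hs⟩ := hq x hx ⟨0, by simp⟩
    obtain ⟨s', hs'⟩ := hq y hy hxy
    exact ⟨s' - s, by rw [hs, hs', sub_smul]; abel⟩
  have hloc : ∀ p ∈ U, ∃ m b₁ b₂ : ℝ,
      φ =ᶠ[nhds p] fun x => (m * x.1 + b₁, m * x.2 + b₂) := by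
    intro p hp
    refine eventually_eq_special_affine hUopen hcont ?_ ?_ ?_ hp
    · intro x hx y hy hxy
      obtain ⟨s, hs⟩ := hpair (1, 0) (by simp) x hx y hy
        ⟨y.1 - x.1, by ext <;> simp [hxy]⟩
      simp [hs]
    · intro x hx y hy hxy
      obtain ⟨s, hs⟩ := hpair (0, 1) (by simp) x hx y hy
        ⟨y.2 - x.2, by ext <;> simp [hxy]⟩
      simp [hs]
    · intro x hx y hy hxy
      obtain ⟨s, hs⟩ := hpair (1, 1) (by simp) x hx y hy
        ⟨y.1 - x.1, by ext <;> simp; linarith⟩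
      simp [hs]
  have haff : ∀ m b₁ b₂ : ℝ, ∀ p,
      AnalyticAt ℝ (fun x : ℝ × ℝ => (m * x.1 + b₁, m * x.2 + b₂)) p := by
    intro m b₁ b₂ p
    exact ((analyticAt_const.mul analyticAt_fst).add analyticAt_const).prod
      ((analyticAt_const.mul analyticAt_snd).add analyticAt_const)
  have hφ : AnalyticOnNhd ℝ φ U := by
    intro p hp
    obtain ⟨m, b₁, b₂, h⟩ := hloc p hp
    exact (haff m b₁ b₂ p).congr h.symm
  obtain ⟨p, hp⟩ := hUconn.nonempty
  obtain ⟨m, b₁, b₂, h⟩ := hloc p hp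
  exact ⟨m, b₁, b₂, hφ.eqOn_of_preconnected_of_eventuallyEq
    (fun x _ => haff m b₁ b₂ x) hUconn.isPreconnected hp h⟩
end

section
/- Let n ≥ 2 and fix 1 ≤ j ≤ n−1. Let ℙ(ℝⁿ) be the real projective space of lines through the origin in ℝⁿ with its quotient topology, let Z₁ = {[v] ∈ ℙ(ℝⁿ) : v ∈ span(e₁,…,e_{n−j})} and Z₂ = {[v] ∈ ℙ(ℝⁿ) : v ∈ span(e_{n−j+1},…,eₙ)}. Let K₁ ⊆ ℙ(ℝⁿ) be a compact subset disjoint from Z₁, and let U₁ ⊆ ℙ(ℝⁿ) be an open subset containing Z₂. Then there exists r̄ > 0 such that for every 0 < r ≤ r̄, the projective transformation δ̂_r : [v] ↦ [g_r v] induced by the diagonal matrix g_r = diag(r^{−1}, r^{−2}, …, r^{−n}) maps K₁ into U₁. -/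
open scoped LinearAlgebra.Projectivization

/-- The quotient topology on `ℙ(ℝⁿ)`, inherited from `ℝⁿ \ {0}`. -/
noncomputable instance (n : ℕ) : TopologicalSpace (Projectivization ℝ (Fin n → ℝ)) :=
  instTopologicalSpaceQuotient

theorem mem_span_single_of_eq_zero {ι : Type*} [Finite ι] [DecidableEq ι] (p : ι → Prop)
    {v : ι → ℝ} (hv : ∀ i, ¬ p i → v i = 0) :
    v ∈ Submodule.span ℝ {x : ι → ℝ | ∃ i, p i ∧ x = Pi.single i 1} := by
  have := Fintype.ofFinite ι
  rw [pi_eq_sum_univ' v]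
  refine Submodule.sum_mem _ fun i _ => ?_
  by_cases hi : p i
  · refine Submodule.smul_mem _ _ (Submodule.subset_span ⟨i, hi, ?_⟩)
    ext l
    simp [Pi.single_apply, eq_comm]
  · simp [hv i hi]

theorem continuous_indicator_pi {ι : Type*} (s : Set ι) :
    Continuous fun v : ι → ℝ => s.indicator v := by
  refine continuous_pi fun i => ?_
  by_cases hi : i ∈ s
  · simpa [hi] using continuous_apply i
  · simpa [hi] using continuous_const

theorem isOpen_projectivization_iff {n : ℕ} {U : Set (ℙ ℝ (Fin n → ℝ))} :
    IsOpen U ↔ IsOpen {v : Fin n → ℝ | ∃ hv : v ≠ 0, Projectivization.mk ℝ v hv ∈ U} := by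
  have h : {v : Fin n → ℝ | ∃ hv : v ≠ 0, Projectivization.mk ℝ v hv ∈ U} =
      Subtype.val '' (Projectivization.mk' ℝ (V := Fin n → ℝ) ⁻¹' U) := by
    ext v
    simp [Projectivization.mk'_eq_mk]
  rw [h]
  exact (isOpen_ne (x := (0 : Fin n → ℝ))).isOpenEmbedding_subtypeVal.isOpen_iff_image_isOpen

/-- The lines on which the part of a vector supported on `s` is smaller than `C` times the part
supported on `sᶜ`. -/
def projectiveCone {n : ℕ} (s : Set (Fin n)) (C : ℝ) : Set (ℙ ℝ (Fin n → ℝ)) :=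
  {x | ‖s.indicator x.rep‖ < C * ‖sᶜ.indicator x.rep‖}

theorem mk_mem_projectiveCone {n : ℕ} (s : Set (Fin n)) (C : ℝ) {v : Fin n → ℝ} (hv : v ≠ 0) :
    Projectivization.mk ℝ v hv ∈ projectiveCone s C ↔
      ‖s.indicator v‖ < C * ‖sᶜ.indicator v‖ := by
  obtain ⟨a, ha⟩ := Projectivization.exists_smul_eq_mk_rep ℝ v hv
  have ha0 : 0 < ‖(a : ℝ)‖ := norm_pos_iff.2 a.ne_zero
  have key (t : Set (Fin n)) : ‖t.indicator (a • v)‖ = ‖(a : ℝ)‖ * ‖t.indicator v‖ := by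
    rw [← norm_smul]
    exact congrArg norm (Set.indicator_const_smul t (a : ℝ) v)
  rw [projectiveCone, Set.mem_ofPred_eq, ← ha, key, key, mul_left_comm, mul_lt_mul_iff_right₀ ha0]

theorem isOpen_projectiveCone {n : ℕ} (s : Set (Fin n)) (C : ℝ) :
    IsOpen (projectiveCone s C) := by
  rw [isOpen_projectivization_iff]
  simp only [mk_mem_projectiveCone, exists_prop]
  exact isOpen_ne.inter (isOpen_lt (continuous_indicator_pi s).norm
    (continuous_const.mul (continuous_indicator_pi sᶜ).norm))

/-- A compact set of lines missing the subspace of vectors supported on `s` lies in some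
`projectiveCone`. -/
theorem IsCompact.exists_subset_projectiveCone {n : ℕ} {s : Set (Fin n)}
    {K : Set (ℙ ℝ (Fin n → ℝ))} (hK : IsCompact K)
    (h : ∀ x ∈ K, sᶜ.indicator x.rep ≠ 0) : ∃ C > 0, K ⊆ projectiveCone s C := by
  obtain ⟨m, hm⟩ := hK.elim_directed_cover (fun m : ℕ => projectiveCone s ((m : ℝ) + 1))
    (fun m => isOpen_projectiveCone s _)
    (fun x hx => by
      have hpos := norm_pos_iff.2 (h x hx)
      obtain ⟨m, hm⟩ := exists_nat_gt (‖s.indicator x.rep‖ / ‖sᶜ.indicator x.rep‖)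
      rw [div_lt_iff₀ hpos] at hm
      exact Set.mem_iUnion.2 ⟨m, hm.trans (by gcongr; exact lt_add_one _)⟩)
    (Monotone.directed_le fun a b hab x hx =>
      lt_of_lt_of_le (Set.mem_ofPred_eq ▸ hx) (by gcongr))
  exact ⟨m + 1, by positivity, hm⟩

/-- An open set of lines containing the subspace of vectors vanishing on `s` contains some
`projectiveCone`. -/
theorem exists_projectiveCone_subset {n : ℕ} {s : Set (Fin n)} {U : Set (ℙ ℝ (Fin n → ℝ))}
    (hU : IsOpen U)
    (h : ∀ (v : Fin n → ℝ) (hv : v ≠ 0), s.indicator v = 0 → Projectivization.mk ℝ v hv ∈ U) :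
    ∃ ε > 0, projectiveCone s ε ⊆ U := by
  have hS : IsCompact (Metric.sphere (0 : Fin n → ℝ) 1 ∩ {v | s.indicator v = 0}) :=
    (isCompact_sphere 0 1).inter_right
      (isClosed_eq (continuous_indicator_pi s) continuous_const)
  obtain ⟨ε, hε, hsub⟩ := hS.exists_thickening_subset_open (isOpen_projectivization_iff.1 hU)
    (fun v hv => by
      have hv0 : v ≠ 0 := ne_zero_of_mem_unit_sphere ⟨v, hv.1⟩
      exact ⟨hv0, h v hv0 hv.2⟩)
  refine ⟨ε, hε, fun x hx => ?_⟩
  induction x using Projectivization.ind with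
  | h w hw =>
  rw [mk_mem_projectiveCone] at hx
  set t := ‖sᶜ.indicator w‖ with ht
  have htpos : 0 < t := by
    by_contra! hle
    nlinarith [norm_nonneg (s.indicator w)]
  obtain ⟨hw', hmem⟩ := hsub <| show t⁻¹ • w ∈ _ by
    refine Metric.mem_thickening_iff.2 ⟨t⁻¹ • sᶜ.indicator w, ⟨?_, ?_⟩, ?_⟩
    · rw [mem_sphere_zero_iff_norm, norm_smul, ← ht, norm_inv, Real.norm_of_nonneg htpos.le,
        inv_mul_cancel₀ htpos.ne']
    · rw [Set.mem_ofPred_eq]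
      ext i
      by_cases hi : i ∈ s <;> simp [hi]
    · have hsplit : w - sᶜ.indicator w = s.indicator w :=
        sub_eq_iff_eq_add.2 (Set.indicator_self_add_compl s w).symm
      rw [dist_eq_norm, ← smul_sub, hsplit, norm_smul, norm_inv, Real.norm_of_nonneg htpos.le,
        inv_mul_lt_iff₀ htpos, mul_comm]
      exact hx
  convert hmem using 1
  exact (Projectivization.mk_eq_mk_iff' ℝ _ _ _ _).2
    ⟨t, by rw [smul_smul, mul_inv_cancel₀ htpos.ne', one_smul]⟩

/-- The dilation `diag(r⁻¹, …, r⁻ⁿ)` contracts cones around the last coordinates. -/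
theorem mk_dilation_mem_projectiveCone {n k : ℕ} {C r : ℝ} (hC : 0 < C) (hr : 0 < r) (hr1 : r ≤ 1)
    {v w : Fin n → ℝ} (hw : w ≠ 0)
    (hv : ‖{i : Fin n | (i : ℕ) < k}.indicator v‖ < C * ‖{i : Fin n | (i : ℕ) < k}ᶜ.indicator v‖)
    (hwv : w = (Matrix.diagonal fun i : Fin n => r ^ (-((i : ℕ) : ℤ) - 1)).mulVec v) :
    Projectivization.mk ℝ w hw ∈ projectiveCone {i : Fin n | (i : ℕ) < k} (r * C) := by
  rw [mk_mem_projectiveCone]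
  set s := {i : Fin n | (i : ℕ) < k} with hs
  have hwi (i : Fin n) : ‖w i‖ = r ^ (-((i : ℕ) : ℤ) - 1) * ‖v i‖ := by
    rw [hwv, Matrix.mulVec_diagonal, norm_mul, Real.norm_of_nonneg (by positivity)]
  have hlow : ‖s.indicator w‖ ≤ r ^ (-(k : ℤ)) * ‖s.indicator v‖ := by
    refine (pi_norm_le_iff_of_nonneg (by positivity)).2 fun i => ?_
    by_cases hi : i ∈ s
    · have hik : (i : ℕ) < k := hi
      have hvi : ‖v i‖ ≤ ‖s.indicator v‖ := by simpa [hi] using norm_le_pi_norm (s.indicator v) i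
      rw [Set.indicator_of_mem hi, hwi]
      gcongr ?_ * ?_
      exact zpow_le_zpow_right_of_le_one₀ hr hr1 (by lia)
    · rw [Set.indicator_of_notMem hi, norm_zero]
      positivity
  have htop : r ^ (-(k : ℤ) - 1) * ‖sᶜ.indicator v‖ ≤ ‖sᶜ.indicator w‖ := by
    rw [← Real.norm_of_nonneg (show 0 ≤ r ^ (-(k : ℤ) - 1) by positivity), ← norm_smul]
    refine (pi_norm_le_iff_of_nonneg (by positivity)).2 fun i => ?_
    by_cases hi : i ∈ sᶜ
    · have hik : k ≤ (i : ℕ) := not_lt.1 hi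
      refine le_trans ?_ (norm_le_pi_norm (sᶜ.indicator w) i)
      rw [Pi.smul_apply, Set.indicator_of_mem hi, Set.indicator_of_mem hi, hwi, norm_smul,
        Real.norm_of_nonneg (by positivity)]
      gcongr ?_ * _
      exact zpow_le_zpow_right_of_le_one₀ hr hr1 (by lia)
    · simp only [Pi.smul_apply, Set.indicator_of_notMem hi, smul_zero, norm_zero, norm_nonneg]
  have hpow : r ^ (-(k : ℤ)) = r * r ^ (-(k : ℤ) - 1) := by
    rw [zpow_sub_one₀ hr.ne']
    field_simp
  calc ‖s.indicator w‖ ≤ r ^ (-(k : ℤ)) * ‖s.indicator v‖ := hlow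
    _ < r ^ (-(k : ℤ)) * (C * ‖sᶜ.indicator v‖) := by gcongr
    _ = r * C * (r ^ (-(k : ℤ) - 1) * ‖sᶜ.indicator v‖) := by rw [hpow]; ring
    _ ≤ r * C * ‖sᶜ.indicator w‖ := by gcongr

/-- Dynamics of the Carnot dilations on projective space: any compact set
disjoint from `ℙ(span(e₁,…,e_{n-j}))` is moved by `δ̂_r = [g_r]`,
`g_r = diag(r⁻¹, …, r⁻ⁿ)`, into any given open neighborhood of
`ℙ(span(e_{n-j+1},…,eₙ))`, for all sufficiently small `r > 0`. -/
theorem dilation_dynamics_on_projective_space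
    (n : ℕ) (hn : 2 ≤ n) (j : ℕ) (hj1 : 1 ≤ j) (hj2 : j ≤ n - 1)
    (Z₁ Z₂ : Set (Projectivization ℝ (Fin n → ℝ)))
    (hZ₁ : Z₁ = {x | x.submodule ≤ stdIncFlag n (n - j)})
    (hZ₂ : Z₂ = {x | x.submodule ≤ stdDecFlag n j})
    (K₁ : Set (Projectivization ℝ (Fin n → ℝ)))
    (hK₁comp : IsCompact K₁) (hK₁disj : Disjoint K₁ Z₁)
    (U₁ : Set (Projectivization ℝ (Fin n → ℝ)))
    (hU₁open : IsOpen U₁) (hU₁Z₂ : Z₂ ⊆ U₁) :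
    ∃ rbar : ℝ, 0 < rbar ∧ ∀ r : ℝ, 0 < r → r ≤ rbar →
      ∀ x ∈ K₁, ∀ (v : Fin n → ℝ) (hv : v ≠ 0),
        x = Projectivization.mk ℝ v hv →
        ∀ (w : Fin n → ℝ) (hw : w ≠ 0),
          w = (Matrix.diagonal fun i : Fin n => r ^ (-((i : ℕ) : ℤ) - 1)).mulVec v →
          Projectivization.mk ℝ w hw ∈ U₁ := by
  subst hZ₁ hZ₂
  set s := {i : Fin n | (i : ℕ) < n - j} with hs
  obtain ⟨C, hC, hKC⟩ := hK₁comp.exists_subset_projectiveCone (s := s) fun x hx h0 => by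
    refine Set.disjoint_left.1 hK₁disj hx ?_
    rw [Set.mem_ofPred_eq, Projectivization.submodule_eq, Submodule.span_singleton_le_iff_mem]
    exact mem_span_single_of_eq_zero _ fun i hi => by
      simpa [hs, hi] using congrFun h0 i
  obtain ⟨ε, hε, hεU⟩ := exists_projectiveCone_subset (s := s) hU₁open fun v hv h0 => by
    refine hU₁Z₂ ?_
    rw [Set.mem_ofPred_eq, Projectivization.submodule_mk, Submodule.span_singleton_le_iff_mem]
    exact mem_span_single_of_eq_zero _ fun i hi => by
      simpa [hs, not_le.1 hi] using congrFun h0 i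
  refine ⟨min 1 (ε / C), by positivity, fun r hr hrle x hx v hv hxv w hw hwv => hεU ?_⟩
  subst hxv
  have hcone := mk_dilation_mem_projectiveCone hC hr (hrle.trans (min_le_left _ _)) hw
    ((mk_mem_projectiveCone s C hv).1 (hKC hx)) hwv
  rw [mk_mem_projectiveCone] at hcone ⊢
  refine hcone.trans_le ?_
  gcongr
  exact (le_div_iff₀ hC).1 (hrle.trans (min_le_right _ _))
end

section
/- Let n ≥ 2. There exists an augmented projective frame (W̃⁰, W̃¹, …, W̃ⁿ, W̃^{n+1}) of 1-dimensional subspaces of ℝⁿ such that: (a) for every complete flag (U₁,…,U_{n−1}) in ℝⁿ with the property that each U_j is spanned by j of the lines W̃⁰,…,W̃^{n+1}, one has U_j ∩ span(e₁,…,e_{n−j}) = {0} for all 1 ≤ j ≤ n−1; and (b) span(W̃ⁿ ∪ W̃^{n−1} ∪ … ∪ W̃^{n−j+1}) = span(eₙ,…,e_{n−j+1}) for all 1 ≤ j ≤ n−1. -/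
open Module in
/-- Over an infinite field, given a finite family of vectors and independent subfamilies `D j` of
size `j`, there are linear forms `f₀, f₁, …` with `f_s` vanishing on `D s` such that the common
kernel of the first `j` of them meets the span of every independent `j`-subfamily trivially. -/
theorem exists_generic_dual_sequence {K V ι : Type*} [Field K] [Infinite K] [AddCommGroup V]
    [Module K V] (v : ι → V) (R : Finset ι) (D : ℕ → Finset ι) (t : ℕ)
    (hD : ∀ j < t, D j ⊆ R ∧ (D j).card = j ∧ LinearIndepOn K v (D j)) :
    ∃ f : ℕ → Dual K V,
      (∀ s < t, ∀ i ∈ D s, f s (v i) = 0) ∧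
      ∀ j ≤ t, ∀ S ⊆ R, S.card = j → LinearIndepOn K v S →
        ∀ x ∈ Submodule.span K (v '' S), (∀ s < j, f s x = 0) → x = 0 := by
  classical
  induction t with
  | zero =>
    refine ⟨0, by simp, fun j hj S _ hS _ x hx _ ↦ ?_⟩
    obtain rfl : S = ∅ := by rw [← Finset.card_eq_zero]; omega
    simpa using hx
  | succ t ih =>
    obtain ⟨f, hfD, hf⟩ := ih fun j hj ↦ hD j (by omega)
    let B : Set (Finset ι) := {S | S ⊆ R ∧ ∃ x ∈ Submodule.span K (v '' (S : Set ι)),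
      x ≠ 0 ∧ ∀ s < t, f s x = 0}
    have : Finite B := (R.powerset.finite_toSet.subset fun S hS ↦ by simpa using hS.1).to_subtype
    choose x hxS hx0 hxf using fun S : B ↦ S.2.2
    obtain ⟨hDR, hDc, hDi⟩ := hD t (by omega)
    have hxD (S : B) : x S ∉ Submodule.span K (v '' (D t : Set ι)) := fun h ↦
      hx0 S (hf t le_rfl (D t) hDR hDc hDi _ h (hxf S))
    obtain ⟨g, hgD, hg⟩ := Dual.exists_forall_mem_ne_zero_of_forall_exists
      (Submodule.span K (v '' (D t : Set ι))).dualAnnihilator (fun S : B ↦ Dual.eval K V (x S))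
      fun S ↦ by
        obtain ⟨g, hg, hle⟩ := Submodule.exists_le_ker_of_notMem (hxD S)
        exact ⟨g, (Submodule.mem_dualAnnihilator g).2 fun w hw ↦ hle hw, hg⟩
    have hlt {s j : ℕ} (hj : j ≤ t) (hs : s < j) : Function.update f t g s = f s :=
      Function.update_of_ne (by omega) _ _
    refine ⟨Function.update f t g, fun s hs i hi ↦ ?_, fun j hj S hSR hSc hSi y hy hfy ↦ ?_⟩
    · rcases Nat.lt_succ_iff_lt_or_eq.1 hs with h | rfl
      · rw [hlt le_rfl h]
        exact hfD s h i hi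
      · rw [Function.update_self]
        exact (Submodule.mem_dualAnnihilator g).1 hgD _ (Submodule.subset_span ⟨i, hi, rfl⟩)
    · rcases hj.lt_or_eq with h | rfl
      · exact hf j (by omega) S hSR hSc hSi y hy fun s hs ↦ by
          simpa only [hlt (by omega) hs] using hfy s hs
      have hfy' : ∀ s < t, f s y = 0 := fun s hs ↦ by
        simpa only [hlt le_rfl hs] using hfy s (by omega)
      have hgy : g y = 0 := by simpa using hfy t (by omega)
      by_contra hy0
      let b : B := ⟨S, hSR, y, hy, hy0, hfy'⟩
      obtain ⟨i, hi⟩ : S.Nonempty := by rw [← Finset.card_pos]; omega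
      have hsmall := hf t le_rfl (S.erase i) ((S.erase_subset i).trans hSR)
        (by rw [Finset.card_erase_of_mem hi]; omega)
        (hSi.mono (by exact_mod_cast S.erase_subset i))
      have hdec : v '' (S : Set ι) = insert (v i) (v '' (S.erase i : Finset ι)) := by
        rw [← Set.image_insert_eq, ← Finset.coe_insert, Finset.insert_erase hi]
      have hxb := hxS b
      rw [hdec, Submodule.mem_span_insert] at hy
      rw [show ((b : Finset ι) : Set ι) = S from rfl, hdec, Submodule.mem_span_insert] at hxb
      obtain ⟨c, w, hw, rfl⟩ := hy
      obtain ⟨a, u, hu, hau⟩ := hxb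
      have hprop : c • x b - a • (c • v i + w) = 0 := by
        refine hsmall _ ?_ fun s hs ↦ by
          rw [map_sub, map_smul, map_smul, hxf b s hs, hfy' s hs]; simp
        have : c • x b - a • (c • v i + w) = c • u - a • w := by
          rw [hau]; module
        rw [this]
        exact sub_mem (Submodule.smul_mem _ _ hu) (Submodule.smul_mem _ _ hw)
      have hc : c = 0 := by
        have h := congrArg g hprop
        rw [map_sub, map_smul, map_smul, hgy] at h
        simpa [show g (x b) ≠ 0 from hg b] using h
      subst hc
      refine hy0 (hsmall _ ?_ hfy')
      simpa using hw

/-- The vectors `-(1, …, 1), e₁, …, eₙ, eₙ - (1, …, 1)`, indexed by `0, …, n + 1`. -/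
def standardFrameVector (n i : ℕ) : Fin n → ℝ :=
  fun k ↦ if i = 0 then -1 else if i = n + 1 then (if (k : ℕ) + 1 = n then 0 else -1)
    else if i = k + 1 then 1 else 0

theorem sum_standardFrameVector (n : ℕ) :
    ∑ i ∈ Finset.range (n + 1), standardFrameVector n i = 0 := by
  ext k
  rw [Finset.sum_range_succ', Pi.add_apply, Finset.sum_apply,
    Finset.sum_congr rfl (g := fun i ↦ if i = (k : ℕ) then (1 : ℝ) else 0)]
  · simp [standardFrameVector]
  · intro i hi
    have : i ≠ n := by simp at hi; omega
    simp [standardFrameVector, this]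

theorem standardFrameVector_ne_zero {n : ℕ} (hn : 2 ≤ n) {i : ℕ} (hi : i ≤ n + 1) :
    standardFrameVector n i ≠ 0 := by
  intro h
  by_cases h1 : i = 0 ∨ i = n + 1
  · have := congrFun h ⟨0, by omega⟩
    rcases h1 with rfl | rfl <;> simp [standardFrameVector] at this
    omega
  · have := congrFun h ⟨i - 1, by omega⟩
    simp only [standardFrameVector, Pi.zero_apply] at this
    split_ifs at this <;> first | omega | exact one_ne_zero this

theorem standardFrameVector_add_one {n : ℕ} (hn : 0 < n) :
    standardFrameVector n (n + 1) = standardFrameVector n n + standardFrameVector n 0 := by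
  ext k
  have := k.2
  rw [Pi.add_apply]
  unfold standardFrameVector
  split_ifs <;> first | contradiction | omega | norm_num

theorem standardFrameVector_succ {n : ℕ} (k : Fin n) :
    standardFrameVector n (k + 1) = Pi.single k 1 := by
  ext l
  have := k.2
  simp only [Pi.single_apply, Fin.ext_iff]
  unfold standardFrameVector
  split_ifs <;> first | contradiction | omega | rfl

theorem span_standardFrameVector_eq_top {n : ℕ} {S : Finset ℕ} (hS : S ⊆ Finset.range (n + 1))
    (hc : S.card = n) : Submodule.span ℝ (standardFrameVector n '' S) = ⊤ := by
  have hmem : ∀ i ∈ Finset.range (n + 1),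
      standardFrameVector n i ∈ Submodule.span ℝ (standardFrameVector n '' S) := by
    intro i hi
    by_cases hiS : i ∈ S
    · exact Submodule.subset_span ⟨i, hiS, rfl⟩
    have hSe : (Finset.range (n + 1)).erase i = S :=
      (Finset.eq_of_subset_of_card_le (Finset.subset_erase.2 ⟨hS, hiS⟩)
        (by rw [Finset.card_erase_of_mem hi]; simp [hc])).symm
    have hsum := sum_standardFrameVector n
    rw [← Finset.add_sum_erase _ _ hi, hSe] at hsum
    rw [eq_neg_of_add_eq_zero_left hsum]
    exact neg_mem (sum_mem fun l hl ↦ Submodule.subset_span ⟨l, hl, rfl⟩)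
  rw [eq_top_iff, ← (Pi.basisFun ℝ (Fin n)).span_eq, Submodule.span_le]
  rintro _ ⟨k, rfl⟩
  rw [Pi.basisFun_apply, ← standardFrameVector_succ]
  exact hmem _ (by simp)

theorem linearIndepOn_standardFrameVector {n : ℕ} {S : Finset ℕ}
    (hS : S ⊆ Finset.range (n + 1)) (hc : S.card = n) :
    LinearIndepOn ℝ (standardFrameVector n) S := by
  refine linearIndependent_of_top_le_span_of_card_eq_finrank ?_ (by simp [hc])
  rw [← span_standardFrameVector_eq_top hS hc, Set.image_eq_range]

theorem span_standardFrameVector_add_one {n : ℕ} (hn : 2 ≤ n) :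
    Submodule.span ℝ {standardFrameVector n (n + 1)} =
      (Submodule.span ℝ {standardFrameVector n n} ⊔ Submodule.span ℝ {standardFrameVector n 0}) ⊓
        ⨆ i ∈ Finset.Icc 1 (n - 1), Submodule.span ℝ {standardFrameVector n i} := by
  apply le_antisymm
  · rw [Submodule.span_singleton_le_iff_mem]
    refine ⟨?_, ?_⟩
    · rw [standardFrameVector_add_one (by omega)]
      exact Submodule.add_mem_sup (Submodule.mem_span_singleton_self _)
        (Submodule.mem_span_singleton_self _)
    · have hsum := sum_standardFrameVector n
      rw [Finset.sum_range_succ, ← Nat.sub_add_cancel (show 1 ≤ n by omega),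
        Finset.sum_range_succ', Nat.sub_add_cancel (show 1 ≤ n by omega)] at hsum
      rw [standardFrameVector_add_one (by omega), add_comm,
        eq_neg_of_add_eq_zero_right ((add_assoc _ _ _).symm.trans hsum)]
      refine neg_mem (sum_mem fun i hi ↦ ?_)
      exact Submodule.mem_iSup_of_mem (i + 1) (Submodule.mem_iSup_of_mem
        (by simp at hi ⊢; omega) (Submodule.mem_span_singleton_self _))
  · rintro x ⟨h1, h2⟩
    obtain ⟨a, b, rfl⟩ : ∃ a b : ℝ,
        a • standardFrameVector n n + b • standardFrameVector n 0 = x := by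
      rw [SetLike.mem_coe, ← Submodule.span_union, Set.singleton_union,
        Submodule.mem_span_pair] at h1
      exact h1
    have hle : (⨆ i ∈ Finset.Icc 1 (n - 1), Submodule.span ℝ {standardFrameVector n i}) ≤
        LinearMap.ker (LinearMap.proj (R := ℝ) (φ := fun _ : Fin n ↦ ℝ) ⟨n - 1, by omega⟩) := by
      refine iSup₂_le fun i hi ↦ ?_
      rw [Submodule.span_singleton_le_iff_mem]
      simp only [Finset.mem_Icc] at hi
      simp only [LinearMap.mem_ker, LinearMap.proj_apply, standardFrameVector]
      split_ifs <;> first | omega | rfl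
    have hab := hle h2
    have hn' : n = n - 1 + 1 := by omega
    simp [standardFrameVector, show n ≠ 0 by omega, ← hn'] at hab
    obtain rfl : a = b := by linarith
    rw [← smul_add, ← standardFrameVector_add_one (by omega)]
    exact Submodule.smul_mem _ _ (Submodule.mem_span_singleton_self _)

theorem apply_eq_zero_of_mem_stdIncFlag {n j : ℕ} {x : Fin n → ℝ} (hx : x ∈ stdIncFlag n j)
    {k : Fin n} (hk : j ≤ k) : x k = 0 := by
  have hle : stdIncFlag n j ≤
      LinearMap.ker (LinearMap.proj (R := ℝ) (φ := fun _ : Fin n ↦ ℝ) k) := by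
    refine Submodule.span_le.2 ?_
    rintro _ ⟨i, hi, rfl⟩
    simp [show k ≠ i by rintro rfl; omega]
  exact hle hx

theorem mem_stdDecFlag_s9 {n j : ℕ} {x : Fin n → ℝ} (hx : ∀ k : Fin n, (k : ℕ) < n - j → x k = 0) :
    x ∈ stdDecFlag n j := by
  rw [pi_eq_sum_univ' x]
  refine sum_mem fun k _ ↦ ?_
  by_cases hk : (k : ℕ) < n - j
  · simp [hx k hk]
  · exact Submodule.smul_mem _ _
      (Submodule.subset_span ⟨k, by omega, by ext; simp [Pi.single_apply, eq_comm]⟩)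

theorem finrank_stdDecFlag_le {n j : ℕ} (hj : j ≤ n) :
    Module.finrank ℝ (stdDecFlag n j) ≤ j := by
  have hset : {x : Fin n → ℝ | ∃ i : Fin n, n - j ≤ (i : ℕ) ∧ x = Pi.single i 1} =
      Set.range fun l : Fin j ↦ Pi.single (⟨n - j + l, by omega⟩ : Fin n) (1 : ℝ) := by
    ext x
    constructor
    · rintro ⟨i, hi, rfl⟩
      refine ⟨⟨i - (n - j), by omega⟩, ?_⟩
      simp only
      congr 1
      ext
      grind
    · rintro ⟨l, rfl⟩
      exact ⟨_, by simp, rfl⟩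
  rw [stdDecFlag, hset]
  exact (finrank_range_le_card _).trans (by simp)


/-- There is an augmented projective frame `(W⁰, …, Wⁿ, W^{n+1})` of lines in
`ℝⁿ` such that (a) every complete flag each of whose members is spanned by
lines of the frame is transverse to the standard increasing flag, and
(b) the last `j` frame lines `Wⁿ, …, W^{n-j+1}` span `W_j^- = span(eₙ,…,e_{n-j+1})`. -/
theorem exists_good_augmented_projective_frame (n : ℕ) (hn : 2 ≤ n) :
    ∃ W : ℕ → Submodule ℝ (Fin n → ℝ),
      -- each member of the tuple is a line
      (∀ i : ℕ, i ≤ n + 1 → Module.finrank ℝ (W i) = 1) ∧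
      -- projective frame: any n of W⁰, …, Wⁿ span ℝⁿ
      (∀ S : Finset ℕ, S ⊆ Finset.range (n + 1) → S.card = n →
        (⨆ i ∈ S, W i) = ⊤) ∧
      -- augmentation: W^{n+1} = span(Wⁿ ∪ W⁰) ∩ span(W¹ ∪ … ∪ W^{n-1})
      (W (n + 1) = (W n ⊔ W 0) ⊓ (⨆ i ∈ Finset.Icc 1 (n - 1), W i)) ∧
      -- (a): flags spanned by frame lines are transverse to the increasing flag
      (∀ U : ℕ → Submodule ℝ (Fin n → ℝ),
        (∀ j : ℕ, 1 ≤ j → j ≤ n - 1 → Module.finrank ℝ (U j) = j) →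
        (∀ j : ℕ, 1 ≤ j → j + 1 ≤ n - 1 → U j ≤ U (j + 1)) →
        (∀ j : ℕ, 1 ≤ j → j ≤ n - 1 →
          ∃ S : Finset ℕ, S ⊆ Finset.range (n + 2) ∧ S.card = j ∧
            U j = ⨆ i ∈ S, W i) →
        ∀ j : ℕ, 1 ≤ j → j ≤ n - 1 → U j ⊓ stdIncFlag n (n - j) = ⊥) ∧
      -- (b): span(Wⁿ, …, W^{n-j+1}) = W_j^-
      (∀ j : ℕ, 1 ≤ j → j ≤ n - 1 →
        (⨆ i ∈ Finset.Icc (n - j + 1) n, W i) = stdDecFlag n j) := by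
  have hIcc {j : ℕ} (hj : j ≤ n) :
      LinearIndepOn ℝ (standardFrameVector n) (Finset.Icc (n - j + 1) n) := by
    refine (linearIndepOn_standardFrameVector (S := Finset.Icc 1 n) (fun i ↦ ?_)
      (by simp)).mono fun i ↦ ?_ <;> simp <;> omega
  obtain ⟨f, hfD, hf⟩ := exists_generic_dual_sequence (K := ℝ) (standardFrameVector n)
    (Finset.range (n + 2)) (fun j ↦ Finset.Icc (n - j + 1) n) n fun j hj ↦
      ⟨fun i ↦ by simp; omega, by simp; omega, hIcc hj.le⟩
  let φ : (Fin n → ℝ) →ₗ[ℝ] (Fin n → ℝ) := LinearMap.pi fun k ↦ f (n - 1 - k)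
  have hφ (x : Fin n → ℝ) (k : Fin n) : φ x k = f (n - 1 - k) x := rfl
  have hinj : Function.Injective φ := by
    refine (injective_iff_map_eq_zero φ).2 fun x hx ↦ ?_
    have hsub : Finset.Icc 1 n ⊆ Finset.range (n + 1) := fun i ↦ by simp
    refine hf n le_rfl (Finset.Icc 1 n) (fun i ↦ by simp; omega) (by simp)
      (linearIndepOn_standardFrameVector hsub (by simp)) x
      (by rw [span_standardFrameVector_eq_top hsub (by simp)]; trivial) fun s hs ↦ ?_
    have h := congrFun hx ⟨n - 1 - s, by omega⟩
    rwa [hφ, show n - 1 - (n - 1 - s) = s by omega] at h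
  have hrank (p : Submodule ℝ (Fin n → ℝ)) :
      Module.finrank ℝ (p.map φ) = Module.finrank ℝ p :=
    (Submodule.equivMapOfInjective φ hinj p).finrank_eq.symm
  have hmap (S : Finset ℕ) : (⨆ i ∈ S, (Submodule.span ℝ {standardFrameVector n i}).map φ) =
      (Submodule.span ℝ (standardFrameVector n '' S)).map φ := by
    rw [← Set.biUnion_of_singleton (standardFrameVector n '' S), Set.biUnion_image]
    simp only [Submodule.span_iUnion₂, Submodule.map_iSup, Finset.mem_coe]
  refine ⟨fun i ↦ (Submodule.span ℝ {standardFrameVector n i}).map φ, fun i hi ↦ ?_,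
    fun S hS hc ↦ ?_, ?_, fun U hU _ hUS j hj hjn ↦ ?_, fun j hj hjn ↦ ?_⟩
  · rw [hrank]
    exact finrank_span_singleton (standardFrameVector_ne_zero hn hi)
  · rw [hmap, span_standardFrameVector_eq_top hS hc, Submodule.map_top, LinearMap.range_eq_top]
    exact LinearMap.injective_iff_surjective.1 hinj
  · simp only [← Submodule.map_iSup, ← Submodule.map_sup, ← Submodule.map_inf φ hinj]
    rw [span_standardFrameVector_add_one hn]
  · obtain ⟨S, hS, hc, hUj⟩ := hUS j hj hjn
    rw [hmap] at hUj
    have hSi : LinearIndepOn ℝ (standardFrameVector n) S := by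
      refine linearIndependent_iff_card_eq_finrank_span.2 ?_
      have h := hU j hj hjn
      rw [hUj, hrank, Set.image_eq_range] at h
      rw [Set.finrank]
      simpa [hc] using h.symm
    rw [hUj, eq_bot_iff]
    rintro _ ⟨⟨x, hx, rfl⟩, hinc⟩
    rw [hf j (by omega) S hS hc hSi x hx fun s hs ↦ ?_, map_zero]
    · exact zero_mem _
    have h := apply_eq_zero_of_mem_stdIncFlag hinc (k := ⟨n - 1 - s, by omega⟩)
      (by grind)
    rwa [hφ, show n - 1 - (n - 1 - s) = s by omega] at h
  · rw [hmap]
    refine Submodule.eq_of_le_of_finrank_le ?_ ?_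
    · rw [Submodule.map_span_le]
      rintro _ ⟨i, hi, rfl⟩
      refine mem_stdDecFlag_s9 fun k hk ↦ ?_
      rw [Finset.mem_coe, Finset.mem_Icc] at hi
      exact hfD _ (by omega) i (Finset.mem_Icc.2 (by omega))
    · rw [hrank, Set.image_eq_range]
      refine (finrank_stdDecFlag_le (by omega)).trans
        (le_of_eq ((?_ : j = _).trans (finrank_span_eq_card (hIcc (by omega))).symm))
      simp
      omega
end

section
/- Let λ, μ be quaternions satisfying λ² = μ² = (λμ)² = −1, and set ν = λμ. Then the real-linear map h : ℍ → ℍ defined by h(a₀ + a₁ i + a₂ j + a₃ k) = a₀ + a₁ λ + a₂ μ + a₃ ν (for a₀, a₁, a₂, a₃ ∈ ℝ) is a ring automorphism of ℍ. Conversely, every ring automorphism h of ℍ is of this form: setting λ = h(i), μ = h(j), ν = h(k), one has λ² = μ² = ν² = −1, ν = λμ, and h(a₀ + a₁ i + a₂ j + a₃ k) = a₀ + a₁ λ + a₂ μ + a₃ ν for all a₀, a₁, a₂, a₃ ∈ ℝ. -/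
open scoped Quaternion

namespace Quaternion

/-- The quaternion unit `i`. -/
@[simps]
noncomputable def unitI : ℍ[ℝ] := ⟨0, 1, 0, 0⟩

/-- The quaternion unit `j`. -/
@[simps]
noncomputable def unitJ : ℍ[ℝ] := ⟨0, 0, 1, 0⟩

/-- The quaternion unit `k`. -/
@[simps]
noncomputable def unitK : ℍ[ℝ] := ⟨0, 0, 0, 1⟩

theorem unitI_sq : unitI ^ 2 = -1 := by ext <;> simp [sq]

theorem unitJ_sq : unitJ ^ 2 = -1 := by ext <;> simp [sq]

theorem unitK_sq : unitK ^ 2 = -1 := by ext <;> simp [sq]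

theorem unitK_eq_mul : unitK = unitI * unitJ := by ext <;> simp

theorem eq_coe_add_units (x : ℍ[ℝ]) :
    x = (x.re : ℍ[ℝ]) + x.imI * unitI + x.imJ * unitJ + x.imK * unitK := by
  ext <;> simp

/-- A quaternion commuting with `i` and `j` is real. -/
theorem eq_coe_re_of_commute {x : ℍ[ℝ]} (hi : Commute x unitI) (hj : Commute x unitJ) :
    x = (x.re : ℍ[ℝ]) := by
  have h₁ : (x * unitI).imJ = (unitI * x).imJ := by rw [hi.eq]
  have h₂ : (x * unitI).imK = (unitI * x).imK := by rw [hi.eq]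
  have h₃ : (x * unitJ).imK = (unitJ * x).imK := by rw [hj.eq]
  simp at h₁ h₂ h₃
  ext <;> simp <;> linarith

/-- Every ring automorphism of the real quaternions fixes the real numbers. -/
theorem ringEquiv_coe (e : ℍ[ℝ] ≃+* ℍ[ℝ]) (r : ℝ) : e (r : ℍ[ℝ]) = (r : ℍ[ℝ]) := by
  have hcomm (r : ℝ) (y : ℍ[ℝ]) : e r * y = y * e r := by
    obtain ⟨z, rfl⟩ := e.surjective y
    rw [← map_mul, ← map_mul, coe_commutes]
  have hre (r : ℝ) : e (r : ℍ[ℝ]) = ((e (r : ℍ[ℝ])).re : ℍ[ℝ]) :=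
    eq_coe_re_of_commute (hcomm r _) (hcomm r _)
  let f : ℝ →+* ℝ :=
    { toFun := fun r => (e (r : ℍ[ℝ])).re
      map_one' := by simp
      map_mul' := fun a b => by
        apply coe_injective
        rw [coe_mul a b, map_mul, coe_mul, ← hre, ← hre, ← map_mul, ← coe_mul, ← hre]
      map_zero' := by simp
      map_add' := fun a b => by simp }
  have hf : f r = r := congrArg (fun g : ℝ →+* ℝ => g r) (Subsingleton.elim f (RingHom.id ℝ))
  rw [hre r]
  exact congrArg _ hf

/-- The quaternionic basis given by `l`, `m` and `l * m`, all of square `-1`. -/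
noncomputable def basisOfSqEqNegOne (l m : ℍ[ℝ]) (hl : l ^ 2 = -1) (hm : m ^ 2 = -1)
    (hlm : (l * m) ^ 2 = -1) : QuaternionAlgebra.Basis ℍ[ℝ] (-1 : ℝ) 0 (-1) where
  i := l
  j := m
  k := l * m
  i_mul_i := by simpa [sq] using hl
  j_mul_j := by simpa [sq] using hm
  i_mul_j := rfl
  j_mul_i := by
    have h : l ^ 2 * (m * l) * m ^ 2 = l * (l * m) ^ 2 * m := by noncomm_ring
    simpa [hl, hm, hlm] using h

theorem ringEquiv_apply (e : ℍ[ℝ] ≃+* ℍ[ℝ]) (x : ℍ[ℝ]) :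
    e x = (x.re : ℍ[ℝ]) + x.imI • e unitI + x.imJ • e unitJ + x.imK • e unitK := by
  conv_lhs => rw [eq_coe_add_units x]
  simp only [map_add, map_mul, ringEquiv_coe, ← coe_mul_eq_smul]

theorem ringEquiv_apply_sq (e : ℍ[ℝ] ≃+* ℍ[ℝ]) {x : ℍ[ℝ]} (hx : x ^ 2 = -1) :
    (e x) ^ 2 = -1 := by
  rw [← map_pow, hx, map_neg, map_one]

end Quaternion

/-- Classification of the ring automorphisms of `ℍ`: for unit quaternions
`λ, μ` with `λ² = μ² = (λμ)² = -1`, the real-linear map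
`a₀ + a₁ i + a₂ j + a₃ k ↦ a₀ + a₁ λ + a₂ μ + a₃ (λμ)` is a ring automorphism
of `ℍ`, and conversely every ring automorphism of `ℍ` arises this way. -/
theorem quaternion_automorphism_classification :
    (∀ l m : ℍ[ℝ], l ^ 2 = -1 → m ^ 2 = -1 → (l * m) ^ 2 = -1 →
      ∃ e : ℍ[ℝ] ≃+* ℍ[ℝ], ∀ x : ℍ[ℝ],
        e x = (x.re : ℍ[ℝ]) + x.imI • l + x.imJ • m + x.imK • (l * m)) ∧
    (∀ e : ℍ[ℝ] ≃+* ℍ[ℝ],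
      (e (⟨0, 1, 0, 0⟩ : ℍ[ℝ])) ^ 2 = -1 ∧
      (e (⟨0, 0, 1, 0⟩ : ℍ[ℝ])) ^ 2 = -1 ∧
      (e (⟨0, 0, 0, 1⟩ : ℍ[ℝ])) ^ 2 = -1 ∧
      e (⟨0, 0, 0, 1⟩ : ℍ[ℝ]) = e (⟨0, 1, 0, 0⟩ : ℍ[ℝ]) * e (⟨0, 0, 1, 0⟩ : ℍ[ℝ]) ∧
      ∀ x : ℍ[ℝ], e x = (x.re : ℍ[ℝ]) + x.imI • e (⟨0, 1, 0, 0⟩ : ℍ[ℝ]) +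
        x.imJ • e (⟨0, 0, 1, 0⟩ : ℍ[ℝ]) + x.imK • e (⟨0, 0, 0, 1⟩ : ℍ[ℝ])) := by
  refine ⟨fun l m hl hm hlm => ?_, fun e => ?_⟩
  · let f : ℍ[ℝ] →ₐ[ℝ] ℍ[ℝ] := (Quaternion.basisOfSqEqNegOne l m hl hm hlm).liftHom
    have hinj : Function.Injective f := f.toRingHom.injective
    have hsurj : Function.Surjective f :=
      LinearMap.injective_iff_surjective (f := f.toLinearMap).mp hinj
    exact ⟨RingEquiv.ofBijective f ⟨hinj, hsurj⟩, fun x => rfl⟩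
  · exact ⟨Quaternion.ringEquiv_apply_sq e Quaternion.unitI_sq,
      Quaternion.ringEquiv_apply_sq e Quaternion.unitJ_sq,
      Quaternion.ringEquiv_apply_sq e Quaternion.unitK_sq,
      (congrArg e Quaternion.unitK_eq_mul).trans (map_mul e _ _),
      Quaternion.ringEquiv_apply e⟩
end

section
/- Let n ≥ 3 and let 𝔫_ℍ be the real Lie algebra of strictly upper triangular n×n quaternion matrices, with bracket [A,B] = AB − BA and grading by superdiagonals V_i = {A ∈ 𝔫_ℍ : A_{jk} = 0 whenever k − j ≠ i}. Let φ : 𝔫_ℍ → 𝔫_ℍ be a graded automorphism, i.e. an ℝ-linear Lie algebra automorphism with φ(V_i) = V_i for all i. Then there exist ε ∈ {0,1}, a ring automorphism h of ℍ, and an invertible diagonal quaternion matrix g = diag(λ₁,…,λₙ) such that φ = τ^ε ∘ ĥ ∘ Ad_g, where Ad_g(A) = g A g⁻¹, ĥ applies h to each entry of the matrix, τ is defined by (τ(A))_{i,j} = −conj(A_{n−j+1, n−i+1}) with conj the quaternionic conjugation, τ⁰ = id and τ¹ = τ. -/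
open scoped Quaternion

/-- The real Lie algebra `𝔫_ℍ` of strictly upper triangular `n×n` quaternion
matrices, as a real submodule. -/
def strictlyUpperH (n : ℕ) : Submodule ℝ (Matrix (Fin n) (Fin n) ℍ[ℝ]) where
  carrier := {A | ∀ i j : Fin n, j ≤ i → A i j = 0}
  add_mem' := fun ha hb i j h => by
    simp only [Matrix.add_apply, ha i j h, hb i j h, add_zero]
  zero_mem' := fun i j _ => rfl
  smul_mem' := fun c A hA i j h => by
    simp only [Matrix.smul_apply, hA i j h, smul_zero]

/-- The `i`-th layer `V_i` of the grading of `𝔫_ℍ`. -/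
def superdiagH (n i : ℕ) : Submodule ℝ (Matrix (Fin n) (Fin n) ℍ[ℝ]) where
  carrier := {A | ∀ a b : Fin n, (b : ℕ) ≠ (a : ℕ) + i → A a b = 0}
  add_mem' := fun ha hb a b h => by
    simp only [Matrix.add_apply, ha a b h, hb a b h, add_zero]
  zero_mem' := fun a b _ => rfl
  smul_mem' := fun c A hA a b h => by
    simp only [Matrix.smul_apply, hA a b h, smul_zero]

/-- The graded automorphism `τ` of `𝔫_ℍ`,
`(τ A)_{i,j} = -conj (A_{n-j+1, n-i+1})` (1-indexed; `Fin.rev` here). -/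
def tauH (n : ℕ) (A : Matrix (Fin n) (Fin n) ℍ[ℝ]) : Matrix (Fin n) (Fin n) ℍ[ℝ] :=
  Matrix.of fun i j => - star (A j.rev i.rev)

open Matrix

/-- A linear map restricting to a graded Lie algebra automorphism of `𝔫_ℍ`. -/
structure IsGradedAutH (n : ℕ)
    (φ : Matrix (Fin n) (Fin n) ℍ[ℝ] →ₗ[ℝ] Matrix (Fin n) (Fin n) ℍ[ℝ]) : Prop where
  map_layer : ∀ i : ℕ, 1 ≤ i → Submodule.map φ (superdiagH n i) = superdiagH n i
  map_bracket : ∀ A ∈ strictlyUpperH n, ∀ B ∈ strictlyUpperH n,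
    φ (A * B - B * A) = φ A * φ B - φ B * φ A
  eq_zero : ∀ A ∈ strictlyUpperH n, φ A = 0 → A = 0

section layers

variable {n : ℕ}

theorem superdiagH_le {i : ℕ} (hi : 1 ≤ i) : superdiagH n i ≤ strictlyUpperH n := by
  intro A hA a b hab
  have : (b : ℕ) ≤ a := hab
  exact hA a b (by omega)

theorem single_mem_superdiagH {i : ℕ} {a b : Fin n} (h : (b : ℕ) = a + i) (x : ℍ[ℝ]) :
    single a b x ∈ superdiagH n i := by
  intro c d hcd
  rw [single_apply, if_neg]
  rintro ⟨rfl, rfl⟩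
  exact hcd h

theorem single_mem_strictlyUpperH {a b : Fin n} (h : a < b) (x : ℍ[ℝ]) :
    single a b x ∈ strictlyUpperH n := by
  have : (a : ℕ) < b := h
  exact superdiagH_le (i := (b : ℕ) - a) (by omega) (single_mem_superdiagH (by omega) x)

theorem mul_apply_of_mem_superdiagH {i : ℕ} {A : Matrix (Fin n) (Fin n) ℍ[ℝ]}
    (hA : A ∈ superdiagH n i) (B : Matrix (Fin n) (Fin n) ℍ[ℝ]) {a c : Fin n}
    (h : (c : ℕ) = a + i) (b : Fin n) : (A * B) a b = A a c * B c b := by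
  rw [mul_apply]
  refine Finset.sum_eq_single c (fun d _ hd => ?_) (by simp)
  rw [hA a d, zero_mul]
  intro h'
  exact hd (Fin.ext (by omega))

theorem mul_apply_of_mem_superdiagH_right {i : ℕ} (A : Matrix (Fin n) (Fin n) ℍ[ℝ])
    {B : Matrix (Fin n) (Fin n) ℍ[ℝ]} (hB : B ∈ superdiagH n i) {b c : Fin n}
    (h : (b : ℕ) = c + i) (a : Fin n) : (A * B) a b = A a c * B c b := by
  rw [mul_apply]
  refine Finset.sum_eq_single c (fun d _ hd => ?_) (by simp)
  rw [hB d b, mul_zero]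
  intro h'
  exact hd (Fin.ext (by omega))

theorem mul_mem_superdiagH {i j : ℕ} {A B : Matrix (Fin n) (Fin n) ℍ[ℝ]}
    (hA : A ∈ superdiagH n i) (hB : B ∈ superdiagH n j) : A * B ∈ superdiagH n (i + j) := by
  intro a b hab
  rw [mul_apply]
  refine Finset.sum_eq_zero fun c _ => ?_
  by_cases h : (c : ℕ) = a + i
  · rw [hB c b (by omega), mul_zero]
  · rw [hA a c h, zero_mul]

theorem bracket_mem_superdiagH {i j : ℕ} {A B : Matrix (Fin n) (Fin n) ℍ[ℝ]}
    (hA : A ∈ superdiagH n i) (hB : B ∈ superdiagH n j) :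
    A * B - B * A ∈ superdiagH n (i + j) :=
  sub_mem (mul_mem_superdiagH hA hB) (add_comm j i ▸ mul_mem_superdiagH hB hA)

end layers

section tau

variable {n : ℕ}

/-- `tauH` as a linear map. -/
def tauLinH (n : ℕ) : Matrix (Fin n) (Fin n) ℍ[ℝ] →ₗ[ℝ] Matrix (Fin n) (Fin n) ℍ[ℝ] where
  toFun := tauH n
  map_add' A B := by ext1 i j; simp [tauH, add_comm]
  map_smul' c A := by ext1 i j; simp [tauH]

@[simp]
theorem tauLinH_apply (A : Matrix (Fin n) (Fin n) ℍ[ℝ]) (i j : Fin n) :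
    tauLinH n A i j = -star (A j.rev i.rev) := rfl

theorem tauLinH_tauLinH (A : Matrix (Fin n) (Fin n) ℍ[ℝ]) : tauLinH n (tauLinH n A) = A := by
  ext1 i j
  simp

theorem tauLinH_mem_superdiagH {i : ℕ} {A : Matrix (Fin n) (Fin n) ℍ[ℝ]}
    (hA : A ∈ superdiagH n i) : tauLinH n A ∈ superdiagH n i := by
  intro a b hab
  rw [tauLinH_apply, hA, star_zero, neg_zero]
  simp only [Fin.val_rev]
  omega

theorem tauLinH_mul (A B : Matrix (Fin n) (Fin n) ℍ[ℝ]) :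
    tauLinH n A * tauLinH n B = -tauLinH n (B * A) := by
  ext1 i j
  simp only [mul_apply, Matrix.neg_apply, tauLinH_apply, neg_mul_neg, neg_neg, star_sum, star_mul]
  exact Fintype.sum_equiv Fin.revPerm (fun k => star (A k.rev i.rev) * star (B j.rev k.rev))
    (fun k => star (A k i.rev) * star (B j.rev k)) fun k => by simp

theorem isGradedAutH_tauLinH : IsGradedAutH n (tauLinH n) where
  map_layer i _ := by
    refine le_antisymm ?_ fun A hA => ⟨tauLinH n A, tauLinH_mem_superdiagH hA, tauLinH_tauLinH A⟩
    rintro _ ⟨A, hA, rfl⟩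
    exact tauLinH_mem_superdiagH hA
  map_bracket A _ B _ := by
    rw [tauLinH_mul, tauLinH_mul, map_sub]
    abel
  eq_zero A _ h := by rw [← tauLinH_tauLinH A, h, map_zero]

end tau

namespace IsGradedAutH

variable {n : ℕ} {φ ψ : Matrix (Fin n) (Fin n) ℍ[ℝ] →ₗ[ℝ] Matrix (Fin n) (Fin n) ℍ[ℝ]}

theorem map_mem (hφ : IsGradedAutH n φ) {i : ℕ} (hi : 1 ≤ i) {A : Matrix (Fin n) (Fin n) ℍ[ℝ]}
    (hA : A ∈ superdiagH n i) : φ A ∈ superdiagH n i :=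
  hφ.map_layer i hi ▸ Submodule.mem_map_of_mem hA

theorem exists_eq (hφ : IsGradedAutH n φ) {i : ℕ} (hi : 1 ≤ i)
    {A : Matrix (Fin n) (Fin n) ℍ[ℝ]} (hA : A ∈ superdiagH n i) :
    ∃ B ∈ superdiagH n i, φ B = A := by
  rw [← hφ.map_layer i hi] at hA
  exact hA

theorem map_apply_eq_sum (hφ : IsGradedAutH n φ) {A : Matrix (Fin n) (Fin n) ℍ[ℝ]}
    (hA : A ∈ strictlyUpperH n) (c d : Fin n) {y : ℍ[ℝ]} (a₀ b₀ : Fin n)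
    (h₀ : φ (single a₀ b₀ (A a₀ b₀)) c d = y)
    (h : ∀ a b : Fin n, a < b → (b : ℕ) + c = d + a → (a ≠ a₀ ∨ b ≠ b₀) →
      φ (single a b (A a b)) c d = 0) : φ A c d = y := by
  have key : ∀ a b : Fin n, (a ≠ a₀ ∨ b ≠ b₀) → φ (single a b (A a b)) c d = 0 := by
    intro a b hab
    by_cases h1 : a < b
    · by_cases h2 : (b : ℕ) + c = d + a
      · exact h a b h1 h2 hab
      · have h1' : (a : ℕ) < b := h1
        exact hφ.map_mem (i := (b : ℕ) - a) (by omega) (single_mem_superdiagH (by omega) _) c d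
          (by omega)
    · rw [hA a b (not_lt.mp h1), single_zero, map_zero, Matrix.zero_apply]
  conv_lhs => rw [matrix_eq_sum_single A]
  rw [map_sum, Matrix.sum_apply, Finset.sum_eq_single a₀, map_sum, Matrix.sum_apply,
    Finset.sum_eq_single b₀, h₀]
  · exact fun b _ hb => key a₀ b (Or.inr hb)
  · simp
  · intro a _ ha
    rw [map_sum, Matrix.sum_apply]
    exact Finset.sum_eq_zero fun b _ => key a b (Or.inl ha)
  · simp

theorem map_mem_strictlyUpperH (hφ : IsGradedAutH n φ) {A : Matrix (Fin n) (Fin n) ℍ[ℝ]}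
    (hA : A ∈ strictlyUpperH n) : φ A ∈ strictlyUpperH n := by
  intro c d hdc
  have hdc' : (d : ℕ) ≤ c := hdc
  refine hφ.map_apply_eq_sum hA c d c d ?_ fun a b hab h _ => ?_
  · rw [hA c d hdc, single_zero, map_zero, Matrix.zero_apply]
  · have hab' : (a : ℕ) < b := hab
    omega

theorem comp (hφ : IsGradedAutH n φ) (hψ : IsGradedAutH n ψ) : IsGradedAutH n (φ ∘ₗ ψ) where
  map_layer i hi := by rw [Submodule.map_comp, hψ.map_layer i hi, hφ.map_layer i hi]
  map_bracket A hA B hB := by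
    rw [LinearMap.comp_apply, hψ.map_bracket A hA B hB,
      hφ.map_bracket _ (hψ.map_mem_strictlyUpperH hA) _ (hψ.map_mem_strictlyUpperH hB)]
    rfl
  eq_zero A hA h := hψ.eq_zero A hA (hφ.eq_zero _ (hψ.map_mem_strictlyUpperH hA) h)

theorem bracket_eq_zero_iff (hφ : IsGradedAutH n φ) {i j : ℕ} (hi : 1 ≤ i) (hj : 1 ≤ j)
    {A B : Matrix (Fin n) (Fin n) ℍ[ℝ]} (hA : A ∈ superdiagH n i) (hB : B ∈ superdiagH n j) :
    φ A * φ B - φ B * φ A = 0 ↔ A * B - B * A = 0 := by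
  rw [← hφ.map_bracket A (superdiagH_le hi hA) B (superdiagH_le hj hB)]
  refine ⟨hφ.eq_zero _ (superdiagH_le (i := i + j) (by omega) (bracket_mem_superdiagH hA hB)),
    fun h => ?_⟩
  rw [h, map_zero]

end IsGradedAutH

section pairing

variable {m : ℕ} {φ : Matrix (Fin (m + 3)) (Fin (m + 3)) ℍ[ℝ] →ₗ[ℝ]
  Matrix (Fin (m + 3)) (Fin (m + 3)) ℍ[ℝ]}

theorem bracket_eq_zero_iff_corner {v w : Matrix (Fin (m + 3)) (Fin (m + 3)) ℍ[ℝ]}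
    (hv : v ∈ superdiagH (m + 3) 1) (hw : w ∈ superdiagH (m + 3) (m + 1)) :
    v * w - w * v = 0 ↔
      v 0 1 * w 1 (Fin.rev 0) = w 0 (Fin.rev 1) * v (Fin.rev 1) (Fin.rev 0) := by
  have hc : (v * w - w * v) 0 (Fin.rev 0) =
      v 0 1 * w 1 (Fin.rev 0) - w 0 (Fin.rev 1) * v (Fin.rev 1) (Fin.rev 0) := by
    rw [Matrix.sub_apply, mul_apply_of_mem_superdiagH hv w (c := 1) (by simp),
      mul_apply_of_mem_superdiagH hw v (c := Fin.rev 1) (by simp [Fin.val_rev])]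
  constructor
  · intro h
    rw [h, Matrix.zero_apply] at hc
    exact (sub_eq_zero.mp hc.symm)
  · intro h
    ext1 a b
    by_cases hab : a = 0 ∧ b = Fin.rev 0
    · rw [hab.1, hab.2, hc, h, sub_self, Matrix.zero_apply]
    · refine bracket_mem_superdiagH hv hw a b fun h' => hab ?_
      have := b.isLt
      constructor <;> apply Fin.ext <;> simp only [Fin.val_rev, Fin.val_zero] <;> omega

/-- The element of the next to last layer with the two given entries. -/
noncomputable def penultimateH (m : ℕ) (u w : ℍ[ℝ]) : Matrix (Fin (m + 3)) (Fin (m + 3)) ℍ[ℝ] :=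
  single 0 (Fin.rev 1) u + single 1 (Fin.rev 0) w

theorem penultimateH_mem (u w : ℍ[ℝ]) : penultimateH m u w ∈ superdiagH (m + 3) (m + 1) :=
  add_mem (single_mem_superdiagH (by simp [Fin.val_rev]) _)
    (single_mem_superdiagH (by simp; omega) _)

@[simp]
theorem penultimateH_left (u w : ℍ[ℝ]) : penultimateH m u w 0 (Fin.rev 1) = u := by
  simp [penultimateH]

@[simp]
theorem penultimateH_right (u w : ℍ[ℝ]) : penultimateH m u w 1 (Fin.rev 0) = w := by
  simp [penultimateH]

theorem ends_eq_zero_iff {v : Matrix (Fin (m + 3)) (Fin (m + 3)) ℍ[ℝ]}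
    (hv : v ∈ superdiagH (m + 3) 1) :
    (v 0 1 = 0 ∧ v (Fin.rev 1) (Fin.rev 0) = 0) ↔
      ∀ w ∈ superdiagH (m + 3) (m + 1), v * w - w * v = 0 := by
  constructor
  · rintro ⟨h1, h2⟩ w hw
    rw [bracket_eq_zero_iff_corner hv hw, h1, h2, zero_mul, mul_zero]
  · intro h
    have h1 := (bracket_eq_zero_iff_corner hv (penultimateH_mem 0 1)).mp
      (h _ (penultimateH_mem 0 1))
    have h2 := (bracket_eq_zero_iff_corner hv (penultimateH_mem 1 0)).mp
      (h _ (penultimateH_mem 1 0))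
    rw [penultimateH_left, penultimateH_right, mul_one, zero_mul] at h1
    rw [penultimateH_left, penultimateH_right, mul_zero, one_mul] at h2
    exact ⟨h1, h2.symm⟩

theorem IsGradedAutH.ends_eq_zero_iff_map (hφ : IsGradedAutH (m + 3) φ)
    {v : Matrix (Fin (m + 3)) (Fin (m + 3)) ℍ[ℝ]} (hv : v ∈ superdiagH (m + 3) 1) :
    (φ v 0 1 = 0 ∧ φ v (Fin.rev 1) (Fin.rev 0) = 0) ↔
      (v 0 1 = 0 ∧ v (Fin.rev 1) (Fin.rev 0) = 0) := by
  rw [ends_eq_zero_iff hv, ends_eq_zero_iff (hφ.map_mem le_rfl hv)]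
  constructor
  · intro h w hw
    exact (hφ.bracket_eq_zero_iff le_rfl (by omega) hv hw).mp (h _ (hφ.map_mem (by omega) hw))
  · intro h w hw
    obtain ⟨w, hw', rfl⟩ := hφ.exists_eq (by omega) hw
    exact (hφ.bracket_eq_zero_iff le_rfl (by omega) hv hw').mpr (h w hw')

/-- The imaginary unit `i` of `ℍ`. -/
def unitI : ℍ[ℝ] := ⟨0, 1, 0, 0⟩

/-- The imaginary unit `j` of `ℍ`. -/
def unitJ : ℍ[ℝ] := ⟨0, 0, 1, 0⟩

theorem exists_coe_eq_of_forall_commute {t : ℍ[ℝ]} (h : ∀ u, t * u = u * t) :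
    ∃ r : ℝ, t = r := by
  have h1 := Quaternion.ext_iff.mp (h unitI)
  have h2 := Quaternion.ext_iff.mp (h unitJ)
  simp only [Quaternion.re_mul, Quaternion.imI_mul, Quaternion.imJ_mul, Quaternion.imK_mul]
    at h1 h2
  simp only [unitI, unitJ] at h1 h2
  obtain ⟨-, -, h1J, h1K⟩ := h1
  obtain ⟨-, -, -, h2K⟩ := h2
  refine ⟨t.re, Quaternion.ext _ _ rfl ?_ ?_ ?_⟩ <;>
    simp only [Quaternion.imI_coe, Quaternion.imJ_coe, Quaternion.imK_coe] <;> linarith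

theorem eq_zero_of_unitI_mul_eq {x : ℍ[ℝ]} {r : ℝ} (h : unitI * x = r * x) : x = 0 := by
  by_contra hx
  have := congrArg QuaternionAlgebra.imI (show unitI = r from mul_right_cancel₀ hx h)
  simp [unitI] at this

theorem eq_zero_of_mul_unitI_eq {x : ℍ[ℝ]} {r : ℝ} (h : x * unitI = r * x) : x = 0 := by
  by_contra hx
  rw [Quaternion.coe_commutes] at h
  have := congrArg QuaternionAlgebra.imI (show unitI = r from mul_left_cancel₀ hx h)
  simp [unitI] at this

/-- If both end entries of `v` are nonzero, its double centralizer through the next to last layer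
consists, up to elements with zero end entries, of real multiples of `v`. -/
theorem exists_real_of_double_centralizer {v v' : Matrix (Fin (m + 3)) (Fin (m + 3)) ℍ[ℝ]}
    (hv : v ∈ superdiagH (m + 3) 1) (hv' : v' ∈ superdiagH (m + 3) 1)
    (h : ∀ w ∈ superdiagH (m + 3) (m + 1), v * w - w * v = 0 → v' * w - w * v' = 0)
    (h1 : v 0 1 ≠ 0) (h2 : v (Fin.rev 1) (Fin.rev 0) ≠ 0) :
    ∃ r : ℝ, v' 0 1 = r * v 0 1 ∧
      v' (Fin.rev 1) (Fin.rev 0) = r * v (Fin.rev 1) (Fin.rev 0) := by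
  set x := v 0 1
  set y := v (Fin.rev 1) (Fin.rev 0)
  have key : ∀ u, v' 0 1 * (x⁻¹ * (u * y)) = u * v' (Fin.rev 1) (Fin.rev 0) := by
    intro u
    have hw := penultimateH_mem (m := m) u (x⁻¹ * (u * y))
    have := (bracket_eq_zero_iff_corner hv' hw).mp <| h _ hw <|
      (bracket_eq_zero_iff_corner hv hw).mpr (by
        rw [penultimateH_left, penultimateH_right, mul_inv_cancel_left₀ h1])
    rwa [penultimateH_left, penultimateH_right] at this
  have key1 := key 1
  rw [one_mul, one_mul] at key1
  obtain ⟨r, hr⟩ := exists_coe_eq_of_forall_commute (t := v' 0 1 * x⁻¹) (by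
    intro u
    have := key u
    rw [← key1] at this
    apply mul_right_cancel₀ h2
    simpa only [mul_assoc] using this)
  refine ⟨r, ?_, ?_⟩
  · rw [← hr, inv_mul_cancel_right₀ h1]
  · rw [← key1, ← hr, mul_assoc]

open Classical in
theorem IsGradedAutH.map_end_eq_zero (hφ : IsGradedAutH (m + 3) φ)
    {v : Matrix (Fin (m + 3)) (Fin (m + 3)) ℍ[ℝ]} (hv : v ∈ superdiagH (m + 3) 1)
    (h : v 0 1 = 0 ∨ v (Fin.rev 1) (Fin.rev 0) = 0) :
    φ v 0 1 = 0 ∨ φ v (Fin.rev 1) (Fin.rev 0) = 0 := by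
  by_contra! hne
  have hvK : ¬(v 0 1 = 0 ∧ v (Fin.rev 1) (Fin.rev 0) = 0) := fun hK =>
    hne.1 ((hφ.ends_eq_zero_iff_map hv).mpr hK).1
  set v' : Matrix (Fin (m + 3)) (Fin (m + 3)) ℍ[ℝ] :=
    if v 0 1 = 0 then of fun a b => v a b * unitI else of fun a b => unitI * v a b with hv'def
  have hv' : v' ∈ superdiagH (m + 3) 1 := by
    intro a b hab
    rw [hv'def]
    split_ifs <;> simp [hv a b hab]
  have hcent : ∀ w ∈ superdiagH (m + 3) (m + 1), v * w - w * v = 0 → v' * w - w * v' = 0 := by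
    intro w hw hvw
    rw [bracket_eq_zero_iff_corner hv hw] at hvw
    rw [bracket_eq_zero_iff_corner hv' hw, hv'def]
    split_ifs with h0
    · rw [h0, zero_mul] at hvw
      simp only [of_apply, h0, zero_mul, ← mul_assoc, ← hvw]
    · rw [h.resolve_left h0, mul_zero] at hvw
      simp only [of_apply, h.resolve_left h0, mul_zero, mul_assoc, hvw]
  have hcent' : ∀ w ∈ superdiagH (m + 3) (m + 1),
      φ v * w - w * φ v = 0 → φ v' * w - w * φ v' = 0 := by
    intro w hw
    obtain ⟨w, hw', rfl⟩ := hφ.exists_eq (by omega) hw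
    rw [hφ.bracket_eq_zero_iff le_rfl (by omega) hv hw',
      hφ.bracket_eq_zero_iff le_rfl (by omega) hv' hw']
    exact hcent w hw'
  obtain ⟨r, hr1, hr2⟩ := exists_real_of_double_centralizer (hφ.map_mem le_rfl hv)
    (hφ.map_mem le_rfl hv') hcent' hne.1 hne.2
  have hK := (hφ.ends_eq_zero_iff_map (sub_mem hv' (Submodule.smul_mem _ r hv))).mp (by
    rw [map_sub, map_smul, Matrix.sub_apply, Matrix.sub_apply, Matrix.smul_apply, Matrix.smul_apply,
      hr1, hr2, Quaternion.coe_mul_eq_smul, Quaternion.coe_mul_eq_smul, sub_self, sub_self]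
    exact ⟨rfl, rfl⟩)
  simp only [Matrix.sub_apply, Matrix.smul_apply, sub_eq_zero, ← Quaternion.coe_mul_eq_smul] at hK
  refine hvK ?_
  rw [hv'def] at hK
  split_ifs at hK with h0
  · exact ⟨h0, eq_zero_of_mul_unitI_eq hK.2⟩
  · exact ⟨eq_zero_of_unitI_mul_eq hK.1, h.resolve_left h0⟩

end pairing

theorem forall_eq_zero_or_forall_eq_zero {M N N' : Type*} [AddCommGroup M] [AddCommGroup N]
    [AddCommGroup N'] (S : AddSubgroup M) (f : M →+ N) (g : M →+ N')
    (h : ∀ v ∈ S, f v = 0 ∨ g v = 0) : (∀ v ∈ S, f v = 0) ∨ ∀ v ∈ S, g v = 0 := by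
  by_contra! hne
  obtain ⟨⟨v, hv, hfv⟩, w, hw, hgw⟩ := hne
  have hgv := (h v hv).resolve_left hfv
  have hfw := (h w hw).resolve_right hgw
  rcases h (v + w) (add_mem hv hw) with h' | h'
  · rw [map_add, hfw, add_zero] at h'
    exact hfv h'
  · rw [map_add, hgv, zero_add] at h'
    exact hgw h'

section classification

variable {m : ℕ} {φ : Matrix (Fin (m + 3)) (Fin (m + 3)) ℍ[ℝ] →ₗ[ℝ]
  Matrix (Fin (m + 3)) (Fin (m + 3)) ℍ[ℝ]}

namespace IsGradedAutH

theorem map_row_penultimate (hφ : IsGradedAutH (m + 3) φ)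
    (hP : ∀ v ∈ superdiagH (m + 3) 1, v (Fin.rev 1) (Fin.rev 0) = 0 →
      φ v (Fin.rev 1) (Fin.rev 0) = 0)
    {A : Matrix (Fin (m + 3)) (Fin (m + 3)) ℍ[ℝ]} (hA : A ∈ superdiagH (m + 3) (m + 1))
    (h : A 1 (Fin.rev 0) = 0) : φ A 1 (Fin.rev 0) = 0 := by
  have hv : (single 0 1 1 : Matrix (Fin (m + 3)) (Fin (m + 3)) ℍ[ℝ]) ∈ superdiagH (m + 3) 1 :=
    single_mem_superdiagH (by simp) 1
  have hvl : (single 0 1 1 : Matrix (Fin (m + 3)) (Fin (m + 3)) ℍ[ℝ])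
      (Fin.rev 1) (Fin.rev 0) = 0 := by
    rw [single_apply, if_neg]
    rintro ⟨h0, -⟩
    have := congrArg Fin.val h0
    simp [Fin.val_rev] at this
  have hφl := hP _ hv hvl
  have hφ0 : φ (single 0 1 1) 0 1 ≠ 0 := fun h0 => by
    have := ((hφ.ends_eq_zero_iff_map hv).mp ⟨h0, hφl⟩).1
    simp at this
  have hc := (hφ.bracket_eq_zero_iff le_rfl (by omega) hv hA).mpr
    ((bracket_eq_zero_iff_corner hv hA).mpr (by rw [h, hvl, mul_zero, mul_zero]))
  rw [bracket_eq_zero_iff_corner (hφ.map_mem le_rfl hv) (hφ.map_mem (by omega) hA), hφl,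
    mul_zero] at hc
  exact (mul_eq_zero.mp hc).resolve_left hφ0

theorem map_row (hφ : IsGradedAutH (m + 3) φ)
    (hP : ∀ v ∈ superdiagH (m + 3) 1, v (Fin.rev 1) (Fin.rev 0) = 0 →
      φ v (Fin.rev 1) (Fin.rev 0) = 0) {i : ℕ} (hi : 1 ≤ i)
    {A : Matrix (Fin (m + 3)) (Fin (m + 3)) ℍ[ℝ]} (hA : A ∈ superdiagH (m + 3) i)
    (hrow : ∀ a b, a ≠ 0 → A a b = 0) (a b : Fin (m + 3)) (ha : a ≠ 0) : φ A a b = 0 := by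
  have ha' : (a : ℕ) ≠ 0 := fun h => ha (Fin.ext h)
  by_cases hb : (b : ℕ) = a + i
  swap
  · exact hφ.map_mem hi hA a b hb
  have hb' := b.isLt
  obtain ⟨k, hk⟩ : ∃ k, i + k = m + 1 := ⟨m + 1 - i, by omega⟩
  induction k generalizing i A a b with
  | zero =>
    obtain rfl : i = m + 1 := by omega
    obtain rfl : a = 1 := Fin.ext (by rw [Fin.val_one]; omega)
    obtain rfl : b = Fin.rev 0 := Fin.ext (by rw [Fin.val_rev, Fin.val_zero]; omega)
    exact hφ.map_row_penultimate hP hA (hrow _ _ ha)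
  | succ k ih =>
    have key : ∀ B ∈ superdiagH (m + 3) 1, ∀ c d, c ≠ 0 →
        (φ A * B) c d = (B * φ A) c d := by
      intro B hB c d hc
      obtain ⟨B, hB', rfl⟩ := hφ.exists_eq le_rfl hB
      rw [← sub_eq_zero, ← Matrix.sub_apply,
        ← hφ.map_bracket A (superdiagH_le hi hA) B (superdiagH_le le_rfl hB')]
      have hmem := bracket_mem_superdiagH hA hB'
      by_cases hd : (d : ℕ) = c + (i + 1)
      · refine ih (by omega) hmem (fun a' b' ha' => ?_) c d hc (fun h => hc (Fin.ext h)) hd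
          d.isLt (by omega)
        rw [Matrix.sub_apply, mul_apply, mul_apply, Finset.sum_eq_zero, Finset.sum_eq_zero,
          sub_zero]
        · intro e _
          by_cases he : e = 0
          · rw [he, hB' a' 0 (by simp), zero_mul]
          · rw [hrow e b' he, mul_zero]
        · intro e _
          rw [hrow a' e ha', zero_mul]
      · exact hφ.map_mem (by omega) hmem c d hd
    by_cases hbl : (b : ℕ) + 1 < m + 3
    · set b' : Fin (m + 3) := ⟨b + 1, hbl⟩
      have hB : (single b b' 1 : Matrix _ _ ℍ[ℝ]) ∈ superdiagH (m + 3) 1 :=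
        single_mem_superdiagH rfl 1
      have h := key _ hB a b' ha
      rw [mul_apply_of_mem_superdiagH_right _ hB (c := b) rfl, single_apply_same, mul_one,
        single_mul_apply_of_ne] at h
      · exact h
      · intro hab
        have := congrArg Fin.val hab
        omega
    · set a' : Fin (m + 3) := ⟨a - 1, by omega⟩
      have haa' : (a : ℕ) = a' + 1 := by simp only [a']; omega
      have hB : (single a' a 1 : Matrix _ _ ℍ[ℝ]) ∈ superdiagH (m + 3) 1 :=
        single_mem_superdiagH haa' 1
      have h := key _ hB a' b (fun h0 => by
        have := congrArg Fin.val h0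
        rw [Fin.val_zero] at this
        omega)
      rw [mul_apply_of_mem_superdiagH hB _ haa', single_apply_same, one_mul,
        mul_single_apply_of_ne] at h
      · exact h.symm
      · intro hab
        have := congrArg Fin.val hab
        omega

theorem map_col (hφ : IsGradedAutH (m + 3) φ)
    (hP : ∀ v ∈ superdiagH (m + 3) 1, v 0 1 = 0 → φ v 0 1 = 0) {i : ℕ} (hi : 1 ≤ i)
    {A : Matrix (Fin (m + 3)) (Fin (m + 3)) ℍ[ℝ]} (hA : A ∈ superdiagH (m + 3) i)
    (hcol : ∀ a b, b ≠ Fin.rev 0 → A a b = 0) (a b : Fin (m + 3)) (hb : b ≠ Fin.rev 0) :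
    φ A a b = 0 := by
  have hψ : IsGradedAutH (m + 3) (tauLinH _ ∘ₗ φ ∘ₗ tauLinH _) :=
    isGradedAutH_tauLinH.comp (hφ.comp isGradedAutH_tauLinH)
  have h := hψ.map_row (fun v hv h0 => by
    rw [LinearMap.comp_apply, LinearMap.comp_apply, tauLinH_apply, Fin.rev_rev, Fin.rev_rev,
      hP _ (tauLinH_mem_superdiagH hv) (by rw [tauLinH_apply, h0, star_zero, neg_zero]),
      star_zero, neg_zero]) hi (tauLinH_mem_superdiagH hA)
    (fun c d hc => by
      rw [tauLinH_apply, hcol _ _ fun h => hc (Fin.rev_injective h), star_zero, neg_zero])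
    b.rev a.rev (fun h => hb (by rw [← h, Fin.rev_rev]))
  simpa [tauLinH_tauLinH] using h

theorem map_apply_zero_left (hφ : IsGradedAutH (m + 3) φ)
    (hP : ∀ v ∈ superdiagH (m + 3) 1, v 0 1 = 0 → φ v 0 1 = 0)
    {A : Matrix (Fin (m + 3)) (Fin (m + 3)) ℍ[ℝ]} (hA : A ∈ strictlyUpperH (m + 3))
    {c : Fin (m + 3)} (hc : c ≠ 0) : φ A 0 c = φ (single 0 c (A 0 c)) 0 c := by
  have hc' : (c : ℕ) ≠ 0 := fun h => hc (Fin.ext h)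
  refine hφ.map_apply_eq_sum hA 0 c 0 c rfl fun a b hab h hne => ?_
  rw [Fin.val_zero] at h
  have hab' : (a : ℕ) < b := hab
  have hbl := b.isLt
  have ha : (a : ℕ) ≠ 0 := by
    intro ha
    exact hne.elim (fun h' => h' (Fin.ext ha)) fun h' => h' (Fin.ext (by omega))
  set l : Fin (m + 3) := Fin.rev 0 with hl
  have hlv : (l : ℕ) = m + 2 := by simp [hl]
  have hE : single a b (A a b) ∈ superdiagH (m + 3) c := single_mem_superdiagH (by omega) _
  have hT : (single c l 1 : Matrix _ _ ℍ[ℝ]) ∈ superdiagH (m + 3) (m + 2 - c) :=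
    single_mem_superdiagH (by omega) 1
  have hTcol : ∀ d e, e ≠ l → φ (single c l 1) d e = 0 :=
    hφ.map_col hP (by omega) hT fun d e he => by
      rw [single_apply, if_neg]
      exact fun h' => he h'.2.symm
  have hφT := hφ.map_mem (by omega) hT
  have hg : φ (single c l 1) c l ≠ 0 := by
    intro h0
    have : (single c l 1 : Matrix _ _ ℍ[ℝ]) = 0 :=
      hφ.eq_zero _ (superdiagH_le (by omega) hT) (by
        ext1 d e
        by_cases he : e = l
        · by_cases hd : d = c
          · rw [hd, he, h0, Matrix.zero_apply]
          · refine hφT d e fun h' => hd (Fin.ext ?_)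
            rw [he] at h'
            omega
        · exact hTcol d e he)
    have := congrFun (congrFun this c) l
    simp at this
  have hbr := (hφ.bracket_eq_zero_iff (by omega) (by omega) hE hT).mpr (by
    rw [single_mul_single_of_ne, single_mul_single_of_ne, sub_zero]
    · intro h'
      have := congrArg Fin.val h'
      omega
    · intro h'
      have := congrArg Fin.val h'
      omega)
  have h0l := congrFun (congrFun hbr 0) l
  rw [Matrix.sub_apply, mul_apply_of_mem_superdiagH (hφ.map_mem (by omega) hE) _ (c := c)
    (by simp), mul_apply (M := φ (single c l 1)), Finset.sum_eq_zero, sub_zero] at h0l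
  · exact (mul_eq_zero.mp h0l).resolve_right hg
  · intro d _
    by_cases hd : d = l
    · rw [hd, hφT 0 l (by rw [Fin.val_zero]; omega), zero_mul]
    · rw [hTcol 0 d hd, zero_mul]

end IsGradedAutH

theorem mul_mem_strictlyUpperH {n : ℕ} {A B : Matrix (Fin n) (Fin n) ℍ[ℝ]}
    (hA : A ∈ strictlyUpperH n) (hB : B ∈ strictlyUpperH n) : A * B ∈ strictlyUpperH n := by
  intro a b hab
  rw [mul_apply]
  refine Finset.sum_eq_zero fun c _ => ?_
  rcases le_or_gt c a with h | h
  · rw [hA a c h, zero_mul]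
  · rw [hB c b (hab.trans h.le), mul_zero]

/-- The action of a linear map on the entry `(0, c)`. -/
noncomputable def firstRowMap (φ : Matrix (Fin (m + 3)) (Fin (m + 3)) ℍ[ℝ] →ₗ[ℝ]
    Matrix (Fin (m + 3)) (Fin (m + 3)) ℍ[ℝ]) (c : Fin (m + 3)) : ℍ[ℝ] →ₗ[ℝ] ℍ[ℝ] :=
  Matrix.entryLinearMap ℝ ℍ[ℝ] 0 c ∘ₗ φ ∘ₗ Matrix.singleLinearMap ℝ 0 c

theorem firstRowMap_apply (c : Fin (m + 3)) (x : ℍ[ℝ]) :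
    firstRowMap φ c x = φ (single 0 c x) 0 c := rfl

namespace IsGradedAutH

theorem firstRowMap_mul (hφ : IsGradedAutH (m + 3) φ)
    (hP₀ : ∀ v ∈ superdiagH (m + 3) 1, v 0 1 = 0 → φ v 0 1 = 0)
    (hP₁ : ∀ v ∈ superdiagH (m + 3) 1, v (Fin.rev 1) (Fin.rev 0) = 0 →
      φ v (Fin.rev 1) (Fin.rev 0) = 0)
    {A : Matrix (Fin (m + 3)) (Fin (m + 3)) ℍ[ℝ]} (hA : A ∈ strictlyUpperH (m + 3))
    {b c : Fin (m + 3)} (hb : b ≠ 0) (hc : c ≠ 0) (x : ℍ[ℝ]) :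
    firstRowMap φ c (x * A b c) = firstRowMap φ b x * φ A b c := by
  have hb' : 1 ≤ (b : ℕ) := Nat.one_le_iff_ne_zero.mpr fun h => hb (Fin.ext h)
  have hSb : single 0 b x ∈ superdiagH (m + 3) b := single_mem_superdiagH (by simp) x
  have hS := superdiagH_le hb' hSb
  have h := congrFun (congrFun (hφ.map_bracket _ hS A hA) 0) c
  have hAS : (A * (single 0 b x : Matrix (Fin (m + 3)) (Fin (m + 3)) ℍ[ℝ])) 0 c = 0 := by
    by_cases hcb : c = b
    · rw [hcb, mul_single_apply_same, hA 0 0 le_rfl, zero_mul]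
    · rw [mul_single_apply_of_ne _ _ _ _ _ hcb]
  rw [hφ.map_apply_zero_left hP₀ (sub_mem (mul_mem_strictlyUpperH hS hA)
      (mul_mem_strictlyUpperH hA hS)) hc, Matrix.sub_apply, hAS, sub_zero, single_mul_apply_same,
    Matrix.sub_apply, mul_apply_of_mem_superdiagH (hφ.map_mem hb' hSb) _ (c := b) (by simp),
    mul_apply (M := φ A), Finset.sum_eq_zero, sub_zero] at h
  · exact h
  · intro d _
    by_cases hd : d = 0
    · rw [hd, hφ.map_mem_strictlyUpperH hA 0 0 le_rfl, zero_mul]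
    · rw [hφ.map_row hP₁ hb' hSb (fun a e ha => ?_) d c hd, mul_zero]
      rw [single_apply, if_neg]
      exact fun h' => ha h'.1.symm

theorem firstRowMap_eq_zero (hφ : IsGradedAutH (m + 3) φ)
    (hP₁ : ∀ v ∈ superdiagH (m + 3) 1, v (Fin.rev 1) (Fin.rev 0) = 0 →
      φ v (Fin.rev 1) (Fin.rev 0) = 0)
    {b : Fin (m + 3)} (hb : b ≠ 0) {x : ℍ[ℝ]} (h : firstRowMap φ b x = 0) : x = 0 := by
  have hb' : 1 ≤ (b : ℕ) := Nat.one_le_iff_ne_zero.mpr fun h => hb (Fin.ext h)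
  have hSb : single 0 b x ∈ superdiagH (m + 3) b := single_mem_superdiagH (by simp) x
  have h0 := hφ.eq_zero _ (superdiagH_le hb' hSb) (by
    ext1 d e
    by_cases hd : d = 0
    · by_cases he : e = b
      · rw [hd, he]
        exact h
      · refine hφ.map_mem hb' hSb d e fun h' => he (Fin.ext ?_)
        rw [h', hd, Fin.val_zero, zero_add]
    · refine hφ.map_row hP₁ hb' hSb (fun a e ha => ?_) d e hd
      rw [single_apply, if_neg]
      exact fun h' => ha h'.1.symm)
  have := congrFun (congrFun h0 0) b
  simpa using this

theorem exists_ringEquiv_diagonal (hφ : IsGradedAutH (m + 3) φ)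
    (hP₀ : ∀ v ∈ superdiagH (m + 3) 1, v 0 1 = 0 → φ v 0 1 = 0)
    (hP₁ : ∀ v ∈ superdiagH (m + 3) 1, v (Fin.rev 1) (Fin.rev 0) = 0 →
      φ v (Fin.rev 1) (Fin.rev 0) = 0) :
    ∃ (h : ℍ[ℝ] ≃+* ℍ[ℝ]) (lam : Fin (m + 3) → ℍ[ℝ]), (∀ i, lam i ≠ 0) ∧
      ∀ A ∈ strictlyUpperH (m + 3), φ A = Matrix.of fun a b =>
        h ((Matrix.diagonal lam * A * Matrix.diagonal fun i => (lam i)⁻¹) a b) := by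
  set F := firstRowMap φ
  have hkey : ∀ A ∈ strictlyUpperH (m + 3), ∀ {b c : Fin (m + 3)}, b ≠ 0 → c ≠ 0 → ∀ x,
      F c (x * A b c) = F b x * φ A b c := fun A hA b c => hφ.firstRowMap_mul hP₀ hP₁ hA
  have hF0 : ∀ {b : Fin (m + 3)}, b ≠ 0 → ∀ {x}, F b x = 0 → x = 0 := fun hb _ =>
    hφ.firstRowMap_eq_zero hP₁ hb
  have hF1 : ∀ {b : Fin (m + 3)}, b ≠ 0 → F b 1 ≠ 0 := fun hb h => one_ne_zero (hF0 hb h)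
  have h10 : (1 : Fin (m + 3)) ≠ 0 := one_ne_zero
  set p : ℍ[ℝ] →ₗ[ℝ] ℍ[ℝ] := LinearMap.mulRight ℝ (F 1 1)⁻¹ ∘ₗ F 1
  have hpF : ∀ x, F 1 x * (F 1 1)⁻¹ = p x := fun _ => rfl
  have hFp : ∀ {c : Fin (m + 3)}, c ≠ 0 → ∀ x, F c x = p x * F c 1 := by
    intro c hc x
    by_cases hc1 : c = 1
    · rw [hc1, ← hpF, inv_mul_cancel_right₀ (hF1 h10)]
    · have h1c : 1 < c := by
        have hv : (c : ℕ) ≠ 0 := fun h => hc (Fin.ext h)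
        have hv1 : (c : ℕ) ≠ 1 := fun h => hc1 (Fin.ext h)
        rw [Fin.lt_def, Fin.val_one]
        omega
      have hk := hkey _ (single_mem_strictlyUpperH h1c 1) h10 hc
      simp only [single_apply_same, mul_one] at hk
      rw [hk x, hk 1, ← hpF, mul_assoc, inv_mul_cancel_left₀ (hF1 h10)]
  have hentry : ∀ A ∈ strictlyUpperH (m + 3), ∀ {b c : Fin (m + 3)}, b ≠ 0 → c ≠ 0 →
      φ A b c = (F b 1)⁻¹ * p (A b c) * F c 1 := by
    intro A hA b c hb hc
    have hk := hkey A hA hb hc 1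
    rw [one_mul, hFp hc] at hk
    rw [mul_assoc, hk, inv_mul_cancel_left₀ (hF1 hb)]
  have hp1 : p 1 = 1 := by rw [← hpF, mul_inv_cancel₀ (hF1 h10)]
  have hpmul : ∀ x y, p (x * y) = p x * p y := by
    intro x y
    have h12 : (1 : Fin (m + 3)) < 2 := by
      rw [Fin.lt_def, Fin.val_one, Fin.val_two]
      omega
    have h20 : (2 : Fin (m + 3)) ≠ 0 := (bot_lt_of_lt h12).ne'
    have hS := single_mem_strictlyUpperH h12 y
    have hk := hkey _ hS h10 h20 x
    rw [hentry _ hS h10 h20, single_apply_same, hFp h20, ← mul_assoc, ← mul_assoc, hpF] at hk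
    exact mul_right_cancel₀ (hF1 h20) hk
  have hpinj : Function.Injective p := by
    rw [injective_iff_map_eq_zero]
    intro x hx
    refine hF0 h10 (x := x) ?_
    rw [hFp h10, hx, zero_mul]
  let pr : ℍ[ℝ] →+* ℍ[ℝ] :=
    { toFun := p, map_one' := hp1, map_mul' := hpmul, map_zero' := map_zero p,
      map_add' := map_add p }
  let h : ℍ[ℝ] ≃+* ℍ[ℝ] :=
    RingEquiv.ofBijective pr ⟨hpinj, LinearMap.injective_iff_surjective.mp hpinj⟩
  have hh : ∀ x, h x = p x := fun _ => rfl
  refine ⟨h, fun a => if a = 0 then 1 else h.symm (F a 1)⁻¹, fun a => ?_, fun A hA => ?_⟩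
  · dsimp only
    split_ifs with ha
    · exact one_ne_zero
    · exact (map_ne_zero h.symm).mpr (inv_ne_zero (hF1 ha))
  · ext1 a b
    rw [of_apply, mul_diagonal, diagonal_mul, map_mul, map_mul, hh (A a b)]
    dsimp only
    by_cases hb : b = 0
    · have hba : b ≤ a := hb ▸ Fin.zero_le a
      rw [hφ.map_mem_strictlyUpperH hA a b hba, hA a b hba, map_zero, mul_zero, zero_mul]
    · rw [if_neg hb, map_inv₀ h, RingEquiv.apply_symm_apply, inv_inv]
      by_cases ha : a = 0
      · rw [if_pos ha, map_one, one_mul, ← hFp hb, ha]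
        exact hφ.map_apply_zero_left hP₀ hA hb
      · rw [if_neg ha, RingEquiv.apply_symm_apply]
        exact hentry A hA ha hb

theorem ends_preserved_or_swapped (hφ : IsGradedAutH (m + 3) φ) :
    ((∀ v ∈ superdiagH (m + 3) 1, v 0 1 = 0 → φ v 0 1 = 0) ∧
      ∀ v ∈ superdiagH (m + 3) 1, v (Fin.rev 1) (Fin.rev 0) = 0 →
        φ v (Fin.rev 1) (Fin.rev 0) = 0) ∨
    ((∀ v ∈ superdiagH (m + 3) 1, v 0 1 = 0 → φ v (Fin.rev 1) (Fin.rev 0) = 0) ∧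
      ∀ v ∈ superdiagH (m + 3) 1, v (Fin.rev 1) (Fin.rev 0) = 0 → φ v 0 1 = 0) := by
  have hunion : ∀ a b : Fin (m + 3), (∀ v ∈ superdiagH (m + 3) 1, v a b = 0 →
        φ v 0 1 = 0 ∨ φ v (Fin.rev 1) (Fin.rev 0) = 0) →
      (∀ v ∈ superdiagH (m + 3) 1, v a b = 0 → φ v 0 1 = 0) ∨
        ∀ v ∈ superdiagH (m + 3) 1, v a b = 0 → φ v (Fin.rev 1) (Fin.rev 0) = 0 := by
    intro a b h
    have := forall_eq_zero_or_forall_eq_zero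
      (superdiagH (m + 3) 1 ⊓ LinearMap.ker (entryLinearMap ℝ ℍ[ℝ] a b)).toAddSubgroup
      (entryLinearMap ℝ ℍ[ℝ] 0 1 ∘ₗ φ).toAddMonoidHom
      (entryLinearMap ℝ ℍ[ℝ] (Fin.rev 1) (Fin.rev 0) ∘ₗ φ).toAddMonoidHom
      fun v hv => h v hv.1 hv.2
    exact this.imp (fun h v hv hv0 => h v ⟨hv, hv0⟩) fun h v hv hv0 => h v ⟨hv, hv0⟩
  have hsum : ∀ c d : Fin (m + 3), (d : ℕ) = c + 1 →
      (∀ v ∈ superdiagH (m + 3) 1, v 0 1 = 0 → φ v c d = 0) →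
      (∀ v ∈ superdiagH (m + 3) 1, v (Fin.rev 1) (Fin.rev 0) = 0 → φ v c d = 0) → False := by
    intro c d hcd h₀ h₁
    obtain ⟨v, hv, hφv⟩ := hφ.exists_eq le_rfl (single_mem_superdiagH hcd 1)
    have hs : single 0 1 (v 0 1) ∈ superdiagH (m + 3) 1 := single_mem_superdiagH (by simp) _
    have e₀ := h₀ (v - single 0 1 (v 0 1)) (sub_mem hv hs) (by simp)
    have e₁ := h₁ (single 0 1 (v 0 1)) hs (by
      rw [single_apply, if_neg]
      rintro ⟨h0, -⟩
      have := congrArg Fin.val h0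
      simp [Fin.val_rev] at this)
    rw [map_sub, Matrix.sub_apply, e₁, sub_zero, hφv, single_apply_same] at e₀
    exact one_ne_zero e₀
  have hrev : ((Fin.rev 0 : Fin (m + 3)) : ℕ) = (Fin.rev 1 : Fin (m + 3)) + 1 := by
    simp [Fin.val_rev]
  rcases hunion 0 1 fun v hv h => hφ.map_end_eq_zero hv (Or.inl h) with h₀ | h₀ <;>
    rcases hunion (Fin.rev 1) (Fin.rev 0) fun v hv h => hφ.map_end_eq_zero hv (Or.inr h)
      with h₁ | h₁
  · exact (hsum 0 1 (by simp) h₀ h₁).elim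
  · exact Or.inl ⟨h₀, h₁⟩
  · exact Or.inr ⟨h₀, h₁⟩
  · exact (hsum _ _ hrev h₀ h₁).elim

end IsGradedAutH

end classification

/-- Every graded automorphism of `𝔫_ℍ` (for `n ≥ 3`) is of the form
`τ^ε ∘ ĥ ∘ Ad_g` with `h` a ring automorphism of `ℍ` applied entrywise,
`g` an invertible diagonal quaternion matrix and `ε ∈ {0,1}`. -/
theorem graded_automorphism_classification_quaternion
    (n : ℕ) (hn : 3 ≤ n)
    (φ : Matrix (Fin n) (Fin n) ℍ[ℝ] →ₗ[ℝ] Matrix (Fin n) (Fin n) ℍ[ℝ])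
    (hgraded : ∀ i : ℕ, 1 ≤ i → Submodule.map φ (superdiagH n i) = superdiagH n i)
    (hbracket : ∀ A ∈ strictlyUpperH n, ∀ B ∈ strictlyUpperH n,
      φ (A * B - B * A) = φ A * φ B - φ B * φ A)
    (hinj : ∀ A ∈ strictlyUpperH n, φ A = 0 → A = 0) :
    ∃ (ε : Bool) (h : ℍ[ℝ] ≃+* ℍ[ℝ]) (lam : Fin n → ℍ[ℝ]), (∀ i, lam i ≠ 0) ∧
      ∀ A ∈ strictlyUpperH n,
        φ A = (cond ε (tauH n) id)
          (Matrix.of fun a b =>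
            h ((Matrix.diagonal lam * A * Matrix.diagonal fun i => (lam i)⁻¹) a b)) := by
  obtain ⟨m, rfl⟩ : ∃ m, n = m + 3 := ⟨n - 3, by omega⟩
  have hφ : IsGradedAutH (m + 3) φ := ⟨hgraded, hbracket, hinj⟩
  rcases hφ.ends_preserved_or_swapped with ⟨h₀, h₁⟩ | ⟨h₀, h₁⟩
  · obtain ⟨h, lam, hlam, H⟩ := hφ.exists_ringEquiv_diagonal h₀ h₁
    exact ⟨false, h, lam, hlam, H⟩
  · obtain ⟨h, lam, hlam, H⟩ := (isGradedAutH_tauLinH.comp hφ).exists_ringEquiv_diagonal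
      (fun v hv hv0 => by
        rw [LinearMap.comp_apply, tauLinH_apply, h₀ v hv hv0, star_zero, neg_zero])
      (fun v hv hv0 => by
        rw [LinearMap.comp_apply, tauLinH_apply, Fin.rev_rev, Fin.rev_rev, h₁ v hv hv0, star_zero,
          neg_zero])
    refine ⟨true, h, lam, hlam, fun A hA => ?_⟩
    rw [← H A hA]
    exact (tauLinH_tauLinH (φ A)).symm
end
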